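/- For every n ≥ 1 there exist constants C = C(n) ≥ 1 and K = K(n) ≥ 1 such that the following holds. Let U be an open subset of ℝⁿ, B a compact subset of U, and B′ a compact neighborhood of B in U, and let L ≥ 1. Then there exist δ₀ > 0 and an increasing continuous function χ : [0,∞) → [0,∞) with χ(0)=0 (depending on n, U, B, B′ and L) such that for every 0 < δ ≤ δ₀ and every open Lipschitz embedding h : U → ℝⁿ that is locally L-bi-Lipschitz and satisfies |h(x) − x| < δ for all x ∈ U, there exists a C·L^K-bi-Lipschitz homeomorphism h′ : ℝⁿ → ℝⁿ such that h′ = h on B, h′ = identity outside B′, and |h′(x) − x| ≤ χ(δ) for all x ∈ ℝⁿ. -/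

import Mathlib

open Topology Metric Set

universe u v

section Defs

variable {X Y : Type*}

/-- A (local) Lipschitz embedding: `f` is injective, locally Lipschitz, and its inverse
`f ⁻¹ : f(X) → X` is locally Lipschitz. -/
def IsLipschitzEmbedding [MetricSpace X] [MetricSpace Y] (f : X → Y) : Prop :=
  Function.Injective f ∧ LocallyLipschitz f ∧
    ∃ g : Set.range f → X, Function.LeftInverse g (Set.rangeFactorization f) ∧ LocallyLipschitz g

/-- An open Lipschitz embedding: a Lipschitz embedding with open image. -/
def IsOpenLipschitzEmbedding [MetricSpace X] [MetricSpace Y] (f : X → Y) : Prop :=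
  IsLipschitzEmbedding f ∧ IsOpen (Set.range f)

/-- A Lipschitz isomorphism: a surjective Lipschitz embedding. -/
def IsLipschitzIso [MetricSpace X] [MetricSpace Y] (f : X → Y) : Prop :=
  IsLipschitzEmbedding f ∧ Function.Surjective f

/-- The inclusion of a subset, as a continuous map. -/
def inclCM [TopologicalSpace X] (U : Set X) : C(↥U, X) :=
  ⟨Subtype.val, continuous_subtype_val⟩

/-- The data of a deformation rule `h ↦ D h` for the principle `L(X; C; U)`:
the rule is continuous near the inclusion, sends the inclusion to the identity, and sends any
open Lipschitz embedding `h` in the neighbourhood `N` of the inclusion to a Lipschitz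
isomorphism of `X` agreeing with `h` on `C` and with the inclusion outside `U`. -/
def DeformationData [MetricSpace X] (U C : Set X) (N : Set C(↥U, X))
    (D : C(↥U, X) → C(X, X)) : Prop :=
  ContinuousOn D {h | h ∈ N ∧ IsOpenLipschitzEmbedding (⇑h : ↥U → X)} ∧
  D (inclCM U) = ContinuousMap.id X ∧
  ∀ h ∈ N, IsOpenLipschitzEmbedding (⇑h : ↥U → X) →
    IsLipschitzIso (⇑(D h) : X → X) ∧
    (∀ x : ↥U, (x : X) ∈ C → D h x = h x) ∧
    (∀ x : X, x ∉ U → D h x = x)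

/-- Sullivan's Lipschitz deformation principle `L(X)`. -/
def LipschitzDeformationPrinciple (X : Type v) [MetricSpace X] : Prop :=
  ∀ U : Set X, IsOpen U → ∀ C : Set X, IsCompact C → C ⊆ U →
    ∃ N ∈ 𝓝 (inclCM U), ∃ D : C(↥U, X) → C(X, X), DeformationData U C N D

end Defs

section BiLip

variable {X Y : Type*}

/-- `f` is (globally) `L`-bi-Lipschitz: `dist x y / L ≤ dist (f x) (f y) ≤ L * dist x y`. -/
def IsBiLipschitzWith [MetricSpace X] [MetricSpace Y] (L : ℝ) (f : X → Y) : Prop :=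
  ∀ x y : X, dist x y / L ≤ dist (f x) (f y) ∧ dist (f x) (f y) ≤ L * dist x y

/-- `f` is locally `L`-bi-Lipschitz: every point has a neighbourhood on which
`dist x y / L ≤ dist (f x) (f y) ≤ L * dist x y`. -/
def IsLocallyBiLipschitzWith [MetricSpace X] [MetricSpace Y] (L : ℝ) (f : X → Y) : Prop :=
  ∀ x : X, ∃ O ∈ 𝓝 x, ∀ a ∈ O, ∀ b ∈ O,
    dist a b / L ≤ dist (f a) (f b) ∧ dist (f a) (f b) ≤ L * dist a b

end BiLip

/-- An increasing continuous function `χ : [0,∞) → [0,∞)` with `χ(0) = 0`. -/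
def IsModulus (χ : ℝ → ℝ) : Prop :=
  Continuous χ ∧ Monotone χ ∧ χ 0 = 0 ∧ ∀ x, 0 ≤ χ x



namespace CDE

section fill
variable {E : Type*} [NormedAddCommGroup E] [NormedSpace ℝ E]

def PL (L : ℝ) (h : E → E) (p : E) : Prop := ∀ᶠ q in 𝓝 p, ‖h q - h p‖ ≤ L * ‖q - p‖

structure Gd (L ε : ℝ) (h k : E → E) (p : E) : Prop where
  ch : ‖h p - p‖ ≤ ε
  ck : ‖k p - p‖ ≤ ε
  hk : h (k p) = p
  kh : k (h p) = p
  lh : PL L h p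
  lk : PL L k p

theorem PL.cont {L : ℝ} {h : E → E} {p : E} (H : PL L h p) : ContinuousAt h p := by
  rw [ContinuousAt, tendsto_iff_norm_sub_tendsto_zero]
  have : Filter.Tendsto (fun q => L * ‖q - p‖) (𝓝 p) (𝓝 0) := by
    have : Continuous (fun q : E => L * ‖q - p‖) := by fun_prop
    have := this.tendsto p
    simpa using this
  exact squeeze_zero' (Filter.Eventually.of_forall fun _ => norm_nonneg _) H this

theorem PL.mono {L L' : ℝ} {h : E → E} {p : E} (H : PL L h p) (hL : L ≤ L') : PL L' h p := by
  filter_upwards [H] with q hq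
  exact hq.trans (mul_le_mul_of_nonneg_right hL (norm_nonneg _))

theorem PL.congr {L : ℝ} {h h' : E → E} {p : E} (H : PL L h p) (e : h' =ᶠ[𝓝 p] h) : PL L h' p := by
  have := e.self_of_nhds
  filter_upwards [H, e] with q hq hq'
  rw [hq', this]; exact hq

theorem PL.comp {a b : ℝ} (ha : 0 ≤ a) {f g : E → E} {p : E} (Hf : PL a f (g p)) (Hg : PL b g p) :
    PL (a * b) (fun x => f (g x)) p := by
  filter_upwards [Hg.cont.eventually Hf, Hg] with q h1 h2
  calc _ ≤ a * ‖g q - g p‖ := h1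
    _ ≤ a * (b * ‖q - p‖) := mul_le_mul_of_nonneg_left h2 ha
    _ = _ := by ring

theorem PL.of_lip {a : ℝ} {f : E → E} (H : ∀ x y, ‖f x - f y‖ ≤ a * ‖x - y‖) (p : E) : PL a f p :=
  Filter.Eventually.of_forall fun _ => H _ _

theorem PL.id (p : E) : PL 1 (fun x : E => x) p := PL.of_lip (by simp) p

theorem Gd.mono {L L' ε ε' : ℝ} {h k : E → E} {p : E} (H : Gd L ε h k p) (hL : L ≤ L') (he : ε ≤ ε') :
    Gd L' ε' h k p := ⟨H.ch.trans he, H.ck.trans he, H.hk, H.kh, H.lh.mono hL, H.lk.mono hL⟩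

theorem Gd.congr {L ε : ℝ} {h k h' k' : E → E} {p : E} (H : Gd L ε h k p) (e1 : h' =ᶠ[𝓝 p] h)
    (e2 : k' =ᶠ[𝓝 p] k) (e3 : h' (k p) = h (k p)) (e4 : k' (h p) = k (h p)) : Gd L ε h' k' p := by
  have a := e1.self_of_nhds
  have b := e2.self_of_nhds
  refine ⟨by rw [a]; exact H.ch, by rw [b]; exact H.ck, by rw [b, e3, H.hk], by rw [a, e4, H.kh],
    H.lh.congr e1, H.lk.congr e2⟩

noncomputable def rad (φ : ℝ → ℝ) (x : E) : E := (φ ‖x‖ / ‖x‖) • x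

structure RF (φ : ℝ → ℝ) : Prop where
  nn : ∀ x, 0 ≤ x → 0 ≤ φ x
  le : ∀ x, 0 ≤ x → φ x ≤ 2 * x
  lip : ∀ x y, 0 ≤ x → 0 ≤ y → |φ x - φ y| ≤ 20 * |x - y|

theorem rad_norm {φ : ℝ → ℝ} (H : RF φ) (x : E) : ‖rad φ x‖ = φ ‖x‖ := by
  unfold rad
  rw [norm_smul, Real.norm_eq_abs, abs_div, abs_norm, abs_of_nonneg (H.nn _ (norm_nonneg x))]
  rcases eq_or_ne ‖x‖ 0 with h | h
  · have := H.nn 0 le_rfl; have := H.le 0 le_rfl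
    rw [h]; simp; linarith
  · field_simp

theorem rad_rad {φ ψ : ℝ → ℝ} (H : RF φ) (inv : ∀ x, 0 ≤ x → ψ (φ x) = x) (pos : ∀ x, 0 < x → 0 < φ x)
    (x : E) : rad ψ (rad φ x) = x := by
  rcases eq_or_ne x 0 with h | h
  · subst h; simp [rad]
  · have hx : 0 < ‖x‖ := norm_pos_iff.2 h
    have := pos _ hx
    have e : rad ψ (rad φ x) = (ψ ‖rad φ x‖ / ‖rad φ x‖) • rad φ x := rfl
    rw [e, rad_norm H, inv _ hx.le]
    unfold rad
    rw [smul_smul]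
    have : ‖x‖ / φ ‖x‖ * (φ ‖x‖ / ‖x‖) = 1 := by field_simp
    rw [this, one_smul]

theorem rad_id {φ : ℝ → ℝ} {x : E} (h : φ ‖x‖ = ‖x‖) : rad φ x = x := by
  rcases eq_or_ne x 0 with h0 | h0
  · subst h0; simp [rad]
  · have hx : 0 < ‖x‖ := norm_pos_iff.2 h0
    unfold rad; rw [h, div_self hx.ne', one_smul]

theorem rad_two {φ : ℝ → ℝ} {x : E} (h : φ ‖x‖ = 2 * ‖x‖) : rad φ x = (2 : ℝ) • x := by
  rcases eq_or_ne x 0 with h0 | h0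
  · subst h0; simp [rad]
  · have hx : 0 < ‖x‖ := norm_pos_iff.2 h0
    unfold rad; rw [h]; congr 1; field_simp

theorem rad_half {φ : ℝ → ℝ} {x : E} (h : φ ‖x‖ = ‖x‖ / 2) : rad φ x = (1 / 2 : ℝ) • x := by
  rcases eq_or_ne x 0 with h0 | h0
  · subst h0; simp [rad]
  · have hx : 0 < ‖x‖ := norm_pos_iff.2 h0
    unfold rad; rw [h]; congr 1; field_simp

theorem rad_lip {φ : ℝ → ℝ} (H : RF φ) (x y : E) : ‖rad φ x - rad φ y‖ ≤ 24 * ‖x - y‖ := by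
  rcases eq_or_ne x 0 with h0 | h0
  · subst h0
    have h1 : rad φ (0 : E) = 0 := by simp [rad]
    rw [h1, zero_sub, norm_neg, rad_norm H, zero_sub, norm_neg]
    have := H.le _ (norm_nonneg y); have := norm_nonneg y; linarith
  rcases eq_or_ne y 0 with h1 | h1
  · subst h1
    have h1 : rad φ (0 : E) = 0 := by simp [rad]
    rw [h1, sub_zero, rad_norm H, sub_zero]
    have := H.le _ (norm_nonneg x); have := norm_nonneg x; linarith
  have hx : 0 < ‖x‖ := norm_pos_iff.2 h0
  have hy : 0 < ‖y‖ := norm_pos_iff.2 h1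
  have e : rad φ x - rad φ y = (φ ‖x‖ / ‖x‖) • (x - y) + (φ ‖x‖ / ‖x‖ - φ ‖y‖ / ‖y‖) • y := by
    unfold rad; module
  have a0 : 0 ≤ φ ‖x‖ / ‖x‖ := div_nonneg (H.nn _ hx.le) hx.le
  have a1 : φ ‖x‖ / ‖x‖ ≤ 2 := by rw [div_le_iff₀ hx]; exact H.le _ hx.le
  have e2 : (φ ‖x‖ / ‖x‖ - φ ‖y‖ / ‖y‖) * ‖y‖ = φ ‖x‖ / ‖x‖ * (‖y‖ - ‖x‖) + (φ ‖x‖ - φ ‖y‖) := by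
    field_simp; ring
  have a2 : |‖x‖ - ‖y‖| ≤ ‖x - y‖ := abs_norm_sub_norm_le x y
  have a3 := H.lip _ _ hx.le hy.le
  rw [e]
  refine (norm_add_le _ _).trans ?_
  rw [norm_smul, norm_smul, Real.norm_eq_abs, Real.norm_eq_abs, abs_of_nonneg a0]
  have : |φ ‖x‖ / ‖x‖ - φ ‖y‖ / ‖y‖| * ‖y‖ = |φ ‖x‖ / ‖x‖ * (‖y‖ - ‖x‖) + (φ ‖x‖ - φ ‖y‖)| := by
    rw [← e2, abs_mul, abs_norm]
  rw [this]
  have b1 : |φ ‖x‖ / ‖x‖ * (‖y‖ - ‖x‖) + (φ ‖x‖ - φ ‖y‖)| ≤ 2 * ‖x - y‖ + 20 * ‖x - y‖ := by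
    refine (abs_add_le _ _).trans (add_le_add ?_ (by linarith))
    rw [abs_mul, abs_of_nonneg a0, abs_sub_comm]
    exact mul_le_mul a1 a2 (abs_nonneg _) (by norm_num)
  have b2 := mul_le_mul_of_nonneg_right a1 (norm_nonneg (x - y))
  linarith

noncomputable def t' (x : ℝ) : ℝ := max x (min (2 * x) (9/2 * x - 35/4))
noncomputable def t (x : ℝ) : ℝ := min x (max (x / 2) (2/9 * x + 35/18))
noncomputable def u' (x : ℝ) : ℝ := max x (min (2 * x) (2/25 * x + 4416/1000))
noncomputable def u (x : ℝ) : ℝ := min x (max (x / 2) (25/2 * x - 4416/80))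

theorem aux_lip (a b : ℝ) {x y z w : ℝ} (e : z - w = a * (x - y) + b * 0) (h : |a| ≤ 20) :
    |z - w| ≤ 20 * |x - y| := by
  rw [e, mul_zero, add_zero, abs_mul]; exact mul_le_mul_of_nonneg_right h (abs_nonneg _)
theorem rf_t' : RF t' := by
  refine ⟨fun x hx => ?_, fun x hx => ?_, fun x y hx hy => ?_⟩ <;> unfold t'
  · exact le_max_of_le_left hx
  · exact max_le (by linarith) (min_le_left _ _)
  · refine (abs_max_sub_max_le_max _ _ _ _).trans (max_le ?_ ((abs_min_sub_min_le_max _ _ _ _).trans (max_le ?_ ?_)))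
    · exact aux_lip 1 0 (by ring) (by norm_num [abs_le])
    · exact aux_lip (2) 0 (by ring) (by norm_num [abs_le])
    · exact aux_lip (9/2) 0 (by ring) (by norm_num [abs_le])
theorem rf_u' : RF u' := by
  refine ⟨fun x hx => ?_, fun x hx => ?_, fun x y hx hy => ?_⟩ <;> unfold u'
  · exact le_max_of_le_left hx
  · exact max_le (by linarith) (min_le_left _ _)
  · refine (abs_max_sub_max_le_max _ _ _ _).trans (max_le ?_ ((abs_min_sub_min_le_max _ _ _ _).trans (max_le ?_ ?_)))
    · exact aux_lip 1 0 (by ring) (by norm_num [abs_le])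
    · exact aux_lip (2) 0 (by ring) (by norm_num [abs_le])
    · exact aux_lip (2/25) 0 (by ring) (by norm_num [abs_le])
theorem rf_t : RF t := by
  refine ⟨fun x hx => ?_, fun x hx => ?_, fun x y hx hy => ?_⟩ <;> unfold t
  · exact le_min hx (le_max_of_le_left (by linarith))
  · exact (min_le_left _ _).trans (by linarith)
  · refine (abs_min_sub_min_le_max _ _ _ _).trans (max_le ?_ ((abs_max_sub_max_le_max _ _ _ _).trans (max_le ?_ ?_)))
    · exact aux_lip 1 0 (by ring) (by norm_num [abs_le])
    · exact aux_lip (1/2) 0 (by ring) (by norm_num [abs_le])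
    · exact aux_lip (2/9) 0 (by ring) (by norm_num [abs_le])
theorem rf_u : RF u := by
  refine ⟨fun x hx => ?_, fun x hx => ?_, fun x y hx hy => ?_⟩ <;> unfold u
  · exact le_min hx (le_max_of_le_left (by linarith))
  · exact (min_le_left _ _).trans (by linarith)
  · refine (abs_min_sub_min_le_max _ _ _ _).trans (max_le ?_ ((abs_max_sub_max_le_max _ _ _ _).trans (max_le ?_ ?_)))
    · exact aux_lip 1 0 (by ring) (by norm_num [abs_le])
    · exact aux_lip (1/2) 0 (by ring) (by norm_num [abs_le])
    · exact aux_lip (25/2) 0 (by ring) (by norm_num [abs_le])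
theorem t'_id {x : ℝ} (h : x ≤ 5/2) : t' x = x := max_eq_left ((min_le_right _ _).trans (by linarith))
theorem t'_two {x : ℝ} (h : 7/2 ≤ x) : t' x = 2 * x := by
  rw [t', min_eq_left (by linarith), max_eq_right (by linarith)]
theorem t'_mid {x : ℝ} (h1 : 5/2 ≤ x) (h : x ≤ 7/2) : t' x = 9/2 * x - 35/4 := by
  rw [t', min_eq_right (by linarith), max_eq_right (by linarith)]
theorem u'_two {x : ℝ} (h0 : 0 ≤ x) (h : x ≤ 23/10) : u' x = 2 * x := by
  rw [u', min_eq_left (by linarith), max_eq_right (by linarith)]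
theorem u'_mid {x : ℝ} (h1 : 23/10 ≤ x) (h : x ≤ 48/10) : u' x = 2/25 * x + 4416/1000 := by
  rw [u', min_eq_right (by linarith), max_eq_right (by linarith)]
theorem u'_id {x : ℝ} (h : 48/10 ≤ x) : u' x = x := max_eq_left ((min_le_right _ _).trans (by linarith))
theorem t_id {x : ℝ} (h : x ≤ 5/2) : t x = x := min_eq_left (le_max_of_le_right (by linarith))
theorem t_half {x : ℝ} (h : 7 ≤ x) : t x = x / 2 := by
  rw [t, max_eq_left (by linarith), min_eq_right (by linarith)]
theorem t_mid {x : ℝ} (h1 : 5/2 ≤ x) (h : x ≤ 7) : t x = 2/9 * x + 35/18 := by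
  rw [t, max_eq_right (by linarith), min_eq_right (by linarith)]
theorem u_half {x : ℝ} (h0 : 0 ≤ x) (h : x ≤ 46/10) : u x = x / 2 := by
  rw [u, max_eq_left (by linarith), min_eq_right (by linarith)]
theorem u_mid {x : ℝ} (h1 : 46/10 ≤ x) (h : x ≤ 48/10) : u x = 25/2 * x - 4416/80 := by
  rw [u, max_eq_right (by linarith), min_eq_right (by linarith)]
theorem u_id {x : ℝ} (h : 48/10 ≤ x) : u x = x := min_eq_left (le_max_of_le_right (by linarith))

theorem tt' (x : ℝ) (hx : 0 ≤ x) : t (t' x) = x := by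
  rcases le_total x (5/2) with h | h
  · rw [t'_id h, t_id h]
  rcases le_total x (7/2) with h' | h'
  · rw [t'_mid h h', t_mid (by linarith) (by linarith)]; ring
  · rw [t'_two h', t_half (by linarith)]; ring
theorem t't (x : ℝ) (hx : 0 ≤ x) : t' (t x) = x := by
  rcases le_total x (5/2) with h | h
  · rw [t_id h, t'_id h]
  rcases le_total x 7 with h' | h'
  · rw [t_mid h h', t'_mid (by linarith) (by linarith)]; ring
  · rw [t_half h', t'_two (by linarith)]; ring
theorem uu' (x : ℝ) (hx : 0 ≤ x) : u (u' x) = x := by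
  rcases le_total x (23/10) with h | h
  · rw [u'_two hx h, u_half (by linarith) (by linarith)]; ring
  rcases le_total x (48/10) with h' | h'
  · rw [u'_mid h h', u_mid (by linarith) (by linarith)]; ring
  · rw [u'_id h', u_id h']
theorem u'u (x : ℝ) (hx : 0 ≤ x) : u' (u x) = x := by
  rcases le_total x (46/10) with h | h
  · rw [u_half hx h, u'_two (by linarith) (by linarith)]; ring
  rcases le_total x (48/10) with h' | h'
  · rw [u_mid h h', u'_mid (by linarith) (by linarith)]; ring
  · rw [u_id h', u'_id h']
theorem t'_ge (x : ℝ) : x ≤ t' x := le_max_left _ _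
theorem u'_ge (x : ℝ) : x ≤ u' x := le_max_left _ _
theorem t_le (x : ℝ) : t x ≤ x := min_le_left _ _
theorem u_le (x : ℝ) : u x ≤ x := min_le_left _ _
theorem t_pos (x : ℝ) (hx : 0 < x) : 0 < t x := lt_min hx (lt_max_of_lt_left (by linarith))
theorem u_pos (x : ℝ) (hx : 0 < x) : 0 < u x := lt_min hx (lt_max_of_lt_left (by linarith))
theorem u_ge (x : ℝ) (hx : 0 ≤ x) : x / 2 ≤ u x := le_min (by linarith) (le_max_left _ _)
theorem Rtt' (x : E) : rad t (rad t' x) = x := rad_rad rf_t' tt' (fun x hx => hx.trans_le (t'_ge x)) x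
theorem Rt't (x : E) : rad t' (rad t x) = x := rad_rad rf_t t't t_pos x
theorem Ruu' (x : E) : rad u (rad u' x) = x := rad_rad rf_u' uu' (fun x hx => hx.trans_le (u'_ge x)) x
theorem Ru'u (x : E) : rad u' (rad u x) = x := rad_rad rf_u u'u u_pos x
theorem t'_le {x y : ℝ} (h : x ≤ y) (h0 : 0 ≤ x) : t' x ≤ 2 * y := (rf_t'.le x h0).trans (by linarith)
theorem u'_le {x : ℝ} (h : x ≤ 9) : u' x ≤ max x (52/10) :=
  max_le_max le_rfl ((min_le_right _ _).trans (by linarith))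
theorem u'_ge2 {x : ℝ} (h : 196/100 ≤ x) : 392/100 ≤ u' x :=
  le_max_of_le_right (le_min (by linarith) (by linarith))
theorem t_ge {x : ℝ} (h : 0 ≤ x) : min x (5/2) ≤ t x :=
  le_min (min_le_left _ _) (by
    rcases le_total x (5/2) with h' | h'
    · exact (min_le_left _ _).trans (le_max_of_le_right (by linarith))
    · exact (min_le_right _ _).trans (le_max_of_le_right (by linarith)))
theorem t_le2 {x : ℝ} (h : x ≤ 804/100) : t x ≤ 402/100 :=
  (min_le_right _ _).trans (max_le (by linarith) (by linarith))

end fill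
end CDE


namespace CDE

section fill
variable {E : Type*} [NormedAddCommGroup E] [NormedSpace ℝ E]

theorem nrm_bd {a b : E} {ε : ℝ} (h : ‖a - b‖ ≤ ε) : ‖a‖ ≤ ‖b‖ + ε ∧ ‖b‖ - ε ≤ ‖a‖ := by
  have := abs_le.1 ((abs_norm_sub_norm_le a b).trans h)
  constructor <;> linarith [this.1, this.2]

def SH (L : ℝ) (h k : E → E) : Prop := ∀ x, 1 < ‖x‖ → ‖x‖ ≤ 10 → Gd L (1/50) h k x

noncomputable def F0 (h k : E → E) (x : E) : E := (1/2 : ℝ) • h (rad u' (k (rad t' (h x))))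
noncomputable def G0 (h k : E → E) (z : E) : E := k (rad t (h (rad u (k ((2 : ℝ) • z)))))

theorem norm_two (x : E) : ‖(2 : ℝ) • x‖ = 2 * ‖x‖ := by rw [norm_smul]; norm_num
theorem norm_half (x : E) : ‖(1/2 : ℝ) • x‖ = ‖x‖ / 2 := by rw [norm_smul]; norm_num; ring
theorem two_half (x : E) : (2 : ℝ) • (1/2 : ℝ) • x = x := by rw [smul_smul]; norm_num
theorem half_two (x : E) : (1/2 : ℝ) • (2 : ℝ) • x = x := by rw [smul_smul]; norm_num

theorem pl_half (x : E) : PL (1/2) (fun x : E => (1/2 : ℝ) • x) x :=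
  PL.of_lip (fun x y => by rw [← smul_sub, norm_half]; linarith) x
theorem pl_two (x : E) : PL 2 (fun x : E => (2:ℝ) • x) x :=
  PL.of_lip (fun x y => by rw [← smul_sub, norm_two]) x

theorem F0_props {L : ℝ} (hL : 1 ≤ L) {h k : E → E} (H : SH L h k) {x : E} (h1 : 17/10 ≤ ‖x‖)
    (h2 : ‖x‖ ≤ 43/10) : G0 h k (F0 h k x) = x ∧ PL (1152 * L ^ 3) (F0 h k) x ∧
    (2 ≤ ‖x‖ → ‖x‖ ≤ 4 → 195/100 ≤ ‖F0 h k x‖ ∧ ‖F0 h k x‖ ≤ 404/100) := by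
  have gx := H x (by linarith) (by linarith)
  have na := nrm_bd gx.ch
  have nb : ‖rad t' (h x)‖ = t' ‖h x‖ := rad_norm rf_t' _
  have nb1 := t'_ge ‖h x‖
  have nb2 := t'_le na.1 (norm_nonneg _)
  have gb := H (rad t' (h x)) (by rw [nb]; linarith) (by rw [nb]; linarith)
  have nc := nrm_bd gb.ck
  have nd : ‖rad u' (k (rad t' (h x)))‖ = u' ‖k (rad t' (h x))‖ := rad_norm rf_u' _
  have nd1 := u'_ge ‖k (rad t' (h x))‖
  rw [nb] at nc
  have nd2 := u'_le (x := ‖k (rad t' (h x))‖) (by linarith)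
  have nd3 : max ‖k (rad t' (h x))‖ (52/10) ≤ 9 := max_le (by linarith) (by norm_num)
  have gd := H (rad u' (k (rad t' (h x)))) (by rw [nd]; linarith) (by rw [nd]; linarith)
  have ne := nrm_bd gd.ch
  rw [nd] at ne
  refine ⟨?_, ?_, ?_⟩
  · unfold F0 G0
    rw [two_half, gd.kh, Ruu', gb.hk, Rtt', gx.kh]
  · have L0 : 0 ≤ L := by linarith
    have e1 := PL.comp (f := rad t') (a := 24) (by norm_num) (PL.of_lip (rad_lip rf_t') _) gx.lh
    have e2 := PL.comp (f := k) (g := fun x => rad t' (h x)) L0 gb.lk e1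
    have e3 := PL.comp (f := rad u') (g := fun x => k (rad t' (h x))) (a := 24) (by norm_num) (PL.of_lip (rad_lip rf_u') _) e2
    have e4 := PL.comp (f := h) (g := fun x => rad u' (k (rad t' (h x)))) L0 gd.lh e3
    have e5 := PL.comp (f := fun x => (1/2:ℝ) • x) (g := fun x => h (rad u' (k (rad t' (h x))))) (by norm_num) (pl_half _) e4
    refine PL.mono e5 ?_
    have : 0 ≤ L ^ 3 := by positivity
    linarith
  · intro h3 h4
    have := u'_ge2 (x := ‖k (rad t' (h x))‖) (by linarith)
    have nd3 : max ‖k (rad t' (h x))‖ (52/10) ≤ 806/100 := max_le (by linarith) (by norm_num)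
    unfold F0
    rw [norm_half]; constructor <;> linarith

theorem G0_props {L : ℝ} (hL : 1 ≤ L) {h k : E → E} (H : SH L h k) {x : E} (h1 : 17/10 ≤ ‖x‖)
    (h2 : ‖x‖ ≤ 43/10) : F0 h k (G0 h k x) = x ∧ PL (1152 * L ^ 3) (G0 h k) x ∧
    (2 ≤ ‖x‖ → ‖x‖ ≤ 4 → 195/100 ≤ ‖G0 h k x‖ ∧ ‖G0 h k x‖ ≤ 404/100) := by
  have n2 := norm_two x
  have gx := H ((2:ℝ) • x) (by linarith) (by linarith)
  have na := nrm_bd gx.ck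
  have nb : ‖rad u (k ((2:ℝ) • x))‖ = u ‖k ((2:ℝ) • x)‖ := rad_norm rf_u _
  have nb1 := u_le ‖k ((2:ℝ) • x)‖
  have nb2 := u_ge ‖k ((2:ℝ) • x)‖ (norm_nonneg _)
  have gb := H (rad u (k ((2:ℝ) • x))) (by rw [nb]; linarith) (by rw [nb]; linarith)
  have nc := nrm_bd gb.ch
  have nd : ‖rad t (h (rad u (k ((2:ℝ) • x))))‖ = t ‖h (rad u (k ((2:ℝ) • x)))‖ := rad_norm rf_t _
  have nd1 := t_le ‖h (rad u (k ((2:ℝ) • x)))‖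
  have nd2 := t_ge (norm_nonneg (h (rad u (k ((2:ℝ) • x)))))
  rw [nb] at nc
  have nd3 : 16/10 ≤ min ‖h (rad u (k ((2:ℝ) • x)))‖ (5/2) := le_min (by linarith) (by norm_num)
  have gd := H (rad t (h (rad u (k ((2:ℝ) • x))))) (by rw [nd]; linarith) (by rw [nd]; linarith)
  have ne := nrm_bd gd.ck
  rw [nd] at ne
  refine ⟨?_, ?_, ?_⟩
  · unfold F0 G0
    rw [gd.hk, Rt't, gb.kh, Ru'u, gx.hk, half_two]
  · have L0 : 0 ≤ L := by linarith
    have e0 := PL.comp (f := k) (g := fun x => (2:ℝ) • x) L0 gx.lk (pl_two x)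
    have e1 := PL.comp (f := rad u) (g := fun x => k ((2:ℝ) • x)) (a := 24) (by norm_num) (PL.of_lip (rad_lip rf_u) _) e0
    have e2 := PL.comp (f := h) (g := fun x => rad u (k ((2:ℝ) • x))) L0 gb.lh e1
    have e3 := PL.comp (f := rad t) (g := fun x => h (rad u (k ((2:ℝ) • x)))) (a := 24) (by norm_num) (PL.of_lip (rad_lip rf_t) _) e2
    have e4 := PL.comp (f := k) (g := fun x => rad t (h (rad u (k ((2:ℝ) • x))))) L0 gd.lk e3
    refine PL.mono e4 (le_of_eq ?_)
    ring
  · intro h3 h4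
    have h5 := t_le2 (x := ‖h (rad u (k ((2:ℝ) • x)))‖) (by linarith)
    have h6 : 197/100 ≤ min ‖h (rad u (k ((2:ℝ) • x)))‖ (5/2) := le_min (by linarith) (by norm_num)
    unfold G0
    constructor <;> linarith

theorem F0_in {L : ℝ} {h k : E → E} (H : SH L h k) {x : E} (h1 : 17/10 ≤ ‖x‖)
    (h2 : ‖x‖ ≤ 22/10) : F0 h k x = (1/2:ℝ) • h ((2:ℝ) • x) := by
  have gx := H x (by linarith) (by linarith)
  have na := nrm_bd gx.ch
  unfold F0
  rw [rad_id (φ := t') (t'_id (by linarith)), gx.kh, rad_two (u'_two (norm_nonneg _) (by linarith))]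

theorem F0_out {L : ℝ} {h k : E → E} (H : SH L h k) {x : E} (h1 : 36/10 ≤ ‖x‖)
    (h2 : ‖x‖ ≤ 49/10) : F0 h k x = h x := by
  have gx := H x (by linarith) (by linarith)
  have na := nrm_bd gx.ch
  have n2 := norm_two (h x)
  have gy := H ((2:ℝ) • h x) (by linarith) (by linarith)
  have nb := nrm_bd gy.ck
  unfold F0
  rw [rad_two (φ := t') (t'_two (by linarith)), rad_id (φ := u') (u'_id (by linarith)), gy.hk, half_two]

theorem G0_in {L : ℝ} {h k : E → E} (H : SH L h k) {x : E} (h1 : 17/10 ≤ ‖x‖)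
    (h2 : ‖x‖ ≤ 22/10) : G0 h k x = (1/2:ℝ) • k ((2:ℝ) • x) := by
  have n2 := norm_two x
  have gx := H ((2:ℝ) • x) (by linarith) (by linarith)
  have na := nrm_bd gx.ck
  have nh := norm_half (k ((2:ℝ) • x))
  have gy := H ((1/2:ℝ) • k ((2:ℝ) • x)) (by linarith) (by linarith)
  have nb := nrm_bd gy.ch
  unfold G0
  rw [rad_half (φ := u) (u_half (norm_nonneg _) (by linarith)), rad_id (φ := t) (t_id (by linarith)), gy.kh]

theorem G0_out {L : ℝ} {h k : E → E} (H : SH L h k) {x : E} (h1 : 36/10 ≤ ‖x‖)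
    (h2 : ‖x‖ ≤ 49/10) : G0 h k x = k x := by
  have n2 := norm_two x
  have gx := H ((2:ℝ) • x) (by linarith) (by linarith)
  have na := nrm_bd gx.ck
  unfold G0
  rw [rad_id (φ := u) (u_id (by linarith)), gx.hk, rad_half (φ := t) (t_half (by linarith)), half_two]

open scoped Classical in
noncomputable def lev (x : E) : ℕ := if h : ∃ m : ℕ, 2 ≤ 2 ^ m * ‖x‖ ∧ 2 ^ m * ‖x‖ < 4 then h.choose else 0
noncomputable def sc (F : E → E) (m : ℕ) (x : E) : E := ((2:ℝ) ^ m)⁻¹ • F (((2:ℝ) ^ m) • x)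
open scoped Classical in
noncomputable def Ext (F h : E → E) (x : E) : E :=
  if ‖x‖ < 4 then (if x = 0 then 0 else sc F (lev x) x) else h x

theorem lev_ex {x : E} (h0 : x ≠ 0) (h : ‖x‖ < 4) : ∃ m : ℕ, 2 ≤ 2 ^ m * ‖x‖ ∧ 2 ^ m * ‖x‖ < 4 := by
  have hx : 0 < ‖x‖ := norm_pos_iff.2 h0
  have ex : ∃ m : ℕ, 2 ≤ 2 ^ m * ‖x‖ := by
    obtain ⟨m, hm⟩ := pow_unbounded_of_one_lt (2 / ‖x‖) (by norm_num : (1:ℝ) < 2)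
    refine ⟨m, ?_⟩
    rw [div_lt_iff₀ hx] at hm; exact hm.le
  classical
  refine ⟨Nat.find ex, Nat.find_spec ex, ?_⟩
  rcases Nat.eq_zero_or_pos (Nat.find ex) with h1 | h1
  · rw [h1]; simpa using h
  · obtain ⟨j, hj⟩ := Nat.exists_eq_succ_of_ne_zero h1.ne'
    have := Nat.find_min ex (m := j) (by omega)
    rw [hj, pow_succ]; push Not at this; linarith

structure SS (C : ℝ) (F h : E → E) : Prop where
  inn : ∀ y, 18/10 ≤ ‖y‖ → ‖y‖ ≤ 22/10 → F y = (1/2:ℝ) • F ((2:ℝ) • y)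
  out : ∀ y, 36/10 ≤ ‖y‖ → ‖y‖ ≤ 49/10 → F y = h y
  bd : ∀ y, 2 ≤ ‖y‖ → ‖y‖ ≤ 4 → 195/100 ≤ ‖F y‖ ∧ ‖F y‖ ≤ 404/100
  pl : ∀ y, 17/10 ≤ ‖y‖ → ‖y‖ ≤ 43/10 → PL C F y
  hC : 3 ≤ C

theorem lev_spec {x : E} (h0 : x ≠ 0) (h : ‖x‖ < 4) : 2 ≤ 2 ^ (lev x) * ‖x‖ ∧ 2 ^ (lev x) * ‖x‖ < 4 := by
  have := lev_ex h0 h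
  unfold lev; rw [dif_pos this]; exact this.choose_spec

theorem sc_norm (m : ℕ) (x : E) : ‖((2:ℝ) ^ m) • x‖ = 2 ^ m * ‖x‖ := by
  rw [norm_smul]; simp

theorem sc_succ {C : ℝ} {F h : E → E} (S : SS C F h) {m : ℕ} {x : E} (h1 : 18/10 ≤ 2 ^ m * ‖x‖)
    (h2 : 2 ^ m * ‖x‖ ≤ 22/10) : sc F m x = sc F (m+1) x := by
  unfold sc
  rw [S.inn _ (by rw [sc_norm]; exact h1) (by rw [sc_norm]; exact h2), smul_smul, smul_smul, pow_succ, mul_comm _ (2:ℝ)]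
  congr 1
  rw [mul_inv]; ring

theorem Ext_form {C : ℝ} {F h : E → E} (S : SS C F h) {m : ℕ} {x : E} (h1 : 18/10 ≤ 2 ^ m * ‖x‖)
    (h2 : 2 ^ m * ‖x‖ < 44/10) : Ext F h x = sc F m x := by
  have hp : ∀ m : ℕ, (1:ℝ) ≤ 2 ^ m := fun m => one_le_pow₀ (by norm_num)
  have x0 : x ≠ 0 := by rintro rfl; simp at h1; norm_num at h1
  have hx : 0 < ‖x‖ := norm_pos_iff.2 x0
  unfold Ext
  rw [if_neg x0]
  split_ifs with h4
  · obtain ⟨a, b⟩ := lev_spec x0 h4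
    generalize lev x = l at a b
    rcases lt_trichotomy m l with hl | hl | hl
    · obtain ⟨j, rfl⟩ := Nat.exists_eq_add_of_lt hl
      rcases Nat.eq_zero_or_pos j with rfl | hj
      · have e : (2:ℝ) ^ (m + 0 + 1) = 2 ^ m * 2 := by ring
        rw [e] at a b
        exact (sc_succ S h1 (by linarith)).symm
      · exfalso
        obtain ⟨i, rfl⟩ := Nat.exists_eq_succ_of_ne_zero hj.ne'
        have e : (2:ℝ) ^ (m + (i+1) + 1) = 2 ^ m * 4 * 2 ^ i := by ring
        rw [e] at b
        nlinarith [hp i, mul_pos (lt_of_lt_of_le one_pos (hp m)) hx]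
    · rw [hl]
    · obtain ⟨j, rfl⟩ := Nat.exists_eq_add_of_lt hl
      rcases Nat.eq_zero_or_pos j with rfl | hj
      · have e : (2:ℝ) ^ (l + 0 + 1) = 2 ^ l * 2 := by ring
        rw [e] at h1 h2
        exact (sc_succ S (by linarith) (by linarith))
      · exfalso
        obtain ⟨i, rfl⟩ := Nat.exists_eq_succ_of_ne_zero hj.ne'
        have e : (2:ℝ) ^ (l + (i+1) + 1) = 2 ^ l * 4 * 2 ^ i := by ring
        rw [e] at h2
        nlinarith [hp i, mul_pos (lt_of_lt_of_le one_pos (hp l)) hx]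
  · push Not at h4
    have : m = 0 := by
      by_contra hm
      obtain ⟨i, rfl⟩ := Nat.exists_eq_succ_of_ne_zero hm
      have e : (2:ℝ) ^ (i + 1) = 2 * 2 ^ i := by ring
      rw [e] at h2
      nlinarith [hp i]
    subst this
    simp only [pow_zero, one_mul] at h1 h2
    unfold sc
    simp only [pow_zero, inv_one, one_smul]
    exact (S.out _ (by linarith) (by linarith)).symm

theorem Ext_out {C : ℝ} {F h : E → E} (S : SS C F h) {x : E} (h1 : 36/10 ≤ ‖x‖) : Ext F h x = h x := by
  by_cases h4 : ‖x‖ < 4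
  · rw [Ext_form S (m := 0) (by simp; linarith) (by simp; linarith)]
    simp only [sc, pow_zero, inv_one, one_smul]
    exact S.out _ h1 (by linarith)
  · simp [Ext, h4]

theorem Ext_zero (F h : E → E) : Ext F h 0 = 0 := by simp [Ext]

theorem Ext_bd {C : ℝ} {F h : E → E} (S : SS C F h) {x : E} (hx : ‖x‖ < 4) : ‖Ext F h x‖ ≤ 5/2 * ‖x‖ := by
  rcases eq_or_ne x 0 with h0 | h0
  · subst h0; simp [Ext]
  obtain ⟨a, b⟩ := lev_spec h0 hx
  simp only [Ext, hx, h0, if_true, if_false, sc]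
  have := (S.bd ((2:ℝ) ^ lev x • x) (by rw [sc_norm]; exact a) (by rw [sc_norm]; exact b.le)).2
  rw [norm_smul, norm_inv, norm_pow]
  simp only [Real.norm_ofNat]
  rw [inv_mul_le_iff₀ (by positivity)]
  linarith

theorem sc_PL {C : ℝ} {F : E → E} {m : ℕ} {x : E} (H : PL C F ((2:ℝ)^m • x)) : PL C (sc F m) x := by
  have c : Continuous (fun x : E => (2:ℝ)^m • x) := by fun_prop
  filter_upwards [c.continuousAt.eventually H] with q hq
  unfold sc
  rw [← smul_sub, norm_smul, norm_inv, norm_pow]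
  rw [← smul_sub, norm_smul, norm_pow] at hq
  simp only [Real.norm_ofNat] at hq ⊢
  rw [inv_mul_le_iff₀ (by positivity)]
  linarith

theorem Ext_PL {C : ℝ} {F h : E → E} (S : SS C F h) (H : ∀ x, 4 ≤ ‖x‖ → ‖x‖ ≤ 9 → PL C h x) {x : E}
    (hx : ‖x‖ ≤ 9) : PL C (Ext F h) x := by
  rcases eq_or_ne x 0 with h0 | h0
  · subst h0
    have : ∀ᶠ q in 𝓝 (0:E), ‖q‖ < 4 :=
      continuous_norm.continuousAt.eventually (gt_mem_nhds (by simp))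
    filter_upwards [this] with q hq
    rw [Ext_zero, sub_zero, sub_zero]
    refine (Ext_bd S hq).trans (mul_le_mul_of_nonneg_right (le_trans (by norm_num) S.hC) (norm_nonneg _))
  by_cases h4 : ‖x‖ < 4
  · obtain ⟨a, b⟩ := lev_spec h0 h4
    refine PL.congr (sc_PL (m := lev x) (S.pl _ (by rw [sc_norm]; linarith) (by rw [sc_norm]; linarith))) ?_
    have c : Continuous (fun y : E => 2 ^ lev x * ‖y‖) := by fun_prop
    filter_upwards [c.continuousAt.eventually (lt_mem_nhds (show 18/10 < 2 ^ lev x * ‖x‖ by linarith)),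
      c.continuousAt.eventually (gt_mem_nhds (show 2 ^ lev x * ‖x‖ < 44/10 by linarith))] with q h1 h2
    exact Ext_form S h1.le h2
  · push Not at h4
    refine PL.congr (H x h4 hx) ?_
    filter_upwards [continuous_norm.continuousAt.eventually (lt_mem_nhds (show 36/10 < ‖x‖ by linarith))] with q h1
    exact Ext_out S h1.le

theorem Ext_inv {C : ℝ} {F h G k : E → E} (S : SS C F h) (S' : SS C G k)
    (gf : ∀ y, 17/10 ≤ ‖y‖ → ‖y‖ ≤ 43/10 → G (F y) = y)
    (gk : ∀ x, 4 ≤ ‖x‖ → ‖x‖ ≤ 9 → k (h x) = x ∧ 36/10 ≤ ‖h x‖) {x : E} (hx : ‖x‖ ≤ 9) :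
    Ext G k (Ext F h x) = x := by
  rcases eq_or_ne x 0 with h0 | h0
  · subst h0; rw [Ext_zero, Ext_zero]
  by_cases h4 : ‖x‖ < 4
  · obtain ⟨a, b⟩ := lev_spec h0 h4
    rw [Ext_form S (m := lev x) (by linarith) (by linarith)]
    have n1 := sc_norm (lev x) x
    have bd := S.bd ((2:ℝ) ^ lev x • x) (by linarith) (by linarith)
    have e : (2:ℝ) ^ lev x • sc F (lev x) x = F ((2:ℝ) ^ lev x • x) := by
      unfold sc; rw [smul_smul, mul_inv_cancel₀ (by positivity), one_smul]
    have n2 := sc_norm (lev x) (sc F (lev x) x)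
    rw [e] at n2
    rw [Ext_form S' (m := lev x) (by linarith) (by linarith)]
    have e3 : ∀ z, sc G (lev x) z = ((2:ℝ) ^ lev x)⁻¹ • G ((2:ℝ) ^ lev x • z) := fun _ => rfl
    rw [e3, e, gf _ (by linarith) (by linarith), smul_smul, inv_mul_cancel₀ (by positivity), one_smul]
  · push Not at h4
    rw [Ext_out S (by linarith), Ext_out S' (gk x h4 hx).2, (gk x h4 hx).1]

theorem fill (h k : E → E) : ∃ F G : E → E, (∀ x, 4 ≤ ‖x‖ → F x = h x ∧ G x = k x) ∧
    (∀ L, 1 ≤ L → SH L h k → ∀ x, ‖x‖ ≤ 9 → Gd (1152 * L ^ 3) 30 F G x ∧ ‖F x‖ ≤ 10 ∧ ‖G x‖ ≤ 10) ∧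
    ((∀ x, 1 < ‖x‖ → ‖x‖ ≤ 10 → h x = x ∧ k x = x) → ∀ x, ‖x‖ ≤ 10 → F x = x ∧ G x = x) := by
  by_cases hid : ∀ x, 1 < ‖x‖ → ‖x‖ ≤ 10 → h x = x ∧ k x = x
  · have key : ∀ x, ‖x‖ ≤ 10 → (if ‖x‖ < 4 then x else h x) = x ∧ (if ‖x‖ < 4 then x else k x) = x := by
      intro x hx
      split_ifs with h4
      · exact ⟨rfl, rfl⟩
      · push Not at h4; exact hid x (by linarith) hx
    refine ⟨fun x => if ‖x‖ < 4 then x else h x, fun x => if ‖x‖ < 4 then x else k x, ?_, ?_, ?_⟩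
    · intro x hx; simp [not_lt.2 hx]
    · intro L hL _ x hx
      have gi : Gd (1152 * L ^ 3) 30 (fun x : E => x) (fun x : E => x) x := by
        have : 1 ≤ 1152 * L ^ 3 := by nlinarith [one_le_pow₀ hL (n := 3)]
        exact ⟨by simp, by simp, rfl, rfl, (PL.id x).mono this, (PL.id x).mono this⟩
      have ev : ∀ᶠ y in 𝓝 x, ‖y‖ < 10 := continuous_norm.continuousAt.eventually (gt_mem_nhds (by linarith))
      refine ⟨gi.congr ?_ ?_ (key x (by linarith)).1 (key x (by linarith)).2, ?_, ?_⟩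
      rotate_left 2
      · beta_reduce; rw [(key x (by linarith)).1]; linarith
      · beta_reduce; rw [(key x (by linarith)).2]; linarith
      · filter_upwards [ev] with y hy using (key y hy.le).1
      · filter_upwards [ev] with y hy using (key y hy.le).2
    · intro _; exact key
  · refine ⟨Ext (F0 h k) h, Ext (G0 h k) k, ?_, ?_, fun H => absurd H hid⟩
    · intro x hx; simp [Ext, not_lt.2 hx]
    · intro L hL H x hx
      have L3 : 1 ≤ L ^ 3 := one_le_pow₀ hL
      have LL : L ≤ 1152 * L ^ 3 := by nlinarith [le_self_pow₀ hL (n := 3) (by norm_num)]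
      have S : SS (1152 * L ^ 3) (F0 h k) h := by
        refine ⟨fun y h1 h2 => ?_, fun y h1 h2 => F0_out H h1 h2,
          fun y h1 h2 => (F0_props hL H (by linarith) (by linarith)).2.2 h1 h2,
          fun y h1 h2 => (F0_props hL H h1 h2).2.1, by linarith⟩
        rw [F0_in H (by linarith) h2, F0_out H (by rw [norm_two]; linarith) (by rw [norm_two]; linarith)]
      have S' : SS (1152 * L ^ 3) (G0 h k) k := by
        refine ⟨fun y h1 h2 => ?_, fun y h1 h2 => G0_out H h1 h2,
          fun y h1 h2 => (G0_props hL H (by linarith) (by linarith)).2.2 h1 h2,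
          fun y h1 h2 => (G0_props hL H h1 h2).2.1, by linarith⟩
        rw [G0_in H (by linarith) h2, G0_out H (by rw [norm_two]; linarith) (by rw [norm_two]; linarith)]
      have cl : ∀ {F h : E → E}, SS (1152 * L ^ 3) F h → (∀ x, 4 ≤ ‖x‖ → ‖x‖ ≤ 9 → ‖h x - x‖ ≤ 1/50) →
          ‖Ext F h x - x‖ ≤ 30 := by
        intro F h S hh
        by_cases h4 : ‖x‖ < 4
        · have := Ext_bd S h4
          refine (norm_sub_le _ _).trans (by linarith)
        · push Not at h4
          rw [Ext_out S (by linarith)]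
          exact (hh x h4 hx).trans (by norm_num)
      have cl2 : ∀ {F h : E → E}, SS (1152 * L ^ 3) F h → (∀ x, 4 ≤ ‖x‖ → ‖x‖ ≤ 9 → ‖h x - x‖ ≤ 1/50) →
          ‖Ext F h x‖ ≤ 10 := by
        intro F h S hh
        by_cases h4 : ‖x‖ < 4
        · have := Ext_bd S h4
          linarith
        · push Not at h4
          rw [Ext_out S (by linarith)]
          linarith [(nrm_bd (hh x h4 hx)).1]
      refine ⟨?_, cl2 S fun x h1 h2 => (H x (by linarith) (by linarith)).ch,
        cl2 S' fun x h1 h2 => (H x (by linarith) (by linarith)).ck⟩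
      refine ⟨cl S fun x h1 h2 => (H x (by linarith) (by linarith)).ch,
        cl S' fun x h1 h2 => (H x (by linarith) (by linarith)).ck, ?_, ?_, ?_, ?_⟩
      · refine Ext_inv S' S (fun y h1 h2 => (G0_props hL H h1 h2).1) (fun x h1 h2 => ?_) hx
        have g := H x (by linarith) (by linarith)
        exact ⟨g.hk, by linarith [(nrm_bd g.ck).2]⟩
      · refine Ext_inv S S' (fun y h1 h2 => (F0_props hL H h1 h2).1) (fun x h1 h2 => ?_) hx
        have g := H x (by linarith) (by linarith)
        exact ⟨g.kh, by linarith [(nrm_bd g.ch).2]⟩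
      · exact Ext_PL S (fun x h1 h2 => (H x (by linarith) (by linarith)).lh.mono LL) hx
      · exact Ext_PL S' (fun x h1 h2 => (H x (by linarith) (by linarith)).lk.mono LL) hx

end fill
end CDE


namespace CDE

section step
variable {ι : Type*} [Fintype ι]

noncomputable def nw (w v : ι → ℝ) : ℝ := ‖v / w‖

theorem nw_nn (w v : ι → ℝ) : 0 ≤ nw w v := norm_nonneg _

theorem nw_le {w v : ι → ℝ} (hw : ∀ i, 0 < w i) {c : ℝ} (hc : 0 ≤ c) :
    nw w v ≤ c ↔ ∀ i, |v i| ≤ c * w i := by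
  unfold nw
  rw [pi_norm_le_iff_of_nonneg hc]
  refine forall_congr' fun i => ?_
  rw [Pi.div_apply, Real.norm_eq_abs, abs_div, abs_of_pos (hw i), div_le_iff₀ (hw i)]

theorem nw_i {w : ι → ℝ} (hw : ∀ i, 0 < w i) (v : ι → ℝ) (i : ι) : |v i| ≤ nw w v * w i :=
  (nw_le hw (nw_nn w v)).1 le_rfl i

theorem nw_add (w v v' : ι → ℝ) : nw w (v + v') ≤ nw w v + nw w v' := by
  have e : (v + v') / w = v / w + v' / w := by ext i; simp [add_div]
  unfold nw; rw [e]; exact norm_add_le _ _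

theorem nw_neg (w v : ι → ℝ) : nw w (-v) = nw w v := by
  have e : (-v) / w = -(v / w) := by ext i; simp [neg_div]
  unfold nw; rw [e, norm_neg]

theorem nw_sub_comm (w v v' : ι → ℝ) : nw w (v - v') = nw w (v' - v) := by
  rw [← nw_neg, neg_sub]

theorem nw_tri (w a b c : ι → ℝ) : nw w (a - c) ≤ nw w (a - b) + nw w (b - c) := by
  have := nw_add w (a - b) (b - c); simpa using this

theorem nw_self (w a : ι → ℝ) : nw w (a - a) = 0 := by
  have e : (a - a) / w = 0 := by ext i; simp
  unfold nw; rw [e, norm_zero]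

theorem nw_comp {w w' : ι → ℝ} (hw : ∀ i, 0 < w i) (hw' : ∀ i, 0 < w' i) {M : ℝ} (hM : 0 ≤ M)
    (h : ∀ i, w' i ≤ M * w i) (v : ι → ℝ) : nw w v ≤ M * nw w' v := by
  rw [nw_le hw (mul_nonneg hM (nw_nn _ _))]
  intro i
  calc _ ≤ nw w' v * w' i := nw_i hw' v i
    _ ≤ nw w' v * (M * w i) := mul_le_mul_of_nonneg_left (h i) (nw_nn _ _)
    _ = _ := by ring

theorem nw_cont (w p : ι → ℝ) : Continuous fun q => nw w (q - p) := by
  unfold nw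
  have : Continuous fun q : ι → ℝ => (q - p) / w := by
    refine continuous_pi fun i => ?_
    simp only [Pi.div_apply, Pi.sub_apply]
    fun_prop
  exact this.norm

theorem nw_ev (w p : ι → ℝ) {c : ℝ} (hc : 0 < c) : ∀ᶠ q in 𝓝 p, nw w (q - p) < c :=
  (nw_cont w p).continuousAt.eventually (gt_mem_nhds (by beta_reduce; rw [nw_self]; exact hc))

theorem nw_tendsto {w : ι → ℝ} (hw : ∀ i, 0 < w i) {α : Type*} {l : Filter α} {f : α → ι → ℝ} {x : ι → ℝ}
    (h : Filter.Tendsto (fun a => nw w (f a - x)) l (𝓝 0)) : Filter.Tendsto f l (𝓝 x) := by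
  rw [tendsto_pi_nhds]
  intro i
  rw [tendsto_iff_norm_sub_tendsto_zero]
  have h2 : Filter.Tendsto (fun a => nw w (f a - x) * w i) l (𝓝 0) := by
    simpa using h.mul_const (w i)
  exact squeeze_zero (fun _ => norm_nonneg _) (fun a => nw_i hw (f a - x) i) h2

def PLw (w : ι → ℝ) (L : ℝ) (h : (ι → ℝ) → (ι → ℝ)) (p : ι → ℝ) : Prop :=
  ∀ᶠ q in 𝓝 p, nw w (h q - h p) ≤ L * nw w (q - p)

structure GW (w : ι → ℝ) (L ε : ℝ) (h k : (ι → ℝ) → (ι → ℝ)) (p : ι → ℝ) : Prop where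
  ch : nw w (h p - p) ≤ ε
  ck : nw w (k p - p) ≤ ε
  hk : h (k p) = p
  kh : k (h p) = p
  lh : PLw w L h p
  lk : PLw w L k p

theorem PLw.mono {w : ι → ℝ} {L L' : ℝ} {h : (ι → ℝ) → (ι → ℝ)} {p : ι → ℝ} (H : PLw w L h p) (hL : L ≤ L') :
    PLw w L' h p := by
  filter_upwards [H] with q hq
  exact hq.trans (mul_le_mul_of_nonneg_right hL (nw_nn _ _))

theorem PLw.congr {w : ι → ℝ} {L : ℝ} {h h' : (ι → ℝ) → (ι → ℝ)} {p : ι → ℝ} (H : PLw w L h p)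
    (e : h' =ᶠ[𝓝 p] h) : PLw w L h' p := by
  have := e.self_of_nhds
  filter_upwards [H, e] with q hq hq'
  rw [hq', this]; exact hq

theorem PLw.comp_w {w w' : ι → ℝ} (hw : ∀ i, 0 < w i) (hw' : ∀ i, 0 < w' i) {M L : ℝ} (hM : 0 ≤ M) (hL : 0 ≤ L)
    (h1 : ∀ i, w i ≤ M * w' i) (h2 : ∀ i, w' i ≤ M * w i)
    {h : (ι → ℝ) → (ι → ℝ)} {p : ι → ℝ} (H : PLw w L h p) : PLw w' (M ^ 2 * L) h p := by
  filter_upwards [H] with q hq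
  calc nw w' (h q - h p) ≤ M * nw w (h q - h p) := nw_comp hw' hw hM h1 _
    _ ≤ M * (L * nw w (q - p)) := mul_le_mul_of_nonneg_left hq hM
    _ ≤ M * (L * (M * nw w' (q - p))) := by gcongr; exact nw_comp hw hw' hM h2 _
    _ = _ := by ring

theorem GW.mono {w : ι → ℝ} {L L' ε ε' : ℝ} {h k : (ι → ℝ) → (ι → ℝ)} {p : ι → ℝ} (H : GW w L ε h k p)
    (hL : L ≤ L') (he : ε ≤ ε') : GW w L' ε' h k p :=
  ⟨H.ch.trans he, H.ck.trans he, H.hk, H.kh, H.lh.mono hL, H.lk.mono hL⟩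

theorem GW.congr {w : ι → ℝ} {L ε : ℝ} {h k h' k' : (ι → ℝ) → (ι → ℝ)} {p : ι → ℝ} (H : GW w L ε h k p)
    (e1 : h' =ᶠ[𝓝 p] h) (e2 : k' =ᶠ[𝓝 p] k) (e3 : h' (k p) = h (k p)) (e4 : k' (h p) = k (h p)) :
    GW w L ε h' k' p := by
  have a := e1.self_of_nhds
  have b := e2.self_of_nhds
  refine ⟨by rw [a]; exact H.ch, by rw [b]; exact H.ck, by rw [b, e3, H.hk], by rw [a, e4, H.kh],
    H.lh.congr e1, H.lk.congr e2⟩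

theorem GW.comp_w {w w' : ι → ℝ} (hw : ∀ i, 0 < w i) (hw' : ∀ i, 0 < w' i) {M L ε : ℝ} (hM : 0 ≤ M) (hL : 0 ≤ L)
    (h1 : ∀ i, w i ≤ M * w' i) (h2 : ∀ i, w' i ≤ M * w i)
    {h k : (ι → ℝ) → (ι → ℝ)} {p : ι → ℝ} (H : GW w L ε h k p) : GW w' (M ^ 2 * L) (M * ε) h k p :=
  ⟨(nw_comp hw' hw hM h1 _).trans (mul_le_mul_of_nonneg_left H.ch hM),
   (nw_comp hw' hw hM h1 _).trans (mul_le_mul_of_nonneg_left H.ck hM), H.hk, H.kh,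
   H.lh.comp_w hw hw' hM hL h1 h2, H.lk.comp_w hw hw' hM hL h1 h2⟩

/-- normalised maps -/
noncomputable def nrm (z s : ι → ℝ) (h : (ι → ℝ) → (ι → ℝ)) (v : ι → ℝ) : ι → ℝ := (h (z + s * v) - z) / s
noncomputable def den (z s : ι → ℝ) (F : (ι → ℝ) → (ι → ℝ)) (p : ι → ℝ) : ι → ℝ := z + s * F ((p - z) / s)

theorem zs1 {s : ι → ℝ} (hs : ∀ i, 0 < s i) (z v : ι → ℝ) : (z + s * v - z) / s = v := by
  ext i; have := (hs i).ne'; simp; field_simp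
theorem zs2 {s : ι → ℝ} (hs : ∀ i, 0 < s i) (z v : ι → ℝ) : z + s * ((v - z) / s) = v := by
  ext i; have := (hs i).ne'; simp; field_simp; ring
theorem zs3 {s : ι → ℝ} (hs : ∀ i, 0 < s i) (z v v' : ι → ℝ) : nw s (z + s * v - (z + s * v')) = ‖v - v'‖ := by
  unfold nw; congr 1; ext i; have := (hs i).ne'; simp; field_simp
theorem zs4 (s z p q : ι → ℝ) : ‖(p - z) / s - (q - z) / s‖ = nw s (p - q) := by
  unfold nw; congr 1; ext i; simp; ring

theorem zs_cont {s : ι → ℝ} (z : ι → ℝ) : Continuous fun p : ι → ℝ => (p - z) / s := by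
  refine continuous_pi fun i => ?_
  simp only [Pi.div_apply, Pi.sub_apply]
  fun_prop

theorem Gd_nrm {z s : ι → ℝ} (hs : ∀ i, 0 < s i) {L ε : ℝ} {h k : (ι → ℝ) → (ι → ℝ)} {v : ι → ℝ}
    (H : GW s L ε h k (z + s * v)) : Gd L ε (nrm z s h) (nrm z s k) v := by
  have c : Continuous fun v : ι → ℝ => z + s * v := by fun_prop
  have a1 : ∀ (h : (ι → ℝ) → (ι → ℝ)), ‖nrm z s h v - v‖ = nw s (h (z + s * v) - (z + s * v)) := by
    intro h
    rw [← zs4 s z, zs1 hs, nrm]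
  have a2 : ∀ (h : (ι → ℝ) → (ι → ℝ)), PLw s L h (z + s * v) → PL L (nrm z s h) v := by
    intro h hh
    filter_upwards [c.continuousAt.eventually hh] with q hq
    unfold nrm
    rw [zs4, ← zs3 hs z]; exact hq
  refine ⟨by rw [a1]; exact H.ch, by rw [a1]; exact H.ck, ?_, ?_, a2 _ H.lh, a2 _ H.lk⟩
  · unfold nrm; rw [zs2 hs, H.hk, zs1 hs]
  · unfold nrm; rw [zs2 hs, H.kh, zs1 hs]

theorem GW_den {z s : ι → ℝ} (hs : ∀ i, 0 < s i) {L ε : ℝ} {F G : (ι → ℝ) → (ι → ℝ)} {p : ι → ℝ}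
    (H : Gd L ε F G ((p - z) / s)) : GW s L ε (den z s F) (den z s G) p := by
  have a1 : ∀ (h : (ι → ℝ) → (ι → ℝ)), nw s (den z s h p - p) = ‖h ((p - z) / s) - (p - z) / s‖ := by
    intro h
    rw [← zs4 s z, den, zs1 hs]
  have a2 : ∀ (h : (ι → ℝ) → (ι → ℝ)), PL L h ((p - z) / s) → PLw s L (den z s h) p := by
    intro h hh
    filter_upwards [(zs_cont z).continuousAt.eventually hh] with q hq
    unfold den
    rw [zs3 hs, ← zs4 s z]; exact hq
  refine ⟨by rw [a1]; exact H.ch, by rw [a1]; exact H.ck, ?_, ?_, a2 _ H.lh, a2 _ H.lk⟩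
  · unfold den; rw [zs1 hs, H.hk, zs2 hs]
  · unfold den; rw [zs1 hs, H.kh, zs2 hs]

structure Step {J : Type*} (Ws Wt : (ι → ℝ) → (ι → ℝ)) (f g : (ι → ℝ) → (ι → ℝ) → (ι → ℝ))
    (z s : J → ι → ℝ) (C η : ℝ) : Prop where
  wsp : ∀ p i, 0 < Ws p i
  wtp : ∀ p i, 0 < Wt p i
  sp : ∀ j i, 0 < s j i
  C1 : 1 ≤ C
  η0 : 0 < η
  fg : ∀ p x, f p (g p x) = x
  gf : ∀ p x, g p (f p x) = x
  free : ∀ p, (∀ j, 1 < nw (s j) (p - z j)) → ∀ q r, nw (Ws p) (q - p) ≤ η → nw (Ws p) (r - p) ≤ η →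
    f q r = f p r
  flip : ∀ p r r', nw (Ws p) (r - p) ≤ η → nw (Ws p) (r' - p) ≤ η →
    nw (Wt (f p p)) (f p r - f p r') ≤ C * nw (Ws p) (r - r')
  glip : ∀ p y y', nw (Wt (f p p)) (y - f p p) ≤ η → nw (Wt (f p p)) (y' - f p p) ≤ η →
    nw (Ws p) (g p y - g p y') ≤ C * nw (Wt (f p p)) (y - y')
  disj : ∀ i j p, nw (s i) (p - z i) ≤ 10 → nw (s j) (p - z j) ≤ 10 → i = j
  cmp1 : ∀ j p, nw (s j) (p - z j) ≤ 10 → ∀ i, Ws p i ≤ C * s j i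
  cmp2 : ∀ j p, nw (s j) (p - z j) ≤ 10 → ∀ i, s j i ≤ C * Ws p i
  far : ∀ p q j, nw (Ws p) (q - p) ≤ η → nw (s j) (q - z j) ≤ 4 → nw (s j) (p - z j) ≤ 9

variable {J : Type*} {Ws Wt : (ι → ℝ) → (ι → ℝ)} {f g : (ι → ℝ) → (ι → ℝ) → (ι → ℝ)} {z s : J → ι → ℝ} {C η : ℝ}

def lft (f g : (ι → ℝ) → (ι → ℝ) → (ι → ℝ)) (h : (ι → ℝ) → (ι → ℝ)) (p : ι → ℝ) : ι → ℝ := g p (h (f p p))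

theorem Step.gloc (S : Step Ws Wt f g z s C η) {p : ι → ℝ} (hp : ∀ j, 1 < nw (s j) (p - z j)) {q y : ι → ℝ}
    (hq : nw (Ws p) (q - p) ≤ η) (hy : nw (Wt (f p p)) (y - f p p) ≤ η)
    (hy2 : C * nw (Wt (f p p)) (y - f p p) ≤ η) : g q y = g p y := by
  have h1 := S.glip p y (f p p) hy (by rw [nw_self]; exact S.η0.le)
  rw [S.gf] at h1
  have := S.free p hp q (g p y) hq (h1.trans hy2)
  rw [S.fg] at this
  conv_lhs => rw [← this]
  rw [S.gf]

theorem Step.lift_half (S : Step Ws Wt f g z s C η) {p : ι → ℝ} (hp : ∀ j, 1 < nw (s j) (p - z j))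
    {L ε : ℝ} (hL : 1 ≤ L) (hε : C * ε ≤ η / 2) {h k : (ι → ℝ) → (ι → ℝ)}
    (ch : nw (Wt (f p p)) (h (f p p) - f p p) ≤ ε) (ck : nw (Wt (f p p)) (k (f p p) - f p p) ≤ ε)
    (hk : h (k (f p p)) = f p p)
    (lh : PLw (Wt (f p p)) L h (f p p)) :
    nw (Ws p) (lft f g h p - p) ≤ C * ε ∧ lft f g h (lft f g k p) = p ∧ PLw (Ws p) (C ^ 2 * L) (lft f g h) p := by
  have η0 := S.η0
  have C1 := S.C1
  have ε0 : 0 ≤ ε := (nw_nn _ _).trans ch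
  have e1 : ε ≤ η / 2 := by nlinarith
  have cz : nw (Wt (f p p)) (f p p - f p p) ≤ η := by rw [nw_self]; exact η0.le
  have cz' : nw (Ws p) (p - p) ≤ η := by rw [nw_self]; exact η0.le
  have d1 := S.glip p (h (f p p)) (f p p) (by linarith) cz
  have d2 := S.glip p (k (f p p)) (f p p) (by linarith) cz
  rw [S.gf] at d1 d2
  have m1 : C * nw (Wt (f p p)) (h (f p p) - f p p) ≤ C * ε := by gcongr
  have m2 : C * nw (Wt (f p p)) (k (f p p) - f p p) ≤ C * ε := by gcongr
  refine ⟨d1.trans m1, ?_, ?_⟩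
  · have hq : nw (Ws p) (lft f g k p - p) ≤ η := d2.trans (by linarith)
    have h1 : f (lft f g k p) (lft f g k p) = k (f p p) := by
      rw [S.free p hp _ _ hq hq]; unfold lft; rw [S.fg]
    conv_lhs => unfold lft
    change g (lft f g k p) (h (f (lft f g k p) (lft f g k p))) = p
    rw [h1, hk, S.gloc hp hq cz (by rw [nw_self, mul_zero]; exact η0.le), S.gf]
  · have tf : Filter.Tendsto (f p) (𝓝 p) (𝓝 (f p p)) := by
      refine nw_tendsto (S.wtp (f p p)) ?_
      have t1 : Filter.Tendsto (fun q => C * nw (Ws p) (q - p)) (𝓝 p) (𝓝 0) := by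
        have := ((nw_cont (Ws p) p).const_mul C).tendsto p
        rwa [nw_self, mul_zero] at this
      refine squeeze_zero' (Filter.Eventually.of_forall fun _ => nw_nn _ _) ?_ t1
      filter_upwards [nw_ev (Ws p) p η0] with q hq
      exact S.flip p q p hq.le cz'
    have sm : 0 < η / (2 * C ^ 2 * L) := by positivity
    filter_upwards [nw_ev (Ws p) p η0, nw_ev (Ws p) p sm, tf.eventually lh] with q q1 q2 q3
    have fl := S.flip p q p q1.le cz'
    rw [lt_div_iff₀ (by positivity)] at q2
    have b1 : nw (Wt (f p p)) (h (f p q) - h (f p p)) ≤ L * (C * nw (Ws p) (q - p)) :=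
      q3.trans (by gcongr)
    have b2 := nw_tri (Wt (f p p)) (h (f p q)) (h (f p p)) (f p p)
    have nn := nw_nn (Ws p) (q - p)
    have b3 : C * nw (Wt (f p p)) (h (f p q) - f p p) ≤ η := by
      calc _ ≤ C * (L * (C * nw (Ws p) (q - p)) + ε) := by gcongr; linarith
        _ ≤ η := by nlinarith
    have b4 : nw (Wt (f p p)) (h (f p q) - f p p) ≤ η := by
      nlinarith [nw_nn (Wt (f p p)) (h (f p q) - f p p)]
    have e2 : lft f g h q = g p (h (f p q)) := by
      unfold lft
      rw [S.free p hp q q q1.le q1.le, S.gloc hp q1.le b4 b3]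
    rw [e2]
    calc _ ≤ C * nw (Wt (f p p)) (h (f p q) - h (f p p)) := S.glip p _ _ b4 (by linarith)
      _ ≤ C * (L * (C * nw (Ws p) (q - p))) := by gcongr
      _ = _ := by ring

theorem Step.lift (S : Step Ws Wt f g z s C η) {p : ι → ℝ} (hp : ∀ j, 1 < nw (s j) (p - z j))
    {L ε : ℝ} (hL : 1 ≤ L) (hε : C * ε ≤ η / 2) {h k : (ι → ℝ) → (ι → ℝ)}
    (H : GW (Wt (f p p)) L ε h k (f p p)) : GW (Ws p) (C ^ 2 * L) (C * ε) (lft f g h) (lft f g k) p := by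
  obtain ⟨a1, a2, a3⟩ := S.lift_half hp hL hε H.ch H.ck H.hk H.lh
  obtain ⟨b1, b2, b3⟩ := S.lift_half hp hL hε H.ck H.ch H.kh H.lk
  exact ⟨a1, b1, a2, b2, a3, b3⟩

theorem Step.main (S : Step Ws Wt f g z s C η) {ε : ℝ} (hε : C * ε ≤ η / 2) (hε2 : C * (C * ε) ≤ 1 / 50)
    (h k : (ι → ℝ) → (ι → ℝ)) : ∃ h' k' : (ι → ℝ) → (ι → ℝ),
    (∀ p, (∀ j, 4 < nw (s j) (p - z j)) → h' p = lft f g h p ∧ k' p = lft f g k p) ∧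
    (∀ p L, 1 ≤ L → (∀ q, (q = p ∨ ∃ j, nw (s j) (p - z j) ≤ 9 ∧ nw (s j) (q - z j) ≤ 10) →
        GW (Wt (f q q)) L ε h k (f q q)) → GW (Ws p) (1152 * C ^ 14 * L ^ 3) (30 * C) h' k' p) ∧
    (∀ p, (∀ q, (q = p ∨ ∃ j, nw (s j) (p - z j) ≤ 9 ∧ nw (s j) (q - z j) ≤ 10) →
        h (f q q) = f q q ∧ k (f q q) = f q q) → h' p = p ∧ k' p = p) := by
  classical
  have η0 := S.η0
  have C1 := S.C1
  choose F G FG1 FG2 FG3 using fun j => fill (nrm (z j) (s j) (lft f g h)) (nrm (z j) (s j) (lft f g k))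
  let H : ((ι → ℝ) → (ι → ℝ)) → (J → (ι → ℝ) → (ι → ℝ)) → (ι → ℝ) → (ι → ℝ) := fun l F p =>
    if e : ∃ j, nw (s j) (p - z j) < 4 then den (z e.choose) (s e.choose) (F e.choose) p else l p
  have Hout : ∀ l F p, (∀ j, 4 ≤ nw (s j) (p - z j)) → H l F p = l p := by
    intro l F p hp
    have : ¬ ∃ j, nw (s j) (p - z j) < 4 := by push Not; exact hp
    simp only [H, dif_neg this]
  have Hin : ∀ l F p j, (∀ x, 4 ≤ ‖x‖ → F j x = nrm (z j) (s j) l x) → nw (s j) (p - z j) ≤ 10 →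
      H l F p = den (z j) (s j) (F j) p := by
    intro l F p j hF hp
    by_cases e : ∃ j, nw (s j) (p - z j) < 4
    · have : e.choose = j := S.disj _ _ p (by linarith [e.choose_spec]) hp
      simp only [H, dif_pos e, this]
    · simp only [H, dif_neg e]
      push Not at e
      unfold den
      have e2 := e j
      unfold nw at e2
      rw [hF _ e2, nrm, zs2 (S.sp j), zs2 (S.sp j)]
  refine ⟨H (lft f g h) F, H (lft f g k) G, ?_, ?_, ?_⟩
  · intro p hp
    exact ⟨Hout _ _ _ fun j => (hp j).le, Hout _ _ _ fun j => (hp j).le⟩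
  · intro p L hL hyp
    have L3 : 1 ≤ L ^ 3 := one_le_pow₀ hL
    have LL : L ≤ L ^ 3 := le_self_pow₀ hL (by norm_num)
    by_cases hb : ∃ j, nw (s j) (p - z j) ≤ 9
    · obtain ⟨j, hj⟩ := hb
      have hi1 := fun p => Hin (lft f g h) F p j (fun x hx => (FG1 j x hx).1)
      have hi2 := fun p => Hin (lft f g k) G p j (fun x hx => (FG1 j x hx).2)
      have sh : SH (C ^ 2 * (C ^ 2 * L)) (nrm (z j) (s j) (lft f g h)) (nrm (z j) (s j) (lft f g k)) := by
        intro v v1 v2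
        refine Gd_nrm (S.sp j) ?_
        have nv : nw (s j) (z j + s j * v - z j) = ‖v‖ := by unfold nw; rw [zs1 (S.sp j)]
        have hfree : ∀ i, 1 < nw (s i) (z j + s j * v - z i) := by
          intro i
          by_contra hc
          push Not at hc
          have : i = j := S.disj _ _ (z j + s j * v) (by linarith) (by rw [nv]; exact v2)
          rw [this, nv] at hc; linarith
        have g1 := S.lift hfree hL hε (hyp _ (Or.inr ⟨j, hj, by rw [nv]; exact v2⟩))
        have := g1.comp_w (S.wsp _) (S.sp j) (M := C) (by linarith) (by positivity)
          (S.cmp1 j _ (by rw [nv]; exact v2)) (S.cmp2 j _ (by rw [nv]; exact v2))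
        exact this.mono le_rfl hε2
      have nb : ‖(p - z j) / s j‖ ≤ 9 := hj
      obtain ⟨g1, g2, g3⟩ := FG2 j (C ^ 2 * (C ^ 2 * L)) (by
        have c2 : 1 ≤ C ^ 2 := one_le_pow₀ C1
        exact one_le_mul_of_one_le_of_one_le c2 (one_le_mul_of_one_le_of_one_le c2 hL)) sh _ nb
      have g4 := GW_den (S.sp j) g1
      have ev : ∀ᶠ q in 𝓝 p, nw (s j) (q - z j) ≤ 10 := by
        filter_upwards [(nw_cont (s j) (z j)).continuousAt.eventually (gt_mem_nhds (show nw (s j) (p - z j) < 10 by linarith))] with q hq using hq.le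
      have g5 : GW (s j) (1152 * (C ^ 2 * (C ^ 2 * L)) ^ 3) 30 (H (lft f g h) F) (H (lft f g k) G) p := by
        refine g4.congr ?_ ?_ ?_ ?_
        · filter_upwards [ev] with q hq using hi1 q hq
        · filter_upwards [ev] with q hq using hi2 q hq
        · refine hi1 _ ?_
          unfold nw den; rw [zs1 (S.sp j)]; exact g3
        · refine hi2 _ ?_
          unfold nw den; rw [zs1 (S.sp j)]; exact g2
      have g6 := g5.comp_w (S.sp j) (S.wsp p) (M := C) (by linarith) (by positivity) (S.cmp2 j p (by linarith)) (S.cmp1 j p (by linarith))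
      refine g6.mono (le_of_eq (by ring)) (by linarith)
    · push Not at hb
      have g1 := S.lift (fun j => by linarith [hb j]) hL hε (hyp p (Or.inl rfl))
      have e1 : ∀ q, nw (Ws p) (q - p) ≤ η → ∀ j, 4 ≤ nw (s j) (q - z j) := by
        intro q hq j
        by_contra hc
        push Not at hc
        linarith [hb j, S.far p q j hq hc.le]
      have g2 : GW (Ws p) (C ^ 2 * L) (C * ε) (H (lft f g h) F) (H (lft f g k) G) p := by
        refine g1.congr ?_ ?_ ?_ ?_
        · filter_upwards [nw_ev (Ws p) p η0] with q hq using Hout _ _ _ (e1 q hq.le)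
        · filter_upwards [nw_ev (Ws p) p η0] with q hq using Hout _ _ _ (e1 q hq.le)
        · exact Hout _ _ _ (e1 _ (g1.ck.trans (by linarith)))
        · exact Hout _ _ _ (e1 _ (g1.ch.trans (by linarith)))
      refine g2.mono ?_ ?_
      · have : C ^ 2 ≤ C ^ 14 := pow_le_pow_right₀ C1 (by norm_num)
        calc C ^ 2 * L ≤ C ^ 14 * L ^ 3 := by gcongr
          _ ≤ _ := by nlinarith [show 0 ≤ C ^ 14 * L ^ 3 by positivity]
      · have : C * ε ≤ 1 := by
          by_contra hc
          push Not at hc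
          nlinarith
        linarith
  · intro p hyp
    have idl : ∀ q, h (f q q) = f q q → lft f g h q = q := fun q hq => by unfold lft; rw [hq, S.gf]
    have idk : ∀ q, k (f q q) = f q q → lft f g k q = q := fun q hq => by unfold lft; rw [hq, S.gf]
    by_cases hb : ∃ j, nw (s j) (p - z j) ≤ 9
    · obtain ⟨j, hj⟩ := hb
      have key := FG3 j (by
        intro v v1 v2
        have nv : nw (s j) (z j + s j * v - z j) = ‖v‖ := by unfold nw; rw [zs1 (S.sp j)]
        have := hyp (z j + s j * v) (Or.inr ⟨j, hj, by rw [nv]; exact v2⟩)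
        unfold nrm
        rw [idl _ this.1, idk _ this.2, zs1 (S.sp j)]; exact ⟨rfl, rfl⟩) ((p - z j) / s j) (by unfold nw at hj; linarith)
      rw [Hin (lft f g h) F p j (fun x hx => (FG1 j x hx).1) (by linarith),
        Hin (lft f g k) G p j (fun x hx => (FG1 j x hx).2) (by linarith)]
      unfold den
      rw [key.1, key.2, zs2 (S.sp j)]; exact ⟨rfl, rfl⟩
    · push Not at hb
      rw [Hout _ _ _ fun j => by linarith [hb j], Hout _ _ _ fun j => by linarith [hb j]]
      exact ⟨idl _ (hyp p (Or.inl rfl)).1, idk _ (hyp p (Or.inl rfl)).2⟩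

end step
end CDE


namespace CDE

noncomputable def lam (t : ℝ) : ℝ := (2:ℝ) ^ (-(max t 0))

theorem lam_pos (t : ℝ) : 0 < lam t := Real.rpow_pos_of_pos (by norm_num) _
theorem lam_le_one (t : ℝ) : lam t ≤ 1 := Real.rpow_le_one_of_one_le_of_nonpos (by norm_num) (by simp)
theorem lam_neg {t : ℝ} (h : t ≤ 0) : lam t = 1 := by simp [lam, max_eq_right h]

theorem max_dist (t t' : ℝ) : |max t 0 - max t' 0| ≤ |t - t'| := by
  have := abs_max_sub_max_le_max t 0 t' 0
  simpa using this

theorem lam_quot (t t' : ℝ) : lam t = (2:ℝ) ^ (max t' 0 - max t 0) * lam t' := by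
  unfold lam; rw [← Real.rpow_add (by norm_num)]; congr 1; ring

theorem lam_cmp {t t' : ℝ} {d : ℕ} (h : |t - t'| ≤ d) : lam t ≤ 2 ^ d * lam t' := by
  rw [lam_quot t t']
  refine mul_le_mul_of_nonneg_right ?_ (lam_pos _).le
  rw [← Real.rpow_natCast]
  refine Real.rpow_le_rpow_of_exponent_le (by norm_num) ?_
  have := max_dist t' t
  rw [abs_sub_comm t' t] at this
  exact (le_abs_self _).trans (this.trans h)

theorem lam_cmp1 {t t' : ℝ} (h : |t - t'| ≤ 1) : lam t ≤ 2 * lam t' := by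
  simpa using lam_cmp (d := 1) (by simpa using h)
theorem lam_cmp2 {t t' : ℝ} (h : |t - t'| ≤ 2) : lam t ≤ 4 * lam t' := by
  have := lam_cmp (d := 2) (by simpa using h)
  norm_num at this; exact this

theorem two_rpow_sub_one {s : ℝ} (h : |s| ≤ 1) : |(2:ℝ) ^ s - 1| ≤ 2 * |s| := by
  have l1 : Real.log 2 ≤ 1 := by linarith [Real.log_two_lt_d9]
  have l0 : 0 ≤ Real.log 2 := Real.log_nonneg (by norm_num)
  have e : |Real.log 2 * s| ≤ |s| := by
    rw [abs_mul, abs_of_nonneg l0]; nlinarith [abs_nonneg s]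
  rw [Real.rpow_def_of_pos (by norm_num)]
  exact (Real.abs_exp_sub_one_le (e.trans h)).trans (by linarith)

theorem lam_lip {t t' : ℝ} (h : |t - t'| ≤ 1) : |lam t - lam t'| ≤ 2 * lam t' * |t - t'| := by
  have e : lam t - lam t' = ((2:ℝ) ^ (max t' 0 - max t 0) - 1) * lam t' := by
    conv_lhs => rw [lam_quot t t']
    ring
  have m := max_dist t' t
  rw [abs_sub_comm t' t] at m
  rw [e, abs_mul, abs_of_pos (lam_pos t')]
  have := two_rpow_sub_one (m.trans h)
  nlinarith [lam_pos t']

theorem lam_inv_lip {t t' : ℝ} (h : |t - t'| ≤ 1) : |(lam t)⁻¹ - (lam t')⁻¹| ≤ 2 * (lam t')⁻¹ * |t - t'| := by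
  have h1 := lam_pos t
  have h2 := lam_pos t'
  have e : (lam t)⁻¹ - (lam t')⁻¹ = (lam t' - lam t) * ((lam t)⁻¹ * (lam t')⁻¹) := by field_simp
  have l := lam_lip (t := t') (t' := t) (by rw [abs_sub_comm]; exact h)
  rw [e, abs_mul, abs_of_pos (by positivity : 0 < (lam t)⁻¹ * (lam t')⁻¹)]
  rw [abs_sub_comm t' t] at l
  calc _ ≤ 2 * lam t * |t - t'| * ((lam t)⁻¹ * (lam t')⁻¹) := by gcongr
    _ = _ := by field_simp

theorem lam_int (m : ℤ) : lam m = lam ((m + 1 : ℤ) : ℝ) ∨ lam m = 2 * lam ((m + 1 : ℤ) : ℝ) := by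
  rcases lt_or_ge m 0 with h | h
  · left
    rw [lam_neg (by exact_mod_cast h.le), lam_neg (by exact_mod_cast (by omega : m + 1 ≤ 0))]
  · right
    have h1 : (0:ℝ) ≤ m := by exact_mod_cast h
    rw [lam_quot m ((m+1 : ℤ) : ℝ)]
    congr 1
    push_cast
    rw [max_eq_left h1, max_eq_left (by linarith)]
    norm_num

section grid
variable {ι : Type*} [Fintype ι] [DecidableEq ι]

/-- weights with coordinates in `A` scaled by `x`. -/
noncomputable def wsc (N : ℕ) (A : Finset ι) (x : ℝ) (i : ι) : ℝ := (1 / N) * (if i ∈ A then x else 1)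
noncomputable def wt (N : ℕ) (τ : ι) (A : Finset ι) (p : ι → ℝ) : ι → ℝ := wsc N A (lam (p τ))

theorem wsc_pos {N : ℕ} (hN : 40 ≤ N) (A : Finset ι) {x : ℝ} (hx : 0 < x) (i : ι) : 0 < wsc N A x i := by
  have : (0:ℝ) < N := by exact_mod_cast (by omega : 0 < N)
  unfold wsc; split_ifs <;> positivity

theorem wsc_cmp {N : ℕ} (A : Finset ι) {x y c : ℝ} (hc : 1 ≤ c) (h : x ≤ c * y) (i : ι) :
    wsc N A x i ≤ c * wsc N A y i := by
  have : (0:ℝ) ≤ 1 / N := by positivity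
  unfold wsc; split_ifs <;> nlinarith

theorem wsc_le {N : ℕ} (A : Finset ι) {x : ℝ} (h : x ≤ 1) (i : ι) : wsc N A x i ≤ 1 / N := by
  have : (0:ℝ) ≤ 1 / N := by positivity
  unfold wsc; split_ifs <;> nlinarith

theorem wt_pos {N : ℕ} (hN : 40 ≤ N) (τ : ι) (A : Finset ι) (p : ι → ℝ) (i : ι) : 0 < wt N τ A p i :=
  wsc_pos hN A (lam_pos _) i

/-- grid data -/
structure Gr (ι : Type*) where
  N : ℕ
  τ : ι
  κ : ι
  A : Finset ι
  ω : ℝ → ℝ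
  ρ : ℝ

structure Gr.ok (g : Gr ι) : Prop where
  hN : 40 ≤ g.N
  hτ : g.τ ∉ g.A
  hc : (g.κ = g.τ ∧ g.A = ∅ ∧ g.ω = (fun x => max x 0) ∧ g.ρ = 0) ∨ (g.κ ≠ g.τ ∧ g.κ ∈ g.A ∧ g.ω = (fun x => x) ∧ g.ρ = 1)

namespace Gr

variable (g : Gr ι)

noncomputable def fl (a : ι → ℤ) : ℤ := ⌊(a g.τ : ℝ) / g.N⌋
noncomputable def S (a : ι → ℤ) : ι → ℝ := wsc g.N g.A (lam (g.fl a))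
noncomputable def vv (a : ι → ℤ) (q : ι → ℝ) (i : ι) : ℝ := if i = g.κ then 0 else q i / g.S a i - a i
noncomputable def nv (a : ι → ℤ) (q : ι → ℝ) : ℝ := ‖g.vv a q‖
noncomputable def φ (a : ι → ℤ) (q : ι → ℝ) : ℝ := 8 * g.S a g.κ * max (g.nv a q - 1/2) 0
noncomputable def Q (ι : Type*) [Fintype ι] [DecidableEq ι] : ℝ := Fintype.card (ι → ZMod 32)
noncomputable def res (a : ι → ℤ) (i : ι) : ZMod 32 := if i = g.κ then 0 else (a i : ZMod 32)
noncomputable def o (a : ι → ℤ) : ℝ := 1/7 + (Fintype.equivFin (ι → ZMod 32) (g.res a) : ℕ) / (100 * Q ι)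
noncomputable def Hr (a : ι → ℤ) (b : ℝ) : ℝ := g.S a g.κ * (⌊b / g.S a g.κ - g.o a⌋ + g.o a)
def cset (b : ℝ) (q : ι → ℝ) : Set ℝ := {x | ∃ a, g.nv a q ≤ 1 ∧ x = g.ω (g.Hr a b) - g.φ a q}
noncomputable def c (b : ℝ) (q : ι → ℝ) : ℝ := sSup (g.cset b q)
noncomputable def ell (q : ι → ℝ) : ℝ := if g.κ ∈ g.A then lam (q g.τ) else 1
noncomputable def f (p q : ι → ℝ) : ι → ℝ :=
  Function.update q g.κ (g.ρ * g.c (p g.κ) q + (q g.κ - g.c (p g.κ) q) * (g.ell q)⁻¹)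
noncomputable def gg (p q : ι → ℝ) : ι → ℝ :=
  Function.update q g.κ (g.c (p g.κ) q + (q g.κ - g.ρ * g.c (p g.κ) q) * g.ell q)
noncomputable def Ws : (ι → ℝ) → ι → ℝ := wt g.N g.τ g.A
noncomputable def Wt : (ι → ℝ) → ι → ℝ := wt g.N g.τ (g.A.erase g.κ)
noncomputable def θ (ι : Type*) [Fintype ι] [DecidableEq ι] : ℝ := 1 / (10000 * Q ι)
noncomputable def zc (a : ι → ℤ) (i : ι) : ℝ := if i = g.κ then g.S a i * (a i + g.o a) else g.S a i * a i
noncomputable def sz (a : ι → ℤ) (i : ι) : ℝ := if i = g.κ then θ ι * g.S a i else 11/10 * g.S a i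

theorem Q1 : 1 ≤ Q ι := by
  unfold Q; exact_mod_cast Fintype.card_pos
theorem θ0 : 0 < θ ι := by have := Q1 (ι := ι); unfold θ; positivity
theorem θ1 : θ ι ≤ 1/10000 := by
  have := Q1 (ι := ι); unfold θ
  rw [div_le_div_iff₀ (by positivity) (by norm_num)]; linarith

variable {g}
variable (G : g.ok)
include G

theorem Sp (a : ι → ℤ) (i : ι) : 0 < g.S a i := wsc_pos G.hN _ (lam_pos _) i
theorem Wp (q : ι → ℝ) (i : ι) : 0 < g.Ws q i := wt_pos G.hN _ _ q i
theorem N0 : (0:ℝ) < g.N := by have := G.hN; exact_mod_cast (by omega : 0 < g.N)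
theorem N40 : (40:ℝ) ≤ g.N := by have := G.hN; exact_mod_cast this
theorem Sτ (a : ι → ℤ) : g.S a g.τ = 1 / g.N := by simp [S, wsc, G.hτ]
theorem Wτ (a : ι → ℝ) : g.Ws a g.τ = 1 / g.N := by simp [Ws, wt, wsc, G.hτ]
theorem Wκ (p : ι → ℝ) : g.Ws p g.κ = 1 / g.N * g.ell p := by simp [Ws, wt, wsc, ell]
theorem ell_pos (p : ι → ℝ) : 0 < g.ell p := by unfold ell; split_ifs; exact lam_pos _; norm_num
theorem ell_le (p : ι → ℝ) : g.ell p ≤ 1 := by unfold ell; split_ifs; exact lam_le_one _; norm_num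

theorem nv_i (a : ι → ℤ) (q : ι → ℝ) {i : ι} (hi : i ≠ g.κ) : |q i / g.S a i - a i| ≤ g.nv a q := by
  have := norm_le_pi_norm (g.vv a q) i
  unfold nv
  simpa [vv, hi] using this
theorem nv_i' (a : ι → ℤ) (q : ι → ℝ) {i : ι} (hi : i ≠ g.κ) : |q i - g.S a i * a i| ≤ g.nv a q * g.S a i := by
  have h := Sp G a i
  have e : q i - g.S a i * a i = (q i / g.S a i - a i) * g.S a i := by field_simp
  rw [e, abs_mul, abs_of_pos h]
  exact mul_le_mul_of_nonneg_right (nv_i G a q hi) h.le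
theorem nv_le {a : ι → ℤ} {q : ι → ℝ} {r : ℝ} (hr : 0 ≤ r) (h : ∀ i, i ≠ g.κ → |q i / g.S a i - a i| ≤ r) :
    g.nv a q ≤ r := by
  unfold nv; rw [pi_norm_le_iff_of_nonneg hr]
  intro i
  unfold vv
  split_ifs with hi
  · simpa using hr
  · exact h i hi

/-- τ control -/
theorem nvτ {a : ι → ℤ} {q : ι → ℝ} (h : g.κ ≠ g.τ) : |g.N * q g.τ - a g.τ| ≤ g.nv a q := by
  have := nv_i G a q h.symm
  rw [Sτ G] at this
  simpa [div_eq_mul_inv, mul_comm] using this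

theorem cmp0 {a : ι → ℤ} {q : ι → ℝ} (h : g.κ ≠ g.τ → |g.N * q g.τ - a g.τ| ≤ 12) :
    (∀ i, g.Ws q i ≤ 4 * g.S a i) ∧ (∀ i, g.S a i ≤ 4 * g.Ws q i) := by
  rcases G.hc with ⟨_, hA, _⟩ | ⟨hk, _⟩
  · have : (0:ℝ) ≤ 1 / g.N := by positivity
    constructor <;> intro i <;> simp only [Ws, wt, S, wsc, hA, Finset.notMem_empty, if_false] <;> linarith
  · have h := h hk
    have hN := N40 G
    have N0 := N0 G
    have f1 := Int.floor_le ((a g.τ : ℝ) / g.N)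
    have f2 := Int.lt_floor_add_one ((a g.τ : ℝ) / g.N)
    have e : |q g.τ - (a g.τ : ℝ) / g.N| ≤ 1 := by
      have e1 : q g.τ - (a g.τ : ℝ) / g.N = (g.N * q g.τ - a g.τ) / g.N := by field_simp
      rw [e1, abs_div, abs_of_pos N0, div_le_one N0]; linarith
    have e2 : |q g.τ - (g.fl a : ℝ)| ≤ 2 := by
      rw [abs_le] at e ⊢; unfold fl; constructor <;> linarith [e.1, e.2]
    exact ⟨fun i => wsc_cmp _ (by norm_num) (lam_cmp2 e2) i,
      fun i => wsc_cmp _ (by norm_num) (lam_cmp2 (by rw [abs_sub_comm]; exact e2)) i⟩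

theorem fl_close {a b : ι → ℤ} (h : |(a g.τ : ℝ) - b g.τ| < g.N) : g.fl a ≤ g.fl b + 1 := by
  have N0 := N0 G
  have f1 := Int.floor_le ((a g.τ : ℝ) / g.N)
  have f2 := Int.lt_floor_add_one ((b g.τ : ℝ) / g.N)
  have : (a g.τ : ℝ) / g.N - b g.τ / g.N < 1 := by
    rw [← sub_div, div_lt_one N0]; exact (le_abs_self _).trans_lt h
  have : (g.fl a : ℝ) < g.fl b + 2 := by unfold fl; linarith
  have : g.fl a < g.fl b + 2 := by exact_mod_cast this
  omega

theorem cmp1 {a b : ι → ℤ} {q : ι → ℝ} (ha : g.nv a q ≤ 2) (hb : g.nv b q ≤ 2) (i : ι) :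
    g.S a i ≤ 2 * g.S b i := by
  rcases G.hc with ⟨_, hA, _⟩ | ⟨hk, _⟩
  · have : (0:ℝ) ≤ 1 / g.N := by positivity
    simp only [S, wsc, hA, Finset.notMem_empty, if_false]; linarith
  · have h1 := abs_le.1 ((nvτ G hk).trans ha)
    have h2 := abs_le.1 ((nvτ G hk).trans hb)
    have hN := N40 G
    have e1 : g.fl a ≤ g.fl b + 1 := fl_close G (by rw [abs_lt]; constructor <;> linarith [h1.1, h1.2, h2.1, h2.2])
    have e2 : g.fl b ≤ g.fl a + 1 := fl_close G (by rw [abs_lt]; constructor <;> linarith [h1.1, h1.2, h2.1, h2.2])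
    refine wsc_cmp _ (by norm_num) (lam_cmp1 ?_) i
    rw [abs_le]
    have e1 : (g.fl a : ℝ) ≤ g.fl b + 1 := by exact_mod_cast e1
    have e2 : (g.fl b : ℝ) ≤ g.fl a + 1 := by exact_mod_cast e2
    constructor <;> linarith

theorem core (q : ι → ℝ) : ∃ a, g.nv a q ≤ 1/2 := by
  let x : ℝ := lam ⌊(round (q g.τ / (1 / g.N)) : ℝ) / g.N⌋
  let a : ι → ℤ := fun i => round (q i / wsc g.N g.A x i)
  have e : g.S a = wsc g.N g.A x := by
    have : a g.τ = round (q g.τ / (1 / g.N)) := by simp [a, wsc, G.hτ]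
    unfold S fl; rw [this]
  refine ⟨a, nv_le G (by norm_num) fun i _ => ?_⟩
  rw [e]
  exact abs_sub_round _

theorem ω_mono : Monotone g.ω := by
  rcases G.hc with ⟨_, _, h, _⟩ | ⟨_, _, h, _⟩ <;> rw [h]
  · intro x y h; exact max_le_max h le_rfl
  · exact monotone_id
theorem ω_lip {x y : ℝ} (h : x ≤ y) : g.ω y ≤ g.ω x + (y - x) := by
  rcases G.hc with ⟨_, _, h, _⟩ | ⟨_, _, h, _⟩ <;> rw [h]
  · exact max_le (by linarith [le_max_left x 0]) (by linarith [le_max_right x 0])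
  · simp

theorem Hr_le (a : ι → ℤ) (b : ℝ) : g.Hr a b ≤ b := by
  have h := Sp G a g.κ
  have f1 := Int.floor_le (b / g.S a g.κ - g.o a)
  have : g.S a g.κ * (⌊b / g.S a g.κ - g.o a⌋ + g.o a) ≤ g.S a g.κ * (b / g.S a g.κ) := by gcongr; linarith
  unfold Hr; refine this.trans (le_of_eq (by field_simp))
theorem Hr_ge (a : ι → ℤ) (b : ℝ) : b - g.S a g.κ ≤ g.Hr a b := by
  have h := Sp G a g.κ
  have f1 := Int.lt_floor_add_one (b / g.S a g.κ - g.o a)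
  have : g.S a g.κ * (b / g.S a g.κ - 1) ≤ g.S a g.κ * (⌊b / g.S a g.κ - g.o a⌋ + g.o a) := by gcongr; linarith
  unfold Hr; refine le_trans (le_of_eq (by field_simp)) this

theorem φ_nn (a : ι → ℤ) (q : ι → ℝ) : 0 ≤ g.φ a q := by
  have h := Sp G a g.κ
  unfold φ; have := le_max_right (g.nv a q - 1/2) 0; positivity

theorem c_bdd (b : ℝ) (q : ι → ℝ) : ∀ x ∈ g.cset b q, x ≤ g.ω b := by
  rintro x ⟨a, _, rfl⟩
  have := ω_mono G (Hr_le G a b)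
  linarith [φ_nn G a q]
theorem c_ne (b : ℝ) (q : ι → ℝ) : (g.cset b q).Nonempty := by
  obtain ⟨a, ha⟩ := core G q
  exact ⟨_, a, by linarith, rfl⟩
theorem c_le (b : ℝ) (q : ι → ℝ) : g.c b q ≤ g.ω b := csSup_le (c_ne G b q) (c_bdd G b q)
theorem le_c {b : ℝ} {q : ι → ℝ} {a : ι → ℤ} (h : g.nv a q ≤ 1) : g.ω (g.Hr a b) - g.φ a q ≤ g.c b q :=
  le_csSup ⟨_, c_bdd G b q⟩ ⟨a, h, rfl⟩
theorem c_ge {b : ℝ} {q : ι → ℝ} {a : ι → ℤ} (h : g.nv a q ≤ 1/2) : g.ω b - g.S a g.κ ≤ g.c b q := by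
  have h1 := le_c G (b := b) (show g.nv a q ≤ 1 by linarith)
  have h2 : g.φ a q = 0 := by unfold φ; rw [max_eq_right (by linarith), mul_zero]
  have h3 := ω_lip G (Hr_le G a b)
  have h4 := Hr_ge G a b
  linarith

theorem vv_upd (a : ι → ℤ) (q : ι → ℝ) (x : ℝ) : g.nv a (Function.update q g.κ x) = g.nv a q := by
  unfold nv; congr 1; ext i; unfold vv
  split_ifs with h
  · rfl
  · rw [Function.update_of_ne h]
theorem c_upd (b : ℝ) (q : ι → ℝ) (x : ℝ) : g.c b (Function.update q g.κ x) = g.c b q := by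
  simp only [c, cset, φ, vv_upd G]
theorem ell_upd (q : ι → ℝ) (x : ℝ) : g.ell (Function.update q g.κ x) = g.ell q := by
  unfold ell
  split_ifs with h
  · rw [Function.update_of_ne]; rintro e; exact G.hτ (e ▸ h)
  · rfl

theorem fg (p x : ι → ℝ) : g.f p (g.gg p x) = x := by
  have := (ell_pos G x).ne'
  unfold f gg
  rw [c_upd G, ell_upd G]
  simp only [Function.update_self, Function.update_idem]
  ext i
  by_cases h : i = g.κ
  · subst h; simp only [Function.update_self]; field_simp; ring
  · rw [Function.update_of_ne h]
theorem gf (p x : ι → ℝ) : g.gg p (g.f p x) = x := by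
  have := (ell_pos G x).ne'
  unfold f gg
  rw [c_upd G, ell_upd G]
  simp only [Function.update_self, Function.update_idem]
  ext i
  by_cases h : i = g.κ
  · subst h; simp only [Function.update_self]; field_simp; ring
  · rw [Function.update_of_ne h]

/-- closeness off κ -/
theorem nearτ {p u : ι → ℝ} (hu : ∀ i, i ≠ g.κ → |u i - p i| ≤ 1/100 * g.Ws p i) {a : ι → ℤ} {r : ℝ}
    (ha : g.nv a u ≤ r) : g.κ ≠ g.τ → |g.N * p g.τ - a g.τ| ≤ r + 1/100 := by
  intro hk
  have N0 := N0 G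
  have h1 := hu g.τ hk.symm
  rw [Wτ G] at h1
  have h2 := (nvτ G (a := a) (q := u) hk).trans ha
  have e : g.N * p g.τ - a g.τ = (g.N * u g.τ - a g.τ) - g.N * (u g.τ - p g.τ) := by ring
  rw [e]
  refine (abs_sub _ _).trans ?_
  rw [abs_mul, abs_of_pos N0]
  have : g.N * |u g.τ - p g.τ| ≤ g.N * (1/100 * (1 / g.N)) := by gcongr
  have e2 : (g.N:ℝ) * (1/100 * (1 / g.N)) = 1/100 := by field_simp
  linarith

theorem nv_lip {p u u' : ι → ℝ} {a : ι → ℤ} {D : ℝ} (hD : 0 ≤ D) (h : ∀ i, g.Ws p i ≤ 4 * g.S a i)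
    (hu : ∀ i, i ≠ g.κ → |u i - u' i| ≤ D * g.Ws p i) : g.nv a u' ≤ g.nv a u + 4 * D := by
  refine nv_le G (by have := norm_nonneg (g.vv a u); unfold nv; positivity) fun i hi => ?_
  have hS := Sp G a i
  have e : u' i / g.S a i - a i = (u i / g.S a i - a i) - (u i - u' i) / g.S a i := by ring
  rw [e]
  refine (abs_sub _ _).trans (add_le_add (nv_i G a u hi) ?_)
  rw [abs_div, abs_of_pos hS, div_le_iff₀ hS]
  refine (hu i hi).trans ?_
  nlinarith [h i]

theorem c_lip_half {p u u' : ι → ℝ} {b D : ℝ} (hD : 0 ≤ D)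
    (hu : ∀ i, i ≠ g.κ → |u i - p i| ≤ 1/100 * g.Ws p i) (hu' : ∀ i, i ≠ g.κ → |u' i - p i| ≤ 1/100 * g.Ws p i)
    (h : ∀ i, i ≠ g.κ → |u i - u' i| ≤ D * g.Ws p i) : g.c b u ≤ g.c b u' + 128 * D * g.Ws p g.κ := by
  refine csSup_le (c_ne G b u) ?_
  rintro _ ⟨a, ha, rfl⟩
  have cm := cmp0 G (q := p) (a := a) (fun hk => (nearτ G hu ha hk).trans (by norm_num))
  have hS := Sp G a g.κ
  have n1 : g.nv a u' ≤ g.nv a u + 4 * D := nv_lip G hD cm.1 h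
  have n2 : g.nv a u' ≤ g.nv a u + 4 * (1/50) := nv_lip G (by norm_num) cm.1 fun i hi => by
    have := abs_sub_le (u i) (p i) (u' i)
    rw [abs_sub_comm (p i)] at this
    linarith [hu i hi, hu' i hi]
  have p1 : g.φ a u' ≤ g.φ a u + 32 * D * g.S a g.κ := by
    unfold φ
    have : max (g.nv a u' - 1/2) 0 ≤ max (g.nv a u - 1/2) 0 + 4 * D :=
      max_le (by linarith [le_max_left (g.nv a u - 1/2) 0]) (by linarith [le_max_right (g.nv a u - 1/2) 0])
    nlinarith
  have p2 : 32 * D * g.S a g.κ ≤ 128 * D * g.Ws p g.κ := by nlinarith [cm.2 g.κ]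
  by_cases h1 : g.nv a u' ≤ 1
  · have := le_c G (b := b) h1
    linarith
  · push Not at h1
    obtain ⟨a0, h0⟩ := core G u'
    have c1 := c_ge G (b := b) h0
    have s1 := cmp1 G (a := a0) (b := a) (q := u') (by linarith) (by linarith) g.κ
    have p3 : 4 * g.S a g.κ ≤ g.φ a u' := by
      unfold φ
      have : 1/2 ≤ max (g.nv a u' - 1/2) 0 := le_max_of_le_left (by linarith)
      nlinarith
    have := ω_mono G (Hr_le G a b)
    linarith

theorem c_lip {p u u' : ι → ℝ} {b D : ℝ} (hD : 0 ≤ D)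
    (hu : ∀ i, i ≠ g.κ → |u i - p i| ≤ 1/100 * g.Ws p i) (hu' : ∀ i, i ≠ g.κ → |u' i - p i| ≤ 1/100 * g.Ws p i)
    (h : ∀ i, i ≠ g.κ → |u i - u' i| ≤ D * g.Ws p i) : |g.c b u - g.c b u'| ≤ 128 * D * g.Ws p g.κ := by
  have h1 := c_lip_half G (b := b) hD hu hu' h
  have h2 := c_lip_half G (b := b) hD hu' hu (fun i hi => by rw [abs_sub_comm]; exact h i hi)
  rw [abs_le]; constructor <;> linarith

/-- in the K case `c b u` is close to `b` -/
theorem c_near {p u : ι → ℝ} {b : ℝ} (hu : ∀ i, i ≠ g.κ → |u i - p i| ≤ 1/100 * g.Ws p i) (hω : g.ω = fun x => x) :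
    |b - g.c b u| ≤ 4 * g.Ws p g.κ := by
  obtain ⟨a, ha⟩ := core G u
  have h1 := c_le G b u
  have h2 := c_ge G (b := b) ha
  have cm := cmp0 G (q := p) (a := a) (fun hk => (nearτ G hu ha hk).trans (by norm_num))
  rw [hω] at h1 h2
  have := cm.2 g.κ
  simp only at h1 h2
  rw [abs_le]; constructor <;> linarith [Wp G p g.κ]

theorem Wt_eq (p : ι → ℝ) : (∀ i, i ≠ g.κ → g.Wt (g.f p p) i = g.Ws p i) ∧ g.Wt (g.f p p) g.κ = 1 / g.N := by
  rcases G.hc with ⟨hk, hA, _⟩ | ⟨hk, _⟩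
  · constructor
    · intro i _; simp [Wt, Ws, wt, wsc, hA]
    · simp [Wt, Ws, wt, wsc, hA]
  · constructor
    · intro i hi
      have : g.f p p g.τ = p g.τ := by unfold f; rw [Function.update_of_ne hk.symm]
      simp only [Wt, Ws, wt, wsc, Finset.mem_erase, hi, this]
      simp [hi]
    · simp [Wt, wt, wsc]

theorem ell_lip {p u u' : ι → ℝ} (hk : g.κ ≠ g.τ) (hA : g.κ ∈ g.A) {D : ℝ} (hD : 0 ≤ D)
    (hu : ∀ i, i ≠ g.κ → |u i - p i| ≤ 1/100 * g.Ws p i) (hu' : ∀ i, i ≠ g.κ → |u' i - p i| ≤ 1/100 * g.Ws p i)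
    (h : ∀ i, i ≠ g.κ → |u i - u' i| ≤ D * g.Ws p i) :
    |g.ell u - g.ell u'| ≤ 4 * D * g.ell p ∧ |(g.ell u)⁻¹ - (g.ell u')⁻¹| ≤ 4 * D * (g.ell p)⁻¹ := by
  have N40 := N40 G
  have N1 : (1:ℝ) / g.N ≤ 1 := by rw [div_le_one (by linarith)]; linarith
  have N2 : (0:ℝ) < 1 / g.N := by have := N0 G; positivity
  have h1 := hu _ hk.symm
  have h2 := hu' _ hk.symm
  have h3 := h _ hk.symm
  rw [Wτ G] at h1 h2 h3
  have h4 : |u g.τ - u' g.τ| ≤ 1 := by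
    have := abs_sub_le (u g.τ) (p g.τ) (u' g.τ)
    rw [abs_sub_comm (p g.τ)] at this
    linarith
  have h5 : |u g.τ - u' g.τ| ≤ D := h3.trans (by nlinarith)
  have a1 := lam_cmp1 (t := u' g.τ) (t' := p g.τ) (by linarith)
  have a2 := lam_cmp1 (t := p g.τ) (t' := u' g.τ) (by rw [abs_sub_comm]; linarith)
  have q1 := lam_pos (u' g.τ)
  have q2 := lam_pos (p g.τ)
  have a3 : (lam (u' g.τ))⁻¹ ≤ 2 * (lam (p g.τ))⁻¹ := by
    rw [← div_eq_mul_inv, inv_eq_one_div, div_le_div_iff₀ q1 q2]; linarith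
  simp only [ell, hA, if_true]
  constructor
  · refine (lam_lip h4).trans ?_
    calc 2 * lam (u' g.τ) * |u g.τ - u' g.τ| ≤ 2 * (2 * lam (p g.τ)) * D := by gcongr
      _ = _ := by ring
  · refine (lam_inv_lip h4).trans ?_
    calc 2 * (lam (u' g.τ))⁻¹ * |u g.τ - u' g.τ| ≤ 2 * (2 * (lam (p g.τ))⁻¹) * D := by gcongr
      _ = _ := by ring

theorem ell_cmp {p u : ι → ℝ} (hu : ∀ i, i ≠ g.κ → |u i - p i| ≤ 1/100 * g.Ws p i) :
    g.ell u ≤ 2 * g.ell p ∧ (g.ell u)⁻¹ ≤ 2 * (g.ell p)⁻¹ := by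
  rcases G.hc with ⟨hk, hA, _⟩ | ⟨hk, hA, _⟩
  · simp [ell, hA]
  · have N40 := N40 G
    have N1 : (1:ℝ) / g.N ≤ 1 := by rw [div_le_one (by linarith)]; linarith
    have h1 := hu _ hk.symm
    rw [Wτ G] at h1
    have a1 := lam_cmp1 (t := u g.τ) (t' := p g.τ) (by linarith)
    have a2 := lam_cmp1 (t := p g.τ) (t' := u g.τ) (by rw [abs_sub_comm]; linarith)
    have q1 := lam_pos (u g.τ)
    have q2 := lam_pos (p g.τ)
    simp only [ell, hA, if_true]
    refine ⟨a1, ?_⟩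
    rw [← div_eq_mul_inv, inv_eq_one_div, div_le_div_iff₀ q1 q2]; linarith

end Gr
end grid
end CDE


namespace CDE
section grid
variable {ι : Type*} [Fintype ι] [DecidableEq ι]
namespace Gr
variable {g : Gr ι}
variable (G : g.ok)
include G

theorem szp (a : ι → ℤ) (i : ι) : 0 < g.sz a i := by
  have := Sp G a i
  have := θ0 (ι := ι)
  unfold sz; split_ifs <;> positivity

theorem box {a : ι → ℤ} {p : ι → ℝ} {r : ℝ} (hr : 0 ≤ r) : nw (g.sz a) (p - g.zc a) ≤ r ↔
    (∀ i, i ≠ g.κ → |p i - g.S a i * a i| ≤ r * (11/10 * g.S a i)) ∧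
      |p g.κ - g.S a g.κ * (a g.κ + g.o a)| ≤ r * (θ ι * g.S a g.κ) := by
  rw [nw_le (szp G a) hr]
  constructor
  · intro h
    refine ⟨fun i hi => ?_, ?_⟩
    · have := h i; simpa [sz, zc, hi] using this
    · have := h g.κ; simpa [sz, zc] using this
  · rintro ⟨h1, h2⟩ i
    by_cases hi : i = g.κ
    · subst hi; simpa [sz, zc] using h2
    · have := h1 i hi; simpa [sz, zc, hi] using this

theorem boxτ {a : ι → ℤ} {p : ι → ℝ} {r : ℝ} (hr : 0 ≤ r) (h : nw (g.sz a) (p - g.zc a) ≤ r) (hk : g.κ ≠ g.τ) :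
    |g.N * p g.τ - a g.τ| ≤ r * (11/10) := by
  have h1 := ((box G hr).1 h).1 g.τ hk.symm
  have N0 := N0 G
  rw [Sτ G] at h1
  have e : g.N * p g.τ - a g.τ = g.N * (p g.τ - 1 / g.N * a g.τ) := by field_simp
  rw [e, abs_mul, abs_of_pos N0]
  calc _ ≤ g.N * (r * (11/10 * (1 / g.N))) := by gcongr
    _ = _ := by field_simp

theorem o_rng (a : ι → ℤ) : 1/7 ≤ g.o a ∧ g.o a ≤ 1/7 + 1/100 := by
  have hQ := Q1 (ι := ι)
  have h2 : ((Fintype.equivFin (ι → ZMod 32) (g.res a) : ℕ) : ℝ) ≤ Q ι := by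
    unfold Q; exact_mod_cast (Fin.is_lt _).le
  unfold o
  constructor
  · have : (0:ℝ) ≤ ((Fintype.equivFin (ι → ZMod 32) (g.res a) : ℕ) : ℝ) / (100 * Q ι) := by positivity
    linarith
  · have : ((Fintype.equivFin (ι → ZMod 32) (g.res a) : ℕ) : ℝ) / (100 * Q ι) ≤ 1/100 := by
      rw [div_le_div_iff₀ (by positivity) (by norm_num)]; linarith
    linarith

theorem o_sep {a b : ι → ℤ} (h : g.res a ≠ g.res b) : 1 / (100 * Q ι) ≤ |g.o a - g.o b| := by
  have hQ := Q1 (ι := ι)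
  set x := Fintype.equivFin (ι → ZMod 32) (g.res a) with hx
  set y := Fintype.equivFin (ι → ZMod 32) (g.res b) with hy
  have hn : ((x : ℕ) : ℤ) - (y : ℕ) ≠ 0 := by
    intro e
    apply h
    apply (Fintype.equivFin (ι → ZMod 32)).injective
    apply Fin.ext
    change (x : ℕ) = y
    omega
  have h1 : (1:ℤ) ≤ |((x : ℕ) : ℤ) - (y : ℕ)| := Int.one_le_abs hn
  have h2 : (1:ℝ) ≤ |((x : ℕ) : ℝ) - (y : ℕ)| := by exact_mod_cast h1
  have e : g.o a - g.o b = (((x : ℕ) : ℝ) - (y : ℕ)) / (100 * Q ι) := by unfold o; rw [← hx, ← hy]; ring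
  rw [e, abs_div, abs_of_pos (show 0 < 100 * Q ι by positivity)]
  gcongr

theorem disj_same {a b : ι → ℤ} {p : ι → ℝ} (hS : g.S a = g.S b) (ha : nw (g.sz a) (p - g.zc a) ≤ 10)
    (hb : nw (g.sz b) (p - g.zc b) ≤ 10) : a = b := by
  obtain ⟨a1, a2⟩ := (box G (by norm_num)).1 ha
  obtain ⟨b1, b2⟩ := (box G (by norm_num)).1 hb
  rw [hS] at a1 a2
  have hQ := Q1 (ι := ι)
  have oa := o_rng G a
  have ob := o_rng G b
  have hz : |((a g.κ : ℝ) - b g.κ) + (g.o a - g.o b)| ≤ 20 * θ ι := by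
    have s := Sp G b g.κ
    have e : g.S b g.κ * (((a g.κ : ℝ) - b g.κ) + (g.o a - g.o b)) =
      (p g.κ - g.S b g.κ * (b g.κ + g.o b)) - (p g.κ - g.S b g.κ * (a g.κ + g.o a)) := by ring
    have : g.S b g.κ * |((a g.κ : ℝ) - b g.κ) + (g.o a - g.o b)| ≤ g.S b g.κ * (20 * θ ι) := by
      rw [← abs_of_pos s, ← abs_mul, abs_of_pos s, e]
      refine (abs_sub _ _).trans ?_
      linarith
    exact le_of_mul_le_mul_left this s
  have t1 := θ1 (ι := ι)
  have hk : a g.κ = b g.κ := by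
    have : |(a g.κ : ℝ) - b g.κ| < 1 := by
      rw [abs_le] at hz; rw [abs_lt]; constructor <;> linarith [hz.1, hz.2]
    have : |a g.κ - b g.κ| < 1 := by exact_mod_cast this
    rw [Int.abs_lt_one_iff] at this; omega
  have hr : g.res a = g.res b := by
    by_contra hne
    have h1 := o_sep G hne
    rw [hk, sub_self, zero_add] at hz
    have h2 : 20 * θ ι < 1 / (100 * Q ι) := by
      unfold θ; rw [← mul_div_assoc, div_lt_div_iff₀ (by positivity) (by positivity)]; linarith
    linarith
  funext i
  by_cases hi : i = g.κ
  · rw [hi, hk]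
  · have h1 := congrFun hr i
    simp only [res, hi, if_false] at h1
    rw [ZMod.intCast_eq_intCast_iff_dvd_sub] at h1
    have s := Sp G b i
    have h2 : g.S b i * |(a i : ℝ) - b i| ≤ g.S b i * 22 := by
      have e : g.S b i * ((a i : ℝ) - b i) = (p i - g.S b i * b i) - (p i - g.S b i * a i) := by ring
      rw [← abs_of_pos s, ← abs_mul, abs_of_pos s, e]
      refine (abs_sub _ _).trans ?_
      linarith [a1 i hi, b1 i hi]
    have h3 : |(a i : ℝ) - b i| ≤ 22 := le_of_mul_le_mul_left h2 s
    have h4 : |a i - b i| ≤ 22 := by exact_mod_cast h3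
    rw [abs_le] at h4
    norm_num at h1
    omega

theorem disj_diff {a b : ι → ℤ} {p : ι → ℝ} (hS : g.S b g.κ = 2 * g.S a g.κ) (ha : nw (g.sz a) (p - g.zc a) ≤ 10)
    (hb : nw (g.sz b) (p - g.zc b) ≤ 10) : False := by
  obtain ⟨a1, a2⟩ := (box G (by norm_num)).1 ha
  obtain ⟨b1, b2⟩ := (box G (by norm_num)).1 hb
  rw [hS] at b2
  have oa := o_rng G a
  have ob := o_rng G b
  have t1 := θ1 (ι := ι)
  have s := Sp G a g.κ
  have hz : |((a g.κ : ℝ) - 2 * b g.κ) + (g.o a - 2 * g.o b)| ≤ 30 * θ ι := by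
    have e : g.S a g.κ * (((a g.κ : ℝ) - 2 * b g.κ) + (g.o a - 2 * g.o b)) =
      (p g.κ - 2 * g.S a g.κ * (b g.κ + g.o b)) - (p g.κ - g.S a g.κ * (a g.κ + g.o a)) := by ring
    have : g.S a g.κ * |((a g.κ : ℝ) - 2 * b g.κ) + (g.o a - 2 * g.o b)| ≤ g.S a g.κ * (30 * θ ι) := by
      rw [← abs_of_pos s, ← abs_mul, abs_of_pos s, e]
      refine (abs_sub _ _).trans ?_
      linarith
    exact le_of_mul_le_mul_left this s
  rw [abs_le] at hz
  have h1 : (0:ℝ) < (a g.κ : ℝ) - 2 * b g.κ := by linarith [hz.1]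
  have h2 : (a g.κ : ℝ) - 2 * b g.κ < 1 := by linarith [hz.2]
  have h1 : (0:ℤ) < a g.κ - 2 * b g.κ := by exact_mod_cast h1
  have h2 : a g.κ - 2 * b g.κ < (1:ℤ) := by exact_mod_cast h2
  omega

theorem disj_aux {a b : ι → ℤ} {p : ι → ℝ} (hf : g.fl a = g.fl b + 1) (hA : g.κ ∈ g.A)
    (ha : nw (g.sz a) (p - g.zc a) ≤ 10)
    (hb : nw (g.sz b) (p - g.zc b) ≤ 10) : a = b := by
  rcases lam_int (g.fl b) with h | h
  · refine disj_same G ?_ ha hb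
    unfold S; rw [hf, h]
  · refine (disj_diff G ?_ ha hb).elim
    unfold S; rw [hf, h]; simp [wsc, hA]; ring

theorem disj {a b : ι → ℤ} {p : ι → ℝ} (ha : nw (g.sz a) (p - g.zc a) ≤ 10)
    (hb : nw (g.sz b) (p - g.zc b) ≤ 10) : a = b := by
  rcases G.hc with ⟨_, hA, _⟩ | ⟨hk, hA, _⟩
  · refine disj_same G ?_ ha hb
    funext i; simp [S, wsc, hA]
  · have h1 := abs_le.1 (boxτ G (by norm_num) ha hk)
    have h2 := abs_le.1 (boxτ G (by norm_num) hb hk)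
    have hN := N40 G
    have e1 : g.fl a ≤ g.fl b + 1 := fl_close G (by rw [abs_lt]; constructor <;> linarith [h1.1, h1.2, h2.1, h2.2])
    have e2 : g.fl b ≤ g.fl a + 1 := fl_close G (by rw [abs_lt]; constructor <;> linarith [h1.1, h1.2, h2.1, h2.2])
    rcases (by omega : g.fl a = g.fl b + 1 ∨ g.fl b = g.fl a + 1 ∨ g.fl a = g.fl b) with h | h | h
    · exact disj_aux G h hA ha hb
    · exact (disj_aux G h hA hb ha).symm
    · refine disj_same G ?_ ha hb
      unfold S; rw [h]

theorem sz_cmp {a : ι → ℤ} {p : ι → ℝ} (h : nw (g.sz a) (p - g.zc a) ≤ 10) (i : ι) :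
    g.Ws p i ≤ 1000 / θ ι * g.sz a i ∧ g.sz a i ≤ 1000 / θ ι * g.Ws p i := by
  have cm := cmp0 G (q := p) (a := a) (fun hk => (boxτ G (by norm_num) h hk).trans (by norm_num))
  have s := Sp G a i
  have w := Wp G p i
  have c1 := cm.1 i
  have c2 := cm.2 i
  have t0 := θ0 (ι := ι)
  have t1 := θ1 (ι := ι)
  have T : 1000 ≤ 1000 / θ ι := by rw [le_div_iff₀ t0]; nlinarith
  have e : 1000 / θ ι * (θ ι * g.S a i) = 1000 * g.S a i := by field_simp
  unfold sz
  split_ifs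
  · rw [e]; constructor
    · linarith
    · nlinarith
  · constructor <;> nlinarith

theorem far {a : ι → ℤ} {p q : ι → ℝ} (h1 : nw (g.Ws p) (q - p) ≤ θ ι / 100) (h2 : nw (g.sz a) (q - g.zc a) ≤ 4) :
    nw (g.sz a) (p - g.zc a) ≤ 9 := by
  have t0 := θ0 (ι := ι)
  have t1 := θ1 (ι := ι)
  have N0 := N0 G
  have d := (nw_le (Wp G p) (by positivity)).1 h1
  have cm := cmp0 G (q := p) (a := a) (fun hk => by
    have x1 := boxτ G (by norm_num) h2 hk
    have x2 := d g.τ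
    rw [Wτ G, Pi.sub_apply] at x2
    have e : g.N * p g.τ - a g.τ = (g.N * q g.τ - a g.τ) - g.N * (q g.τ - p g.τ) := by ring
    rw [e]
    refine (abs_sub _ _).trans ?_
    rw [abs_mul, abs_of_pos N0]
    have : g.N * |q g.τ - p g.τ| ≤ g.N * (θ ι / 100 * (1 / g.N)) := by gcongr
    have e2 : (g.N:ℝ) * (θ ι / 100 * (1 / g.N)) = θ ι / 100 := by field_simp
    linarith)
  rw [nw_le (szp G a) (by norm_num)] at h2 ⊢
  intro i
  have e : (p - g.zc a) i = (q - g.zc a) i - (q - p) i := by simp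
  rw [e]
  refine (abs_sub _ _).trans ?_
  have s := Sp G a i
  have hs : θ ι * g.S a i ≤ g.sz a i := by unfold sz; split_ifs <;> nlinarith
  have x := d i
  have : θ ι / 100 * g.Ws p i ≤ θ ι / 100 * (4 * g.S a i) := by gcongr; exact cm.1 i
  linarith [h2 i, mul_pos t0 s]

theorem Hr_eq {a : ι → ℤ} {p q : ι → ℝ} (hp : ∀ j : ι → ℤ, -2 ≤ j g.τ → 1 < nw (g.sz j) (p - g.zc j))
    (hq : nw (g.Ws p) (q - p) ≤ θ ι / 100) (cm : ∀ i, g.Ws p i ≤ 4 * g.S a i) (hn : g.nv a p ≤ 1 + 1/100)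
    (ha : g.κ ≠ g.τ → -2 ≤ a g.τ) (hpos : g.κ = g.τ → 0 < p g.κ ∨ 0 < q g.κ) : g.Hr a (q g.κ) = g.Hr a (p g.κ) := by
  have t0 := θ0 (ι := ι)
  have t1 := θ1 (ι := ι)
  have s := Sp G a g.κ
  have oa := o_rng G a
  have d := (nw_le (Wp G p) (by positivity)).1 hq g.κ
  rw [Pi.sub_apply] at d
  set P := p g.κ / g.S a g.κ - g.o a with hP
  set Q := q g.κ / g.S a g.κ - g.o a with hQ
  have dPQ : |Q - P| ≤ θ ι / 25 := by
    have e : Q - P = (q g.κ - p g.κ) / g.S a g.κ := by rw [hP, hQ]; ring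
    rw [e, abs_div, abs_of_pos s, div_le_iff₀ s]
    have := mul_le_mul_of_nonneg_left (cm g.κ) (show 0 ≤ θ ι / 100 by positivity)
    linarith
  suffices hfl : ⌊Q⌋ = ⌊P⌋ by unfold Hr; rw [hfl]
  by_contra hne
  obtain ⟨m, hm⟩ : ∃ m : ℤ, |P - m| ≤ θ ι / 25 := by
    rw [abs_le] at dPQ
    rcases lt_or_gt_of_ne hne with h | h
    · refine ⟨⌊P⌋, ?_⟩
      have x1 := Int.floor_le P
      have x2 : Q < ⌊P⌋ := Int.floor_lt.1 h
      rw [abs_le]; constructor <;> linarith [dPQ.1]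
    · refine ⟨⌊Q⌋, ?_⟩
      have x1 := Int.floor_le Q
      have x2 : P < ⌊Q⌋ := Int.floor_lt.1 h
      rw [abs_le]; constructor <;> linarith [dPQ.2]
  set a' := Function.update a g.κ m with ha'
  have hS : g.S a' = g.S a := by
    rcases G.hc with ⟨_, hA, _⟩ | ⟨hk, hA, _⟩
    · funext i; simp [S, wsc, hA]
    · unfold S fl; rw [ha', Function.update_of_ne hk.symm]
  have ho : g.o a' = g.o a := by
    have : g.res a' = g.res a := by
      funext i; unfold res; split_ifs with hi
      · rfl
      · rw [ha', Function.update_of_ne hi]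
    unfold o; rw [this]
  have hJ : -2 ≤ a' g.τ := by
    by_cases hk : g.κ = g.τ
    · rw [ha', ← hk, Function.update_self]
      rw [abs_le] at hm dPQ
      have : -1 < P := by
        rcases hpos hk with h | h
        · have : 0 < p g.κ / g.S a g.κ := by positivity
          linarith
        · have : 0 < q g.κ / g.S a g.κ := by positivity
          linarith [dPQ.2]
      have : (-2:ℝ) ≤ m := by linarith [hm.2]
      exact_mod_cast this
    · rw [ha', Function.update_of_ne (Ne.symm hk)]; exact ha hk
  refine absurd (hp a' hJ) (not_lt.2 ?_)
  rw [box G (by norm_num), hS, ho]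
  constructor
  · intro i hi
    rw [ha', Function.update_of_ne hi]
    refine (nv_i' G a p hi).trans ?_
    nlinarith [Sp G a i]
  · rw [ha', Function.update_self]
    have e : p g.κ - g.S a g.κ * (m + g.o a) = g.S a g.κ * (P - m) := by rw [hP]; field_simp; ring
    rw [e, abs_mul, abs_of_pos s]
    nlinarith

theorem free {p q r : ι → ℝ} (hp : ∀ j : ι → ℤ, -2 ≤ j g.τ → 1 < nw (g.sz j) (p - g.zc j))
    (hq : nw (g.Ws p) (q - p) ≤ θ ι / 100) (hr : nw (g.Ws p) (r - p) ≤ θ ι / 100) : g.f q r = g.f p r := by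
  have t0 := θ0 (ι := ι)
  have t1 := θ1 (ι := ι)
  have d := (nw_le (Wp G p) (by positivity)).1 hr
  have d' : ∀ i, i ≠ g.κ → |r i - p i| ≤ 1/100 * g.Ws p i := fun i _ => (d i).trans (by
    have := Wp G p i; nlinarith)
  have main : (∀ a, g.nv a r ≤ 1 → g.ω (g.Hr a (q g.κ)) = g.ω (g.Hr a (p g.κ))) → g.f q r = g.f p r := by
    intro h
    have : g.cset (q g.κ) r = g.cset (p g.κ) r := by
      ext x; unfold cset
      constructor
      · rintro ⟨a, h1, rfl⟩; exact ⟨a, h1, by rw [h a h1]⟩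
      · rintro ⟨a, h1, rfl⟩; exact ⟨a, h1, by rw [h a h1]⟩
    unfold f c; rw [this]
  have pre : ∀ a, g.nv a r ≤ 1 → (∀ i, g.Ws p i ≤ 4 * g.S a i) ∧ g.nv a p ≤ 1 + 1/100 := by
    intro a ha
    have cm := cmp0 G (q := p) (a := a) (fun hk => (nearτ G d' ha hk).trans (by norm_num))
    refine ⟨cm.1, ?_⟩
    have := nv_lip G (D := θ ι / 100) (by positivity) cm.1 (fun i _ => d i) (u := r) (u' := p)
    linarith
  by_cases hk : g.κ = g.τ
  · apply main
    intro a ha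
    obtain ⟨h1, h2⟩ := pre a ha
    by_cases hpos : 0 < p g.κ ∨ 0 < q g.κ
    · rw [Hr_eq G hp hq h1 h2 (fun h => (h hk).elim) (fun _ => hpos)]
    · push Not at hpos
      rcases G.hc with ⟨_, _, hω, _⟩ | ⟨hk', _⟩
      · rw [hω]; simp only
        rw [max_eq_right ((Hr_le G a _).trans hpos.1), max_eq_right ((Hr_le G a _).trans hpos.2)]
      · exact (hk' hk).elim
  · by_cases hτ : r g.τ ≤ 0
    · rcases G.hc with ⟨hk', _⟩ | ⟨_, hA, _, hρ⟩
      · exact (hk hk').elim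
      · have : g.ell r = 1 := by unfold ell; rw [if_pos hA, lam_neg hτ]
        unfold f; rw [this, hρ]; congr 1; ring
    · apply main
      intro a ha
      obtain ⟨h1, h2⟩ := pre a ha
      rw [Hr_eq G hp hq h1 h2 (fun h => ?_) (fun h => (hk h).elim)]
      have x := abs_le.1 ((nvτ G hk).trans ha)
      push Not at hτ
      have := mul_pos (N0 G) hτ
      have : (-2:ℝ) ≤ a g.τ := by linarith [x.2]
      exact_mod_cast this

theorem flip {p r r' : ι → ℝ} (hr : nw (g.Ws p) (r - p) ≤ θ ι / 100) (hr' : nw (g.Ws p) (r' - p) ≤ θ ι / 100) :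
    nw (g.Wt (g.f p p)) (g.f p r - g.f p r') ≤ 1000 * nw (g.Ws p) (r - r') := by
  have t0 := θ0 (ι := ι)
  have t1 := θ1 (ι := ι)
  set D := nw (g.Ws p) (r - r') with hD
  have D0 : 0 ≤ D := nw_nn _ _
  have dD : ∀ i, |r i - r' i| ≤ D * g.Ws p i := nw_i (Wp G p) (r - r')
  have d1 : ∀ i, |r i - p i| ≤ 1/100 * g.Ws p i := fun i => ((nw_le (Wp G p) (by positivity)).1 hr i).trans (by
    have := Wp G p i; nlinarith)
  have d2 : ∀ i, |r' i - p i| ≤ 1/100 * g.Ws p i := fun i => ((nw_le (Wp G p) (by positivity)).1 hr' i).trans (by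
    have := Wp G p i; nlinarith)
  obtain ⟨W1, W2⟩ := Wt_eq G p
  have Wtp : ∀ i, 0 < g.Wt (g.f p p) i := wt_pos G.hN _ _ _
  rw [nw_le Wtp (by positivity)]
  intro i
  change _ ≤ 1000 * D * g.Wt (g.f p p) i
  by_cases hi : i = g.κ
  · subst hi
    rw [W2]
    have N0 := N0 G
    have n0 : (0:ℝ) < 1 / g.N := by positivity
    have l0 := ell_pos G p
    have l1 := ell_le G p
    have cl := c_lip G (b := p g.κ) D0 (fun i _ => d1 i) (fun i _ => d2 i) (fun i _ => dD i)
    have dk := dD g.κ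
    rw [Wκ G] at cl dk
    have m1 := (ell_cmp G (fun i _ => d1 i)).2
    have mp := inv_pos.2 (ell_pos G r)
    simp only [f, Pi.sub_apply, Function.update_self]
    set x := g.c (p g.κ) r
    set x' := g.c (p g.κ) r'
    set m := (g.ell r)⁻¹
    set m' := (g.ell r')⁻¹
    have b1 : |g.ρ * (x - x')| ≤ 128 * D * (1 / g.N) := by
      have : |g.ρ| ≤ 1 := by rcases G.hc with ⟨_, _, _, h⟩ | ⟨_, _, _, h⟩ <;> rw [h] <;> norm_num
      rw [abs_mul]
      calc |g.ρ| * |x - x'| ≤ 1 * (128 * D * (1 / g.N * g.ell p)) := by gcongr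
        _ ≤ 1 * (128 * D * (1 / g.N * 1)) := by gcongr
        _ = _ := by ring
    have b2 : |(r g.κ - r' g.κ - (x - x')) * m| ≤ 258 * D * (1 / g.N) := by
      rw [abs_mul, abs_of_pos mp]
      calc _ ≤ (D * (1 / g.N * g.ell p) + 128 * D * (1 / g.N * g.ell p)) * (2 * (g.ell p)⁻¹) := by
            gcongr
            exact (abs_sub _ _).trans (by linarith)
        _ = _ := by field_simp; ring
    have b3 : |(r' g.κ - x') * (m - m')| ≤ 21 * D * (1 / g.N) := by
      rcases G.hc with ⟨hk, hA, _⟩ | ⟨hk, hA, hω, _⟩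
      · have : m - m' = 0 := by simp [m, m', ell, hA]
        rw [this, mul_zero, abs_zero]; positivity
      · have e1 := (ell_lip G hk hA D0 (fun i _ => d1 i) (fun i _ => d2 i) (fun i _ => dD i)).2
        have e2 := c_near G (b := p g.κ) (fun i _ => d2 i) hω
        have e3 := d2 g.κ
        rw [Wκ G] at e2 e3
        rw [abs_mul]
        calc _ ≤ (5 * (1 / g.N * g.ell p)) * (4 * D * (g.ell p)⁻¹) := by
              gcongr
              have := abs_sub_le (r' g.κ) (p g.κ) x'
              have : 0 < 1 / g.N * g.ell p := by positivity
              linarith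
          _ = 20 * D * (1 / g.N) := by field_simp; ring
          _ ≤ _ := by gcongr; norm_num
    have e : g.ρ * x + (r g.κ - x) * m - (g.ρ * x' + (r' g.κ - x') * m') =
      g.ρ * (x - x') + (r g.κ - r' g.κ - (x - x')) * m + (r' g.κ - x') * (m - m') := by ring
    rw [e]
    have := abs_add_three (g.ρ * (x - x')) ((r g.κ - r' g.κ - (x - x')) * m) ((r' g.κ - x') * (m - m'))
    have : 0 ≤ D * (1 / g.N) := by positivity
    linarith
  · rw [W1 i hi]
    simp only [f, Pi.sub_apply, Function.update_of_ne hi]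
    have := mul_nonneg D0 (Wp G p i).le
    linarith [dD i]

theorem glip {p y y' : ι → ℝ} (hr : nw (g.Wt (g.f p p)) (y - g.f p p) ≤ θ ι / 100)
    (hr' : nw (g.Wt (g.f p p)) (y' - g.f p p) ≤ θ ι / 100) :
    nw (g.Ws p) (g.gg p y - g.gg p y') ≤ 1000 * nw (g.Wt (g.f p p)) (y - y') := by
  have t0 := θ0 (ι := ι)
  have t1 := θ1 (ι := ι)
  have Wtp : ∀ i, 0 < g.Wt (g.f p p) i := wt_pos G.hN _ _ _
  set D := nw (g.Wt (g.f p p)) (y - y') with hD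
  have D0 : 0 ≤ D := nw_nn _ _
  obtain ⟨W1, W2⟩ := Wt_eq G p
  have dD := nw_i Wtp (y - y')
  have dO : ∀ i, i ≠ g.κ → |y i - y' i| ≤ D * g.Ws p i := fun i hi => by rw [← W1 i hi]; exact dD i
  have e1 := (nw_le Wtp (by positivity)).1 hr
  have e2 := (nw_le Wtp (by positivity)).1 hr'
  have fo : ∀ i, i ≠ g.κ → g.f p p i = p i := fun i hi => by unfold f; rw [Function.update_of_ne hi]
  have d1 : ∀ i, i ≠ g.κ → |y i - p i| ≤ 1/100 * g.Ws p i := fun i hi => by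
    have := e1 i; rw [W1 i hi, Pi.sub_apply, fo i hi] at this
    have := Wp G p i; nlinarith
  have d2 : ∀ i, i ≠ g.κ → |y' i - p i| ≤ 1/100 * g.Ws p i := fun i hi => by
    have := e2 i; rw [W1 i hi, Pi.sub_apply, fo i hi] at this
    have := Wp G p i; nlinarith
  rw [nw_le (Wp G p) (by positivity)]
  intro i
  by_cases hi : i = g.κ
  · subst hi
    have N0 := N0 G
    have n0 : (0:ℝ) < 1 / g.N := by positivity
    have l0 := ell_pos G p
    have l1 := ell_le G p
    have cl := c_lip G (b := p g.κ) D0 d1 d2 dO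
    have dk := dD g.κ
    rw [W2, Pi.sub_apply] at dk
    rw [Wκ G] at cl ⊢
    have m1 := (ell_cmp G d1).1
    have mp := ell_pos G y
    simp only [gg, Pi.sub_apply, Function.update_self]
    have ek := e2 g.κ
    rw [W2] at ek
    simp only [f, Pi.sub_apply, Function.update_self] at ek
    set x := g.c (p g.κ) y
    set x' := g.c (p g.κ) y' with hx'
    set m := g.ell y
    set m' := g.ell y'
    have hρ : |g.ρ| ≤ 1 := by rcases G.hc with ⟨_, _, _, h⟩ | ⟨_, _, _, h⟩ <;> rw [h] <;> norm_num
    have b0 : |g.ρ * (x - x')| ≤ 128 * D * (1 / g.N) := by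
      rw [abs_mul]
      calc |g.ρ| * |x - x'| ≤ 1 * (128 * D * (1 / g.N * g.ell p)) := by gcongr
        _ ≤ 1 * (128 * D * (1 / g.N * 1)) := by gcongr
        _ = _ := by ring
    have b2 : |(y g.κ - y' g.κ - g.ρ * (x - x')) * m| ≤ 258 * D * (1 / g.N * g.ell p) := by
      rw [abs_mul, abs_of_pos mp]
      calc _ ≤ (D * (1 / g.N) + 128 * D * (1 / g.N)) * (2 * (g.ell p)) := by
            gcongr
            exact (abs_sub _ _).trans (by linarith)
        _ = _ := by ring
    have b3 : |(y' g.κ - g.ρ * x') * (m - m')| ≤ 28 * D * (1 / g.N * g.ell p) := by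
      rcases G.hc with ⟨hk, hA, _⟩ | ⟨hk, hA, hω, hρ'⟩
      · have : m - m' = 0 := by simp [m, m', ell, hA]
        rw [this, mul_zero, abs_zero]; positivity
      · have e1 := (ell_lip G hk hA D0 d1 d2 dO).1
        have z0 : ∀ i, i ≠ g.κ → |p i - p i| ≤ 1/100 * g.Ws p i := fun i _ => by
          have := Wp G p i; rw [sub_self, abs_zero]; positivity
        have e2 := c_near G (b := p g.κ) z0 hω
        have e3 := c_lip G (b := p g.κ) (D := 1/100) (by norm_num) z0 d2
          (fun i hi => by rw [abs_sub_comm]; exact d2 i hi)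
        rw [← hx'] at e3
        rw [Wκ G] at e2 e3
        set x0 := g.c (p g.κ) p
        rw [hρ'] at ek ⊢
        have e4 : |(p g.κ - x0) * (g.ell p)⁻¹| ≤ 4 * (1 / g.N) := by
          rw [abs_mul, abs_of_pos (inv_pos.2 l0)]
          calc _ ≤ 4 * (1 / g.N * g.ell p) * (g.ell p)⁻¹ := by gcongr
            _ = _ := by field_simp
        have e5 : |x0 - x'| ≤ 2 * (1 / g.N) := by
          have : 1 / g.N * g.ell p ≤ 1 / g.N * 1 := by gcongr
          linarith
        rw [abs_mul]
        calc _ ≤ (7 * (1 / g.N)) * (4 * D * (g.ell p)) := by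
              gcongr
              have q : y' g.κ - 1 * x' = (y' g.κ - (1 * x0 + (p g.κ - x0) * (g.ell p)⁻¹)) +
                (p g.κ - x0) * (g.ell p)⁻¹ + (x0 - x') := by ring
              rw [q]
              refine (abs_add_three _ _ _).trans ?_
              nlinarith
          _ = _ := by ring
    have e : x + (y g.κ - g.ρ * x) * m - (x' + (y' g.κ - g.ρ * x') * m') =
      (x - x') + (y g.κ - y' g.κ - g.ρ * (x - x')) * m + (y' g.κ - g.ρ * x') * (m - m') := by ring
    rw [e]
    have := abs_add_three (x - x') ((y g.κ - y' g.κ - g.ρ * (x - x')) * m) ((y' g.κ - g.ρ * x') * (m - m'))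
    have : 0 ≤ D * (1 / g.N * g.ell p) := by positivity
    linarith
  · simp only [gg, Pi.sub_apply, Function.update_of_ne hi]
    have := mul_nonneg D0 (Wp G p i).le
    linarith [dO i hi]

theorem step : Step (J := {a : ι → ℤ // -2 ≤ a g.τ}) g.Ws g.Wt g.f g.gg (fun j => g.zc j.1) (fun j => g.sz j.1)
    (1000 / θ ι) (θ ι / 100) where
  wsp := Wp G
  wtp := wt_pos G.hN _ _
  sp := fun j => szp G j.1
  C1 := by
    rw [le_div_iff₀ θ0]; linarith [θ1 (ι := ι)]
  η0 := by have := θ0 (ι := ι); positivity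
  fg := fg G
  gf := gf G
  free := fun p hp q r hq hr => free G (fun j hj => hp ⟨j, hj⟩) hq hr
  flip := fun p r r' h1 h2 => (flip G h1 h2).trans (by
    have : 1000 ≤ 1000 / θ ι := by rw [le_div_iff₀ θ0]; linarith [θ1 (ι := ι)]
    have := nw_nn (g.Ws p) (r - r')
    gcongr)
  glip := fun p r r' h1 h2 => (glip G h1 h2).trans (by
    have : 1000 ≤ 1000 / θ ι := by rw [le_div_iff₀ θ0]; linarith [θ1 (ι := ι)]
    have := nw_nn (g.Wt (g.f p p)) (r - r')
    gcongr)
  disj := fun i j p h1 h2 => Subtype.ext (disj G h1 h2)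
  cmp1 := fun j p h i => (sz_cmp G h i).1
  cmp2 := fun j p h i => (sz_cmp G h i).2
  far := fun p q j h1 h2 => far G h1 h2

end Gr
end grid
end CDE


namespace CDE
section grid
variable {ι : Type*} [Fintype ι] [DecidableEq ι]

noncomputable def pi0 (τ : ι) (p : ι → ℝ) : ι → ℝ := Function.update p τ (min (p τ) 0)

theorem pi0_lip (τ : ι) (p q : ι → ℝ) : ‖pi0 τ p - pi0 τ q‖ ≤ ‖p - q‖ := by
  rw [pi_norm_le_iff_of_nonneg (norm_nonneg _)]
  intro i
  have h := norm_le_pi_norm (p - q) i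
  simp only [Pi.sub_apply, Real.norm_eq_abs, pi0] at h ⊢
  by_cases hi : i = τ
  · subst hi
    simp only [Function.update_self]
    have := abs_min_sub_min_le_max (p i) 0 (q i) 0
    simp at this
    linarith
  · simpa only [Function.update_of_ne hi] using h

namespace Gr
noncomputable def pr (g : Gr ι) (p : ι → ℝ) : ι → ℝ := if g.κ = g.τ then pi0 g.τ p else p

variable {g : Gr ι}
variable (G : g.ok)
include G

theorem pr_lip (p q : ι → ℝ) : ‖g.pr p - g.pr q‖ ≤ ‖p - q‖ := by
  unfold pr; split_ifs
  · exact pi0_lip _ _ _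
  · exact le_rfl

theorem f_dist (q : ι → ℝ) : ‖g.f q q - g.pr q‖ ≤ 1 := by
  have n40 := N40 G
  have N0 := N0 G
  have n1 : (1:ℝ) / g.N ≤ 1/40 := one_div_le_one_div_of_le (by norm_num) n40
  have n0 : (0:ℝ) < 1 / g.N := by positivity
  rw [pi_norm_le_iff_of_nonneg (by norm_num)]
  intro i
  rw [Pi.sub_apply, Real.norm_eq_abs]
  by_cases hi : i = g.κ
  · subst hi
    rcases G.hc with ⟨hk, hA, hω, hρ⟩ | ⟨hk, hA, hω, hρ⟩
    · obtain ⟨a, ha⟩ := core G q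
      have h1 := c_le G (q g.κ) q
      have h2 := c_ge G (b := q g.κ) ha
      have hs : g.S a g.κ = 1 / g.N := by rw [hk]; exact Sτ G a
      have hl : g.ell q = 1 := by simp [ell, hA]
      have e2 : g.pr q g.κ = min (q g.κ) 0 := by unfold pr pi0; rw [if_pos hk, hk, Function.update_self]
      rw [e2]
      simp only [f, Function.update_self]
      rw [hl, hρ]
      rw [hω] at h1 h2
      rw [hs] at h2
      simp only at h1 h2
      have := max_add_min (q g.κ) 0
      rw [abs_le]; constructor <;> linarith
    · have z0 : ∀ i, i ≠ g.κ → |q i - q i| ≤ 1/100 * g.Ws q i := fun i _ => by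
        have := Wp G q i; rw [sub_self, abs_zero]; positivity
      have e2 := c_near G (b := q g.κ) z0 hω
      rw [Wκ G] at e2
      have l0 := ell_pos G q
      have l1 := ell_le G q
      have e4 : |(q g.κ - g.c (q g.κ) q) * (g.ell q)⁻¹| ≤ 4 * (1 / g.N) := by
        rw [abs_mul, abs_of_pos (inv_pos.2 l0)]
        calc _ ≤ 4 * (1 / g.N * g.ell q) * (g.ell q)⁻¹ := by gcongr
          _ = _ := by field_simp
      have e5 : |q g.κ - g.c (q g.κ) q| ≤ 4 * (1 / g.N) := by
        have : 1 / g.N * g.ell q ≤ 1 / g.N * 1 := by gcongr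
        linarith
      have e3 : g.pr q g.κ = q g.κ := by unfold pr; rw [if_neg hk]
      rw [e3]
      simp only [f, Function.update_self]
      rw [hρ]
      rw [abs_le] at *
      constructor <;> linarith [e4.1, e4.2, e5.1, e5.2]
  · have : g.f q q i - g.pr q i = 0 := by
      unfold f pr pi0; rw [Function.update_of_ne hi]
      split_ifs with h
      · rw [Function.update_of_ne (by rw [← h]; exact hi), sub_self]
      · rw [sub_self]
    rw [this, abs_zero]; norm_num

theorem box_dist {a : ι → ℤ} {p q : ι → ℝ} (hp : nw (g.sz a) (p - g.zc a) ≤ 9)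
    (hq : nw (g.sz a) (q - g.zc a) ≤ 10) : ‖q - p‖ ≤ 1 := by
  have n40 := N40 G
  have n1 : (1:ℝ) / g.N ≤ 1/40 := one_div_le_one_div_of_le (by norm_num) n40
  have t1 := θ1 (ι := ι)
  have h1 := (nw_le (szp G a) (by norm_num)).1 hp
  have h2 := (nw_le (szp G a) (by norm_num)).1 hq
  rw [pi_norm_le_iff_of_nonneg (by norm_num)]
  intro i
  have e : (q - p) i = (q - g.zc a) i - (p - g.zc a) i := by simp
  rw [e, Real.norm_eq_abs]
  refine (abs_sub _ _).trans ?_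
  have s1 : g.S a i ≤ 1 / g.N := wsc_le _ (lam_le_one _) i
  have s0 := Sp G a i
  have : g.sz a i ≤ 11/10 * g.S a i := by unfold sz; split_ifs <;> nlinarith
  linarith [h1 i, h2 i]

theorem fix_low {p : ι → ℝ} (hp : p g.τ ≤ -3) (h : (ι → ℝ) → (ι → ℝ)) (hh : h p g.τ ≤ 0) :
    lft g.f g.gg h p = h p := by
  unfold lft
  rcases G.hc with ⟨hk, hA, hω, hρ⟩ | ⟨hk, hA, hω, hρ⟩
  · have hc : ∀ u, g.c (p g.κ) u = 0 := by
      intro u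
      have e : ∀ a, g.ω (g.Hr a (p g.κ)) = 0 := fun a => by
        rw [hω]; exact max_eq_right ((Hr_le G a _).trans (by rw [hk]; linarith))
      obtain ⟨a, ha⟩ := core G u
      have h1 := c_le G (p g.κ) u
      have h2 := le_c G (b := p g.κ) (show g.nv a u ≤ 1 by linarith)
      have h3 : g.φ a u = 0 := by unfold φ; rw [max_eq_right (by linarith), mul_zero]
      rw [e, h3] at h2
      rw [hω] at h1
      simp only at h1
      rw [max_eq_right (by rw [hk]; linarith)] at h1
      linarith
    have hl : ∀ u, g.ell u = 1 := fun u => by simp [ell, hA]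
    have hf : g.f p p = p := by unfold f; rw [hc, hl, hρ]; simp
    rw [hf]; unfold gg; rw [hc, hl, hρ]; simp
  · have hl : ∀ u : ι → ℝ, u g.τ ≤ 0 → g.ell u = 1 := fun u hu => by unfold ell; rw [if_pos hA, lam_neg hu]
    have hf : g.f p p = p := by unfold f; rw [hl _ (by linarith), hρ]; simp
    rw [hf]; unfold gg; rw [hl _ hh, hρ]; simp

theorem low_box {p : ι → ℝ} (hp : p g.τ ≤ -3) {a : ι → ℤ} (ha : -2 ≤ a g.τ) : 4 < nw (g.sz a) (p - g.zc a) := by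
  by_contra! hb
  have ha' : (-2:ℝ) ≤ a g.τ := by exact_mod_cast ha
  have n40 := N40 G
  by_cases hk : g.κ = g.τ
  · have h := ((box G (by norm_num)).1 hb).2
    have oa := o_rng G a
    have t1 := θ1 (ι := ι)
    have s0 := Sp G a g.κ
    rw [hk] at h s0
    have hs := Sτ G a
    have n1 : (1:ℝ) / g.N ≤ 1/40 := one_div_le_one_div_of_le (by norm_num) n40
    have h := (abs_le.1 h).1
    have : g.S a g.τ * (-2) ≤ g.S a g.τ * (a g.τ + g.o a) := by gcongr; linarith
    have : θ ι * g.S a g.τ ≤ 1 * g.S a g.τ := by gcongr; linarith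
    linarith
  · have h := (abs_le.1 (boxτ G (by norm_num) hb hk)).1
    nlinarith

end Gr

noncomputable def Cι (ι : Type*) [Fintype ι] [DecidableEq ι] : ℝ := 1152 * (1000 / Gr.θ ι) ^ 14
noncomputable def Eι (ι : Type*) [Fintype ι] [DecidableEq ι] : ℝ := 30 * (1000 / Gr.θ ι)
noncomputable def ει (ι : Type*) [Fintype ι] [DecidableEq ι] : ℝ := Gr.θ ι ^ 2 / 10 ^ 8

theorem grid_step {g : Gr ι} (G : g.ok) (h k : (ι → ℝ) → (ι → ℝ)) : ∃ h' k' : (ι → ℝ) → (ι → ℝ),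
    (∀ p L, 1 ≤ L → (∀ q, ‖q - g.pr p‖ ≤ 3 → GW (wt g.N g.τ (g.A.erase g.κ) q) L (ει ι) h k q) →
      GW (wt g.N g.τ g.A p) (Cι ι * L ^ 3) (Eι ι) h' k' p) ∧
    (∀ p, (∀ q, ‖q - g.pr p‖ ≤ 3 → h q = q ∧ k q = q) → h' p = p ∧ k' p = p) ∧
    (∀ p, p g.τ ≤ -3 → (h p g.τ ≤ 0 → h' p = h p) ∧ (k p g.τ ≤ 0 → k' p = k p)) := by
  have t0 := Gr.θ0 (ι := ι)
  have t1 := Gr.θ1 (ι := ι)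
  obtain ⟨h', k', a1, a2, a3⟩ := (Gr.step G).main (ε := ει ι)
    (by
      have e : 1000 / Gr.θ ι * ει ι = Gr.θ ι / 10 ^ 5 := by unfold ει; field_simp; norm_num
      rw [e]; linarith)
    (by
      have e : 1000 / Gr.θ ι * (1000 / Gr.θ ι * ει ι) = 1 / 100 := by unfold ει; field_simp; norm_num
      rw [e]; norm_num) h k
  have key : ∀ p q, (q = p ∨ ∃ j : {a : ι → ℤ // -2 ≤ a g.τ}, nw (g.sz j.1) (p - g.zc j.1) ≤ 9 ∧
      nw (g.sz j.1) (q - g.zc j.1) ≤ 10) → ‖g.f q q - g.pr p‖ ≤ 3 := by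
    intro p q hq
    have h1 : ‖q - p‖ ≤ 1 := by
      rcases hq with rfl | ⟨j, hj1, hj2⟩
      · simp
      · exact Gr.box_dist G hj1 hj2
    have h2 := Gr.f_dist G q
    have h3 := Gr.pr_lip G q p
    have e : g.f q q - g.pr p = (g.f q q - g.pr q) + (g.pr q - g.pr p) := by abel
    rw [e]
    linarith [norm_add_le (g.f q q - g.pr q) (g.pr q - g.pr p)]
  refine ⟨h', k', fun p L hL H => a2 p L hL fun q hq => H _ (key p q hq),
    fun p H => a3 p fun q hq => H _ (key p q hq), fun p hp => ?_⟩
  obtain ⟨b1, b2⟩ := a1 p fun j => Gr.low_box G hp j.2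
  exact ⟨fun hh => by rw [b1, Gr.fix_low G hp h hh], fun hh => by rw [b2, Gr.fix_low G hp k hh]⟩

theorem wt_scale {N : ℕ} (τ : ι) (A : Finset ι) (p v : ι → ℝ) :
    nw (wt N τ A p) v = N * nw (wt 1 τ A p) v := by
  have e : v / wt N τ A p = (N:ℝ) • (v / wt 1 τ A p) := by
    ext i
    simp only [Pi.div_apply, Pi.smul_apply, smul_eq_mul, wt, wsc]
    split_ifs <;> simp [div_eq_mul_inv, mul_inv] <;> ring
  unfold nw; rw [e, norm_smul]; simp

theorem wt1_empty (τ : ι) (p v : ι → ℝ) : nw (wt 1 τ ∅ p) v = ‖v‖ := by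
  have : v / wt 1 τ ∅ p = v := by ext i; simp [wt, wsc]
  unfold nw; rw [this]

theorem wt1_pos (τ : ι) (A : Finset ι) (p : ι → ℝ) (i : ι) : 0 < wt 1 τ A p i := by
  have := lam_pos (p τ)
  unfold wt wsc; split_ifs <;> simp [this]

theorem GW_scale {N : ℕ} (hN : 40 ≤ N) (τ : ι) (A : Finset ι) (p : ι → ℝ) {L ε : ℝ} {h k : (ι → ℝ) → (ι → ℝ)} :
    GW (wt N τ A p) L ε h k p ↔ GW (wt 1 τ A p) L (ε / N) h k p := by
  have N0 : (0:ℝ) < N := by exact_mod_cast (by omega : 0 < N)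
  have e1 : ∀ v, nw (wt N τ A p) v ≤ ε ↔ nw (wt 1 τ A p) v ≤ ε / N := fun v => by
    rw [wt_scale, le_div_iff₀ N0, mul_comm]
  have e2 : ∀ h, PLw (wt N τ A p) L h p ↔ PLw (wt 1 τ A p) L h p := fun h => by
    unfold PLw
    refine Filter.eventually_congr (Filter.Eventually.of_forall fun q => ?_)
    rw [wt_scale (N := N), wt_scale (N := N), mul_left_comm, mul_le_mul_iff_right₀ N0]
  constructor
  · rintro ⟨a, b, c, d, e, f⟩; exact ⟨(e1 _).1 a, (e1 _).1 b, c, d, (e2 _).1 e, (e2 _).1 f⟩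
  · rintro ⟨a, b, c, d, e, f⟩; exact ⟨(e1 _).2 a, (e1 _).2 b, c, d, (e2 _).2 e, (e2 _).2 f⟩

theorem GW_empty {τ : ι} {p : ι → ℝ} {L ε : ℝ} {h k : (ι → ℝ) → (ι → ℝ)} (H : Gd L ε h k p) :
    GW (wt 1 τ ∅ p) L ε h k p := by
  refine ⟨by rw [wt1_empty]; exact H.ch, by rw [wt1_empty]; exact H.ck, H.hk, H.kh, ?_, ?_⟩
  · have := H.lh; unfold PL at this; unfold PLw; simpa only [wt1_empty] using this
  · have := H.lk; unfold PL at this; unfold PLw; simpa only [wt1_empty] using this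

theorem chain (τ : ι) (A : Finset ι) (hA : τ ∉ A) : ∀ e : ℝ, 0 < e → ∃ ε C R : ℝ, ∃ K : ℕ, 0 < ε ∧ 1 ≤ C ∧ 3 ≤ R ∧
    ∀ h k : (ι → ℝ) → (ι → ℝ), ∃ h' k' : (ι → ℝ) → (ι → ℝ),
    (∀ p L, 1 ≤ L → (∀ q, ‖q - pi0 τ p‖ ≤ R → Gd L ε h k q) → GW (wt 1 τ A p) (C * L ^ K) e h' k' p) ∧
    (∀ p, (∀ q, ‖q - pi0 τ p‖ ≤ R → h q = q ∧ k q = q) → h' p = p ∧ k' p = p) ∧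
    (∀ p, p τ ≤ -R → (‖h p - p‖ ≤ 1 → h' p = h p) ∧ (‖k p - p‖ ≤ 1 → k' p = k p)) := by
  have t0 := Gr.θ0 (ι := ι)
  have t1 := Gr.θ1 (ι := ι)
  have T : 1 ≤ 1000 / Gr.θ ι := by rw [le_div_iff₀ t0]; linarith
  have C1 : 1 ≤ Cι ι := by
    unfold Cι; have := one_le_pow₀ T (n := 14); linarith
  have E0 : 0 < Eι ι := by unfold Eι; positivity
  have e0 : 0 < ει ι := by unfold ει; positivity
  have tau : ∀ (h : (ι → ℝ) → (ι → ℝ)) p, ‖h p - p‖ ≤ 1 → h p τ ≤ p τ + 1 := fun h p H => by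
    have := (norm_le_pi_norm (h p - p) τ).trans H
    rw [Pi.sub_apply, Real.norm_eq_abs] at this
    linarith [le_abs_self (h p τ - p τ)]
  induction A using Finset.induction_on with
  | empty =>
    intro e he
    obtain ⟨N, hN⟩ := exists_nat_ge (max 40 (Eι ι / e))
    have hN40 : 40 ≤ N := by exact_mod_cast (le_max_left _ _).trans hN
    have N0 : (0:ℝ) < N := by exact_mod_cast (by omega : 0 < N)
    have hE : Eι ι / N ≤ e := by
      have := (le_max_right _ _).trans hN
      rw [div_le_iff₀ he] at this; rw [div_le_iff₀ N0]; linarith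
    let g : Gr ι := ⟨N, τ, τ, ∅, fun x => max x 0, 0⟩
    have G : g.ok := ⟨hN40, by simp [g], Or.inl ⟨rfl, rfl, rfl, rfl⟩⟩
    have hp : ∀ p, g.pr p = pi0 τ p := fun p => by simp [g, Gr.pr]
    refine ⟨ει ι / N, Cι ι, 3, 3, by positivity, C1, le_rfl, fun h k => ?_⟩
    obtain ⟨h', k', a1, a2, a3⟩ := grid_step G h k
    refine ⟨h', k', fun p L hL H => ?_, fun p H => a2 p (by rw [hp]; exact H), fun p hp => ?_⟩
    · have := a1 p L hL (fun q hq => (GW_scale hN40 _ _ _).2 (by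
        have := H q (by rw [← hp]; exact hq)
        simpa [g] using GW_empty (τ := τ) this))
      exact ((GW_scale hN40 _ _ _).1 this).mono le_rfl hE
    · obtain ⟨b1, b2⟩ := a3 p hp
      exact ⟨fun H => b1 (by have := tau _ _ H; change h p τ ≤ 0; linarith),
        fun H => b2 (by have := tau _ _ H; change k p τ ≤ 0; linarith)⟩
  | insert κ A hκ ih =>
    intro e he
    have hτA : τ ∉ A := fun h => hA (Finset.mem_insert_of_mem h)
    have hκτ : κ ≠ τ := fun h => hA (h ▸ Finset.mem_insert_self _ _)
    obtain ⟨N, hN⟩ := exists_nat_ge (max 40 (Eι ι / e))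
    have hN40 : 40 ≤ N := by exact_mod_cast (le_max_left _ _).trans hN
    have N0 : (0:ℝ) < N := by exact_mod_cast (by omega : 0 < N)
    have hE : Eι ι / N ≤ e := by
      have := (le_max_right _ _).trans hN
      rw [div_le_iff₀ he] at this; rw [div_le_iff₀ N0]; linarith
    obtain ⟨ε, C, R, K, ε0, hC, hR, H⟩ := ih hτA (ει ι / N) (by positivity)
    let g : Gr ι := ⟨N, τ, κ, insert κ A, fun x => x, 1⟩
    have G : g.ok := ⟨hN40, hA, Or.inr ⟨hκτ, Finset.mem_insert_self _ _, rfl, rfl⟩⟩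
    have hp : ∀ p, g.pr p = p := fun p => by simp [g, Gr.pr, hκτ]
    have hA' : g.A.erase g.κ = A := Finset.erase_insert hκ
    refine ⟨ε, Cι ι * C ^ 3, R + 3, K * 3, ε0, ?_, by linarith, fun h k => ?_⟩
    · have := one_le_pow₀ hC (n := 3); nlinarith
    obtain ⟨h1, k1, b1, b2, b3⟩ := H h k
    obtain ⟨h', k', a1, a2, a3⟩ := grid_step G h1 k1
    have tri : ∀ p q x : ι → ℝ, ‖q - p‖ ≤ 3 → ‖x - pi0 τ q‖ ≤ R → ‖x - pi0 τ p‖ ≤ R + 3 := by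
      intro p q x h1 h2
      have e : x - pi0 τ p = (x - pi0 τ q) + (pi0 τ q - pi0 τ p) := by abel
      rw [e]
      linarith [norm_add_le (x - pi0 τ q) (pi0 τ q - pi0 τ p), pi0_lip τ q p]
    refine ⟨h', k', fun p L hL H => ?_, fun p H => a2 p fun q hq => ?_, fun p hpp => ?_⟩
    · have L1 : 1 ≤ C * L ^ K := by have := one_le_pow₀ hL (n := K); nlinarith
      have := a1 p (C * L ^ K) L1 (fun q hq => (GW_scale hN40 _ _ _).2 (by
        rw [hA']
        exact b1 q L hL fun x hx => H x (tri p q x (by rw [← hp p]; exact hq) hx)))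
      refine ((GW_scale hN40 _ _ _).1 this).mono (le_of_eq ?_) hE
      rw [mul_pow, pow_mul]; ring
    · exact b2 q fun x hx => H x (tri p q x (by rw [← hp p]; exact hq) hx)
    · obtain ⟨c1, c2⟩ := b3 p (by linarith)
      obtain ⟨d1, d2⟩ := a3 p (by change p τ ≤ -3; linarith)
      constructor
      · intro H
        have e := c1 H
        rw [d1 (by rw [e]; have := tau _ _ H; change h p τ ≤ 0; linarith), e]
      · intro H
        have e := c2 H
        rw [d2 (by rw [e]; have := tau _ _ H; change k p τ ≤ 0; linarith), e]

end grid
end CDE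


namespace CDE

noncomputable def tht (t : ℝ) : ℝ := min t 0 + (1 - lam t)
noncomputable def psi (s : ℝ) : ℝ := min s 0 - Real.logb 2 (1 - max s 0)

theorem tht_neg {t : ℝ} (h : t ≤ 0) : tht t = t := by
  unfold tht; rw [lam_neg h, min_eq_left h]; ring
theorem psi_neg {t : ℝ} (h : t ≤ 0) : psi t = t := by
  unfold psi; rw [max_eq_right h, min_eq_left h]; simp
theorem tht_lt (t : ℝ) : tht t < 1 := by
  unfold tht; linarith [lam_pos t, min_le_right t 0]
theorem lam_le_gap (t : ℝ) : lam t ≤ 1 - tht t := by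
  unfold tht; linarith [min_le_right t 0]
theorem psi_tht (t : ℝ) : psi (tht t) = t := by
  rcases le_total t 0 with h | h
  · rw [tht_neg h, psi_neg h]
  · have e : tht t = 1 - lam t := by unfold tht; rw [min_eq_right h]; ring
    have h1 : 0 ≤ 1 - lam t := by linarith [lam_le_one t]
    rw [e]; unfold psi; rw [min_eq_right h1, max_eq_left h1]
    have : 1 - (1 - lam t) = (2:ℝ) ^ (-t) := by unfold lam; rw [max_eq_left h]; ring
    rw [this, Real.logb_rpow (by norm_num) (by norm_num)]; ring
theorem tht_psi {s : ℝ} (hs : s < 1) : tht (psi s) = s := by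
  rcases le_total s 0 with h | h
  · rw [psi_neg h, tht_neg h]
  · have h1 : psi s = - Real.logb 2 (1 - s) := by unfold psi; rw [min_eq_right h, max_eq_left h]; ring
    have h2 : 0 ≤ psi s := by
      rw [h1]
      have := Real.logb_nonpos (b := 2) (by norm_num) (by linarith : 0 ≤ 1 - s) (by linarith)
      linarith
    unfold tht lam
    rw [max_eq_left h2, min_eq_right h2, h1, neg_neg, Real.rpow_logb (by norm_num) (by norm_num) (by linarith)]
    ring
theorem psi_cont {s : ℝ} (hs : s < 1) : ContinuousAt psi s := by
  unfold psi
  have h1 : ContinuousAt (fun s : ℝ => 1 - max s 0) s := by fun_prop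
  have h2 : 1 - max s 0 ≠ 0 := by
    have : max s 0 < 1 := max_lt hs (by norm_num)
    intro h; linarith
  have h3 : ContinuousAt (fun s : ℝ => min s 0) s := by fun_prop
  unfold Real.logb
  exact h3.sub ((h1.log h2).div_const _)

theorem tht_up {t t' : ℝ} (h : |t - t'| ≤ 1) : |tht t - tht t'| ≤ 4 * lam t' * |t - t'| := by
  have h1 := lam_lip h
  have l1 := lam_pos t'
  have h2 : |min t 0 - min t' 0| ≤ 2 * lam t' * |t - t'| := by
    by_cases hc : 0 ≤ t ∧ 0 ≤ t'
    · rw [min_eq_right hc.1, min_eq_right hc.2]; simp; positivity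
    · have a : (1:ℝ) ≤ 2 * lam t' := by
        rcases le_total t' 0 with ht | ht
        · rw [lam_neg ht]; norm_num
        · have : t ≤ 0 := by by_contra! hh; exact hc ⟨hh.le, ht⟩
          have := lam_cmp1 h; rwa [lam_neg ‹_›] at this
      have b := abs_min_sub_min_le_max t 0 t' 0
      simp at b
      nlinarith [abs_nonneg (t - t')]
  have e : tht t - tht t' = (min t 0 - min t' 0) - (lam t - lam t') := by unfold tht; ring
  rw [e]
  refine (abs_sub _ _).trans ?_
  linarith

theorem tht_lo' {t t' : ℝ} (h : t ≤ t') : lam t' * (t' - t) ≤ 2 * (tht t' - tht t) := by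
  have l0 := lam_pos t'
  have l1 := lam_le_one t'
  set s := max t' 0 - max t 0 with hs
  have s0 : 0 ≤ s := by rw [hs]; linarith [max_le_max h (le_refl (0:ℝ))]
  have e1 := max_add_min t' 0
  have e2 := max_add_min t 0
  have m0 := min_le_min h (le_refl (0:ℝ))
  have e3 : 1 + s / 2 ≤ (2:ℝ) ^ s := by
    rw [Real.rpow_def_of_pos (by norm_num)]
    have := Real.add_one_le_exp (Real.log 2 * s)
    nlinarith [Real.log_two_gt_d9]
  have e4 : lam t = 2 ^ s * lam t' := lam_quot t t'
  have e5 : lam t' * (s / 2) ≤ lam t - lam t' := by rw [e4]; nlinarith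
  have e6 : lam t' * (min t' 0 - min t 0) ≤ min t' 0 - min t 0 := by nlinarith
  have e7 : t' - t = s + (min t' 0 - min t 0) := by linarith
  unfold tht; rw [e7]; linarith

theorem tht_lo {t t' : ℝ} (h : |t - t'| ≤ 1) : lam t' * |t - t'| ≤ 4 * |tht t - tht t'| := by
  rcases le_total t t' with c | c
  · have := tht_lo' c
    rw [abs_sub_comm, abs_of_nonneg (by linarith), abs_sub_comm]
    have := le_abs_self (tht t' - tht t)
    linarith [abs_nonneg (tht t' - tht t)]
  · have h1 := tht_lo' c
    have h2 := lam_cmp1 (t := t') (t' := t) (by rw [abs_sub_comm]; exact h)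
    rw [abs_of_nonneg (by linarith)]
    have := le_abs_self (tht t - tht t')
    nlinarith

section cut
variable {ι : Type*} [Fintype ι] [DecidableEq ι]

noncomputable def Th (τ : ι) (p : ι → ℝ) : ι → ℝ := Function.update p τ (tht (p τ))
noncomputable def Ps (τ : ι) (p : ι → ℝ) : ι → ℝ := Function.update p τ (psi (p τ))
noncomputable def wc (τ : ι) (p : ι → ℝ) : ι → ℝ := wt 1 τ (Finset.univ.erase τ) p

theorem Ps_Th (τ : ι) (p : ι → ℝ) : Ps τ (Th τ p) = p := by
  unfold Ps Th; simp [psi_tht]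
theorem Th_Ps {τ : ι} {p : ι → ℝ} (h : p τ < 1) : Th τ (Ps τ p) = p := by
  unfold Ps Th; simp [tht_psi h]
theorem Thτ (τ : ι) (p : ι → ℝ) : Th τ p τ = tht (p τ) := by unfold Th; rw [Function.update_self]
theorem wcp (τ : ι) (p : ι → ℝ) (i : ι) : 0 < wc τ p i := wt1_pos _ _ _ _
theorem wcτ (τ : ι) (p : ι → ℝ) : wc τ p τ = 1 := by simp [wc, wt, wsc]
theorem wco {τ : ι} (p : ι → ℝ) {i : ι} (h : i ≠ τ) : wc τ p i = lam (p τ) := by simp [wc, wt, wsc, h]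

theorem Th_up {τ : ι} {u u' : ι → ℝ} (h : |u τ - u' τ| ≤ 1) :
    ‖Th τ u - Th τ u'‖ ≤ 4 * lam (u' τ) * nw (wc τ u') (u - u') := by
  have l := lam_pos (u' τ)
  have n := nw_nn (wc τ u') (u - u')
  rw [pi_norm_le_iff_of_nonneg (by positivity)]
  intro i
  have x := nw_i (wcp τ u') (u - u') i
  rw [Pi.sub_apply] at x ⊢
  rw [Real.norm_eq_abs]
  unfold Th
  by_cases hi : i = τ
  · subst hi
    rw [wcτ, mul_one] at x
    simp only [Function.update_self]
    exact (tht_up h).trans (by gcongr)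
  · rw [wco _ hi] at x
    simp only [Function.update_of_ne hi]
    nlinarith [mul_nonneg l.le n]

theorem Th_lo {τ : ι} {u u' : ι → ℝ} (h : |u τ - u' τ| ≤ 1) :
    lam (u' τ) * nw (wc τ u') (u - u') ≤ 4 * ‖Th τ u - Th τ u'‖ := by
  have l := lam_pos (u' τ)
  have : nw (wc τ u') (u - u') ≤ (lam (u' τ))⁻¹ * (4 * ‖Th τ u - Th τ u'‖) := by
    rw [nw_le (wcp τ u') (by positivity)]
    intro i
    have x := norm_le_pi_norm (Th τ u - Th τ u') i
    rw [Pi.sub_apply] at x ⊢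
    rw [Real.norm_eq_abs] at x
    unfold Th at x
    by_cases hi : i = τ
    · subst hi
      rw [wcτ, mul_one]
      simp only [Function.update_self] at x
      rw [← div_eq_inv_mul, le_div_iff₀ l]
      have := tht_lo h
      change |tht (u i) - tht (u' i)| ≤ ‖Th i u - Th i u'‖ at x
      linarith
    · rw [wco _ hi]
      simp only [Function.update_of_ne hi] at x
      change |u i - u' i| ≤ ‖Th τ u - Th τ u'‖ at x
      have e : (lam (u' τ))⁻¹ * (4 * ‖Th τ u - Th τ u'‖) * lam (u' τ) = 4 * ‖Th τ u - Th τ u'‖ := by field_simp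
      rw [e]; linarith [norm_nonneg (Th τ u - Th τ u')]
  calc _ ≤ lam (u' τ) * ((lam (u' τ))⁻¹ * (4 * ‖Th τ u - Th τ u'‖)) := by gcongr
    _ = _ := by field_simp

theorem Ps_cont {τ : ι} {p : ι → ℝ} (h : p τ < 1) : ContinuousAt (Ps τ) p := by
  unfold Ps
  have : ContinuousAt (fun p : ι → ℝ => psi (p τ)) p :=
    ContinuousAt.comp (g := psi) (f := fun p : ι → ℝ => p τ) (psi_cont h) (continuous_apply τ).continuousAt
  exact continuousAt_id.update τ this

theorem cut_half {τ : ι} {h : (ι → ℝ) → (ι → ℝ)} {p : ι → ℝ} {L : ℝ} (hp : p τ < 1) (hL : 1 ≤ L)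
    (c : nw (wc τ (Ps τ p)) (h (Ps τ p) - Ps τ p) ≤ 1/4) (lh : PLw (wc τ (Ps τ p)) L h (Ps τ p)) :
    ‖Th τ (h (Ps τ p)) - p‖ ≤ lam (Ps τ p τ) ∧ PL (64 * L) (fun q => Th τ (h (Ps τ q))) p := by
  set u := Ps τ p with hu
  have l := lam_pos (u τ)
  have ττ : ∀ v, |v τ| ≤ nw (wc τ u) v := fun v => by
    have := nw_i (wcp τ u) v τ; rwa [wcτ, mul_one] at this
  have c1 : |h u τ - u τ| ≤ 1 := (ττ (h u - u)).trans (by linarith)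
  constructor
  · have := Th_up c1
    rw [hu, Th_Ps hp, ← hu] at this
    nlinarith
  · have hL' : 0 < 1 / L := by positivity
    filter_upwards [(Ps_cont hp).eventually lh, (Ps_cont hp).eventually (nw_ev (wc τ u) u hL'),
      (continuous_apply τ).continuousAt.eventually (gt_mem_nhds hp)] with q h1 h2 h3
    have h2' : L * nw (wc τ u) (Ps τ q - u) < 1 := by rwa [lt_div_iff₀' (by linarith)] at h2
    have n0 := nw_nn (wc τ u) (Ps τ q - u)
    have a1 : |Ps τ q τ - u τ| ≤ 1 := (ττ (Ps τ q - u)).trans (by nlinarith)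
    have a2 : |h (Ps τ q) τ - h u τ| ≤ 1 := (ττ (h (Ps τ q) - h u)).trans (by linarith)
    have b1 := Th_lo a1
    rw [Th_Ps h3, hu, Th_Ps hp, ← hu] at b1
    have b2 := Th_up a2
    have b3 : lam (h u τ) ≤ 2 * lam (u τ) := lam_cmp1 c1
    have b4 : nw (wc τ (h u)) (h (Ps τ q) - h u) ≤ 2 * nw (wc τ u) (h (Ps τ q) - h u) :=
      nw_comp (wcp _ _) (wcp _ _) (by norm_num) (fun i => wsc_cmp _ (by norm_num)
        (lam_cmp1 (by rw [abs_sub_comm]; exact c1)) i) _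
    calc _ ≤ 4 * lam (h u τ) * nw (wc τ (h u)) (h (Ps τ q) - h u) := b2
      _ ≤ 4 * (2 * lam (u τ)) * (2 * (L * nw (wc τ u) (Ps τ q - u))) := by
          have := nw_nn (wc τ (h u)) (h (Ps τ q) - h u)
          gcongr
          exact b4.trans (by gcongr)
      _ = 16 * L * (lam (u τ) * nw (wc τ u) (Ps τ q - u)) := by ring
      _ ≤ 16 * L * (4 * ‖q - p‖) := by gcongr
      _ = _ := by ring

theorem pi0_Ps {τ : ι} {p : ι → ℝ} (hp : p τ < 1) : ‖pi0 τ (Ps τ p) - p‖ ≤ 1 := by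
  rw [pi_norm_le_iff_of_nonneg (by norm_num)]
  intro i
  rw [Pi.sub_apply, Real.norm_eq_abs]
  unfold pi0 Ps
  by_cases hi : i = τ
  · subst hi
    simp only [Function.update_self]
    have := tht_psi hp
    unfold tht at this
    have l0 := lam_pos (psi (p i))
    have l1 := lam_le_one (psi (p i))
    rw [abs_le]; constructor <;> linarith
  · simp only [Function.update_of_ne hi, sub_self, abs_zero]; norm_num

theorem cut (τ : ι) : ∃ ε C R : ℝ, ∃ K : ℕ, 0 < ε ∧ 1 ≤ C ∧ 3 ≤ R ∧
    ∀ h k : (ι → ℝ) → (ι → ℝ), ∃ h' k' : (ι → ℝ) → (ι → ℝ),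
    (∀ p L, 1 ≤ L → (∀ q, ‖q - p‖ ≤ R + 2 → Gd L ε h k q) → Gd (C * L ^ K) 1 h' k' p) ∧
    (∀ p, (∀ q, ‖q - p‖ ≤ R + 2 → h q = q ∧ k q = q) → h' p = p ∧ k' p = p) ∧
    (∀ p, p τ ≤ -R → (‖h p - p‖ ≤ 1 → h' p = h p) ∧ (‖k p - p‖ ≤ 1 → k' p = k p)) ∧
    (∀ p, 1 ≤ p τ → h' p = p ∧ k' p = p) := by
  obtain ⟨ε, C, R, K, ε0, hC, hR, H⟩ := chain τ (Finset.univ.erase τ) (by simp) (1/4) (by norm_num)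
  refine ⟨ε, 64 * C, R, K, ε0, by linarith, hR, fun h k => ?_⟩
  obtain ⟨h1, k1, b1, b2, b3⟩ := H h k
  let F : ((ι → ℝ) → (ι → ℝ)) → (ι → ℝ) → (ι → ℝ) := fun h p => if p τ < 1 then Th τ (h (Ps τ p)) else p
  have Fl : ∀ h p, p τ < 1 → F h p = Th τ (h (Ps τ p)) := fun h p hp => if_pos hp
  have Fg : ∀ h p, 1 ≤ p τ → F h p = p := fun h p hp => if_neg (not_lt.2 hp)
  have ball : ∀ p q, p τ < 1 → ‖q - pi0 τ (Ps τ p)‖ ≤ R → ‖q - p‖ ≤ R + 1 := by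
    intro p q hp hq
    have e : q - p = (q - pi0 τ (Ps τ p)) + (pi0 τ (Ps τ p) - p) := by abel
    rw [e]; linarith [norm_add_le (q - pi0 τ (Ps τ p)) (pi0 τ (Ps τ p) - p), pi0_Ps hp]
  have good : ∀ p L, 1 ≤ L → p τ < 1 → (∀ q, ‖q - p‖ ≤ R + 1 → Gd L ε h k q) →
      GW (wc τ (Ps τ p)) (C * L ^ K) (1/4) h1 k1 (Ps τ p) := fun p L hL hp hq =>
    b1 _ L hL fun q hq' => hq q (ball p q hp hq')
  have half : ∀ (f : (ι → ℝ) → (ι → ℝ)) p L', 1 ≤ L' →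
      (∀ q, ‖q - p‖ < 1 → q τ < 1 → nw (wc τ (Ps τ q)) (f (Ps τ q) - Ps τ q) ≤ 1/4 ∧
        PLw (wc τ (Ps τ q)) L' f (Ps τ q)) → ‖F f p - p‖ ≤ 1 ∧ PL (64 * L') (F f) p := by
    intro f p L' hL' hf
    rcases lt_or_ge (p τ) 1 with hp | hp
    · obtain ⟨c1, c2⟩ := hf p (by simp) hp
      obtain ⟨d1, d2⟩ := cut_half hp hL' c1 c2
      refine ⟨by rw [Fl _ _ hp]; exact d1.trans (lam_le_one _), d2.congr ?_⟩
      filter_upwards [(continuous_apply τ).continuousAt.eventually (gt_mem_nhds hp)] with q hq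
      exact Fl _ _ hq
    · refine ⟨by rw [Fg _ _ hp]; simp, ?_⟩
      unfold PL
      rw [Fg _ _ hp]
      filter_upwards [ball_mem_nhds p one_pos] with q hq
      rw [mem_ball_iff_norm] at hq
      have n0 := norm_nonneg (q - p)
      rcases lt_or_ge (q τ) 1 with hq1 | hq1
      · obtain ⟨c1, c2⟩ := hf q hq hq1
        obtain ⟨d1, d2⟩ := cut_half hq1 hL' c1 c2
        rw [Fl _ _ hq1]
        have g := lam_le_gap (Ps τ q τ)
        have e0 : tht (Ps τ q τ) = q τ := by rw [← Thτ, Th_Ps hq1]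
        rw [e0] at g
        have := norm_le_pi_norm (q - p) τ
        rw [Pi.sub_apply, Real.norm_eq_abs, abs_sub_comm] at this
        have := le_abs_self (p τ - q τ)
        have e : Th τ (f (Ps τ q)) - p = (Th τ (f (Ps τ q)) - q) + (q - p) := by abel
        rw [e]
        refine (norm_add_le _ _).trans ?_
        nlinarith
      · rw [Fg _ _ hq1]; nlinarith
  have near : ∀ p q x : ι → ℝ, ‖q - p‖ < 1 → ‖x - q‖ ≤ R + 1 → ‖x - p‖ ≤ R + 2 := by
    intro p q x h1 h2
    have e : x - p = (x - q) + (q - p) := by abel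
    rw [e]; linarith [norm_add_le (x - q) (q - p)]
  have inv : ∀ f g p, (p τ < 1 → f (g (Ps τ p)) = Ps τ p) → F f (F g p) = p := by
    intro f g p hfg
    rcases lt_or_ge (p τ) 1 with hp | hp
    · rw [Fl _ _ hp, Fl, Ps_Th, hfg hp, Th_Ps hp]
      rw [Thτ]; exact tht_lt _
    · rw [Fg _ _ hp, Fg _ _ hp]
  have low : ∀ (f f1 : (ι → ℝ) → (ι → ℝ)) p, p τ ≤ -R → ‖f p - p‖ ≤ 1 → f1 p = f p → F f1 p = f p := by
    intro f f1 p hp hf e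
    have : Ps τ p = p := by unfold Ps; rw [psi_neg (by linarith)]; simp
    rw [Fl _ _ (by linarith), this, e]
    have hx := (norm_le_pi_norm (f p - p) τ).trans hf
    rw [Pi.sub_apply, Real.norm_eq_abs] at hx
    unfold Th; rw [tht_neg (by linarith [le_abs_self (f p τ - p τ)])]; simp
  refine ⟨F h1, F k1, fun p L hL hq => ?_, fun p hq => ?_, fun p hp => ?_, fun p hp => ⟨Fg _ _ hp, Fg _ _ hp⟩⟩
  · have L1 : 1 ≤ C * L ^ K := by have := one_le_pow₀ hL (n := K); nlinarith
    have gd : ∀ q, ‖q - p‖ < 1 → q τ < 1 → GW (wc τ (Ps τ q)) (C * L ^ K) (1/4) h1 k1 (Ps τ q) := fun q h1 h2 =>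
      good q L hL h2 fun x hx => hq x (near p q x h1 hx)
    obtain ⟨x1, x2⟩ := half h1 p _ L1 fun q h1 h2 => ⟨(gd q h1 h2).ch, (gd q h1 h2).lh⟩
    obtain ⟨y1, y2⟩ := half k1 p _ L1 fun q h1 h2 => ⟨(gd q h1 h2).ck, (gd q h1 h2).lk⟩
    rw [← mul_assoc] at x2 y2
    exact ⟨x1, y1, inv _ _ _ fun hp => (gd p (by simp) hp).hk, inv _ _ _ fun hp => (gd p (by simp) hp).kh, x2, y2⟩
  · rcases lt_or_ge (p τ) 1 with hp | hp
    · obtain ⟨c1, c2⟩ := b2 (Ps τ p) fun q hq' => hq q (by linarith [ball p q hp hq'])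
      rw [Fl _ _ hp, Fl _ _ hp, c1, c2, Th_Ps hp]; exact ⟨rfl, rfl⟩
    · exact ⟨Fg _ _ hp, Fg _ _ hp⟩
  · obtain ⟨c1, c2⟩ := b3 p hp
    exact ⟨fun hh => low h h1 p hp hh (c1 hh), fun hh => low k k1 p hp hh (c2 hh)⟩

end cut

theorem Gd_conj {E : Type*} [NormedAddCommGroup E] [NormedSpace ℝ E] {T T' : E → E} {a : ℝ} (ha : 0 < a)
    (tt' : ∀ x, T (T' x) = x) (t't : ∀ x, T' (T x) = x)
    (l1 : ∀ x y, ‖T x - T y‖ ≤ a * ‖x - y‖) (l2 : ∀ x y, ‖T' x - T' y‖ ≤ a⁻¹ * ‖x - y‖)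
    {L ε : ℝ} (hL : 0 ≤ L) {h k : E → E} {x : E} (H : Gd L ε h k (T' x)) :
    Gd L (a * ε) (fun y => T (h (T' y))) (fun y => T (k (T' y))) x := by
  have c : ∀ h : E → E, ‖h (T' x) - T' x‖ ≤ ε → ‖T (h (T' x)) - x‖ ≤ a * ε := fun h hh => by
    have := l1 (h (T' x)) (T' x)
    rw [tt'] at this
    exact this.trans (by gcongr)
  have l : ∀ h : E → E, PL L h (T' x) → PL L (fun y => T (h (T' y))) x := fun h hh => by
    have := PL.comp (a := a) ha.le (f := T) (g := fun y => h (T' y)) (PL.of_lip l1 (h (T' x)))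
      (PL.comp hL (f := h) (g := T') hh (PL.of_lip l2 x))
    refine this.mono (le_of_eq ?_)
    field_simp
  exact ⟨c h H.ch, c k H.ck, by simp only [t't, H.hk, tt'], by simp only [t't, H.kh, tt'], l h H.lh, l k H.lk⟩

section cut2
variable {ι : Type*} [Fintype ι] [DecidableEq ι]

theorem cut2 (i : ι) {η : ℝ} (hη : 0 < η) : ∃ ε C : ℝ, ∃ K : ℕ, 0 < ε ∧ 1 ≤ C ∧
    ∀ (m σ : ℝ), σ * σ = 1 → ∀ h k : (ι → ℝ) → (ι → ℝ), ∃ h' k' : (ι → ℝ) → (ι → ℝ),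
    (∀ p L, 1 ≤ L → (∀ q, ‖q - p‖ ≤ η → Gd L ε h k q) → Gd (C * L ^ K) η h' k' p) ∧
    (∀ p, (∀ q, ‖q - p‖ ≤ η → h q = q ∧ k q = q) → h' p = p ∧ k' p = p) ∧
    (∀ p, σ * (p i - m) ≤ 0 → (‖h p - p‖ ≤ ε → h' p = h p) ∧ (‖k p - p‖ ≤ ε → k' p = k p)) ∧
    (∀ p, η ≤ σ * (p i - m) → h' p = p ∧ k' p = p) := by
  obtain ⟨ε, C, R, K, ε0, hC, hR, H⟩ := cut i
  set μ := η / (R + 2) with hμ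
  have μ0 : 0 < μ := by positivity
  have μη : μ * (R + 2) = η := by rw [hμ]; field_simp
  refine ⟨μ * min ε 1, C, K, by positivity, hC, fun m σ hσ h k => ?_⟩
  let T : (ι → ℝ) → (ι → ℝ) := fun p j => if j = i then σ * (p j - m) / μ - R else p j / μ
  let T' : (ι → ℝ) → (ι → ℝ) := fun p j => if j = i then m + σ * (μ * (p j + R)) else μ * p j
  have sabs : |σ| = 1 := by
    have : |σ| * |σ| = 1 := by rw [← abs_mul, hσ, abs_one]
    nlinarith [abs_nonneg σ]
  have tt' : ∀ x, T (T' x) = x := fun x => by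
    funext j; simp only [T, T']; split_ifs
    · have : σ * (m + σ * (μ * (x j + R)) - m) = σ * σ * (μ * (x j + R)) := by ring
      rw [this, hσ]; field_simp; ring
    · field_simp
  have t't : ∀ x, T' (T x) = x := fun x => by
    funext j; simp only [T, T']; split_ifs
    · have : σ * (μ * (σ * (x j - m) / μ - R + R)) = σ * σ * (x j - m) * (μ / μ) := by ring
      rw [this, hσ, div_self μ0.ne']; ring
    · field_simp
  have l1 : ∀ x y, ‖T x - T y‖ ≤ μ⁻¹ * ‖x - y‖ := fun x y => by
    rw [pi_norm_le_iff_of_nonneg (by positivity)]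
    intro j
    have n := norm_le_pi_norm (x - y) j
    rw [Pi.sub_apply, Real.norm_eq_abs] at n ⊢
    simp only [T]
    split_ifs
    · have e : σ * (x j - m) / μ - R - (σ * (y j - m) / μ - R) = μ⁻¹ * (σ * (x j - y j)) := by ring
      rw [e, abs_mul, abs_mul, sabs, one_mul, abs_of_pos (inv_pos.2 μ0)]; gcongr
    · have e : x j / μ - y j / μ = μ⁻¹ * (x j - y j) := by ring
      rw [e, abs_mul, abs_of_pos (inv_pos.2 μ0)]; gcongr
  have l2 : ∀ x y, ‖T' x - T' y‖ ≤ μ * ‖x - y‖ := fun x y => by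
    rw [pi_norm_le_iff_of_nonneg (by positivity)]
    intro j
    have n := norm_le_pi_norm (x - y) j
    rw [Pi.sub_apply, Real.norm_eq_abs] at n ⊢
    simp only [T']
    split_ifs
    · have e : m + σ * (μ * (x j + R)) - (m + σ * (μ * (y j + R))) = μ * (σ * (x j - y j)) := by ring
      rw [e, abs_mul, abs_mul, sabs, one_mul, abs_of_pos μ0]; gcongr
    · have e : μ * x j - μ * y j = μ * (x j - y j) := by ring
      rw [e, abs_mul, abs_of_pos μ0]; gcongr
  have Ti : ∀ p, T p i = σ * (p i - m) / μ - R := fun p => by simp [T]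
  obtain ⟨h1, k1, a1, a2, a3, a4⟩ := H (fun x => T (h (T' x))) (fun x => T (k (T' x)))
  have near : ∀ p q, ‖q - T p‖ ≤ R + 2 → ‖T' q - p‖ ≤ η := fun p q hq => by
    have := l2 q (T p)
    rw [t't] at this
    rw [← μη]; exact this.trans (by gcongr)
  refine ⟨fun p => T' (h1 (T p)), fun p => T' (k1 (T p)), fun p L hL hq => ?_, fun p hq => ?_, fun p hp => ?_,
    fun p hp => ?_⟩
  · have := a1 (T p) L hL fun q hq' => by
      refine (Gd_conj (inv_pos.2 μ0) tt' t't l1 (by simpa using l2) (by linarith) (hq (T' q) (near p q hq'))).mono le_rfl ?_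
      rw [← mul_assoc, inv_mul_cancel₀ μ0.ne', one_mul]; exact min_le_left _ _
    refine (Gd_conj μ0 t't tt' l2 l1 (by have := one_le_pow₀ hL (n := K); nlinarith) this).mono le_rfl ?_
    rw [← μη]; nlinarith
  · obtain ⟨c1, c2⟩ := a2 (T p) fun q hq' => by
      obtain ⟨d1, d2⟩ := hq (T' q) (near p q hq')
      simp only [d1, d2, tt']; exact ⟨trivial, trivial⟩
    simp only [c1, c2, t't]; exact ⟨trivial, trivial⟩
  · have : T p i ≤ -R := by
      rw [Ti]
      have : σ * (p i - m) / μ ≤ 0 := div_nonpos_of_nonpos_of_nonneg hp μ0.le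
      linarith
    obtain ⟨c1, c2⟩ := a3 (T p) this
    have key : ∀ h : (ι → ℝ) → (ι → ℝ), ‖h p - p‖ ≤ μ * min ε 1 → ‖T (h (T' (T p))) - T p‖ ≤ 1 := fun h hh => by
      rw [t't]
      refine (l1 _ _).trans ?_
      calc _ ≤ μ⁻¹ * (μ * 1) := by gcongr; exact hh.trans (by gcongr; exact min_le_right _ _)
        _ = 1 := by field_simp
    exact ⟨fun hh => by simp only [c1 (key h hh), t't], fun hh => by simp only [c2 (key k hh), t't]⟩
  · have : 1 ≤ T p i := by
      rw [Ti]
      have : (R + 2) ≤ σ * (p i - m) / μ := by rw [le_div_iff₀ μ0]; linarith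
      linarith
    obtain ⟨c1, c2⟩ := a4 (T p) this
    simp only [c1, c2, t't]; exact ⟨trivial, trivial⟩

end cut2
end CDE


namespace CDE

section glue
variable {E : Type*} [NormedAddCommGroup E] [NormedSpace ℝ E]

theorem Gd.symm {L ε : ℝ} {h k : E → E} {p : E} (H : Gd L ε h k p) : Gd L ε k h p :=
  ⟨H.ck, H.ch, H.kh, H.hk, H.lk, H.lh⟩

theorem Gd.comp {a b ε1 ε2 : ℝ} (ha : 0 ≤ a) (hb : 0 ≤ b) {h1 k1 h2 k2 : E → E} {p : E}
    (A : Gd a ε2 h2 k2 (h1 p)) (A' : Gd a ε2 h2 k2 p) (B : Gd b ε1 h1 k1 p) (B' : Gd b ε1 h1 k1 (k2 p)) :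
    Gd (a * b) (ε1 + ε2) (fun x => h2 (h1 x)) (fun x => k1 (k2 x)) p := by
  refine ⟨?_, ?_, ?_, ?_, PL.comp ha A.lh B.lh, ?_⟩
  · have e : h2 (h1 p) - p = (h2 (h1 p) - h1 p) + (h1 p - p) := by abel
    change ‖h2 (h1 p) - p‖ ≤ _
    rw [e]; linarith [norm_add_le (h2 (h1 p) - h1 p) (h1 p - p), A.ch, B.ch]
  · have e : k1 (k2 p) - p = (k1 (k2 p) - k2 p) + (k2 p - p) := by abel
    change ‖k1 (k2 p) - p‖ ≤ _
    rw [e]; linarith [norm_add_le (k1 (k2 p) - k2 p) (k2 p - p), A'.ck, B'.ck]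
  · change h2 (h1 (k1 (k2 p))) = p
    rw [B'.hk, A'.hk]
  · change k1 (k2 (h2 (h1 p))) = p
    rw [A.kh, B.kh]
  · rw [mul_comm]; exact PL.comp hb B'.lk A'.lk

theorem Gd.idd {L ε : ℝ} (hL : 1 ≤ L) (hε : 0 ≤ ε) (p : E) : Gd L ε (fun x => x) (fun x => x) p :=
  ⟨by simpa using hε, by simpa using hε, rfl, rfl, (PL.id p).mono hL, (PL.id p).mono hL⟩

theorem tri {p q r : E} {a b : ℝ} (h1 : ‖p - q‖ ≤ a) (h2 : ‖q - r‖ ≤ b) : ‖p - r‖ ≤ a + b := by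
  have e : p - r = (p - q) + (q - r) := by abel
  rw [e]; linarith [norm_add_le (p - q) (q - r)]

end glue

section split
variable {ι : Type*} [Fintype ι] [DecidableEq ι]

theorem ci {p q : ι → ℝ} {a : ℝ} (h : ‖p - q‖ ≤ a) (i : ι) : |p i - q i| ≤ a := by
  have := (norm_le_pi_norm (p - q) i).trans h
  rwa [Pi.sub_apply, Real.norm_eq_abs] at this

theorem split1 (i : ι) {η : ℝ} (hη : 0 < η) (hη8 : η ≤ 1/8) : ∃ ε C : ℝ, ∃ K : ℕ, 0 < ε ∧ 1 ≤ C ∧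
    ∀ h k : (ι → ℝ) → (ι → ℝ), ∃ h' k' : (ι → ℝ) → (ι → ℝ),
    (∀ p L, 1 ≤ L → (∀ q, ‖q - p‖ ≤ 1 → Gd L ε h k q) → Gd (C * L ^ K) η h' k' p) ∧
    (∀ p, (∀ q, ‖q - p‖ ≤ η → h q = q ∧ k q = q) → h' p = p ∧ k' p = p) ∧
    (∀ (p : ι → ℝ) (l : ℤ), 2 * (l:ℝ) ≤ p i → p i ≤ 2 * l + 1 →
      (‖h p - p‖ ≤ ε → h' p = h p) ∧ (‖k p - p‖ ≤ ε → k' p = k p)) ∧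
    (∀ (p : ι → ℝ) (l : ℤ), 2 * (l:ℝ) + 1 + η ≤ p i → p i ≤ 2 * l + 2 - η → h' p = p ∧ k' p = p) := by
  obtain ⟨ε, C, K, ε0, hC, H⟩ := cut2 i hη
  refine ⟨ε, C, K, ε0, hC, fun h k => ?_⟩
  let σ : ℤ → ℝ := fun m => if Even m then -1 else 1
  have hσ : ∀ m, σ m * σ m = 1 := fun m => by simp only [σ]; split_ifs <;> norm_num
  have σe : ∀ l : ℤ, σ (2 * l) = -1 := fun l => if_pos (by simp)
  have σo : ∀ l : ℤ, σ (2 * l + 1) = 1 := fun l => if_neg (by simp [Int.even_add_one])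
  choose h1 k1 a1 a2 a3 a4 using fun m : ℤ => H m (σ m) (hσ m) h k
  have fA : ∀ (l n : ℤ) (q : ι → ℝ), 2 * (l:ℝ) ≤ q i → q i ≤ 2 * l + 1 → n = 2 * l ∨ n = 2 * l + 1 →
      (‖h q - q‖ ≤ ε → h1 n q = h q) ∧ (‖k q - q‖ ≤ ε → k1 n q = k q) := by
    rintro l n q x1 x2 (rfl | rfl)
    · exact a3 _ q (by rw [σe]; push_cast; linarith)
    · exact a3 _ q (by rw [σo]; push_cast; linarith)
  have fB : ∀ (l n : ℤ) (q : ι → ℝ), 2 * (l:ℝ) + 1 + η ≤ q i → q i ≤ 2 * l + 2 - η → n = 2 * l + 1 ∨ n = 2 * l + 2 →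
      h1 n q = q ∧ k1 n q = q := by
    rintro l n q x1 x2 (rfl | rfl)
    · exact a4 _ q (by rw [σo]; push_cast; linarith)
    · have : (2 * l + 2 : ℤ) = 2 * (l + 1) := by ring
      rw [this]
      exact a4 _ q (by rw [σe]; push_cast; linarith)
  let m : (ι → ℝ) → ℤ := fun q => ⌊q i + 1/2⌋
  have m1 : ∀ q, (m q : ℝ) ≤ q i + 1/2 := fun q => Int.floor_le _
  have m2 : ∀ q, q i + 1/2 < (m q : ℝ) + 1 := fun q => Int.lt_floor_add_one _
  have key : ∀ (n : ℤ) (q : ι → ℝ), |q i - n| ≤ 3/4 → (‖h q - q‖ ≤ ε → h1 (m q) q = h1 n q) ∧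
      (‖k q - q‖ ≤ ε → k1 (m q) q = k1 n q) := by
    intro n q hq
    rw [abs_le] at hq
    have := m1 q; have := m2 q
    by_cases e : m q = n
    · rw [e]; exact ⟨fun _ => rfl, fun _ => rfl⟩
    · have : ∃ a : ℤ, (a:ℝ) + 1/4 ≤ q i ∧ q i ≤ a + 3/4 ∧ (m q = a ∨ m q = a + 1) ∧ (n = a ∨ n = a + 1) := by
        have r1 : m q < n + 2 := by
          have : (m q : ℝ) < ((n + 2 : ℤ) : ℝ) := by push_cast; linarith
          exact_mod_cast this
        have r2 : n - 2 < m q := by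
          have : ((n - 2 : ℤ) : ℝ) < m q := by push_cast; linarith
          exact_mod_cast this
        rcases (by omega : m q = n + 1 ∨ m q = n - 1) with r | r
        · refine ⟨n, ?_, ?_, Or.inr r, Or.inl rfl⟩
          · have : (m q : ℝ) = n + 1 := by rw [r]; push_cast; ring
            linarith
          · linarith
        · have : (m q : ℝ) = n - 1 := by rw [r]; push_cast; ring
          refine ⟨n - 1, ?_, ?_, Or.inl r, Or.inr (by ring)⟩
          · push_cast; linarith
          · push_cast; linarith
      obtain ⟨a, b1, b2, b3, b4⟩ := this
      obtain ⟨l, hl⟩ := Int.even_or_odd' a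
      rcases hl with rfl | rfl
      · push_cast at b1 b2
        have c1 := fA l (m q) q (by linarith) (by linarith) b3
        have c2 := fA l n q (by linarith) (by linarith) b4
        exact ⟨fun hh => (c1.1 hh).trans (c2.1 hh).symm, fun hh => (c1.2 hh).trans (c2.2 hh).symm⟩
      · push_cast at b1 b2
        have c1 := fB l (m q) q (by linarith) (by linarith) (by omega)
        have c2 := fB l n q (by linarith) (by linarith) (by omega)
        exact ⟨fun hh => c1.1.trans c2.1.symm, fun hh => c1.2.trans c2.2.symm⟩
  refine ⟨fun q => h1 (m q) q, fun q => k1 (m q) q, fun p L hL hq => ?_, fun p hq => a2 _ p hq, fun p l x1 x2 => ?_,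
    fun p l x1 x2 => ?_⟩
  · have g := a1 (m p) p L hL fun q hq' => hq q (by linarith)
    have loc : ∀ q, ‖q - p‖ ≤ 1/8 → h1 (m q) q = h1 (m p) q ∧ k1 (m q) q = k1 (m p) q := by
      intro q hq'
      have g' := hq q (by linarith)
      have := m1 p; have := m2 p
      have x := abs_le.1 (ci hq' i)
      have : |q i - m p| ≤ 3/4 := by rw [abs_le]; constructor <;> linarith [x.1, x.2]
      exact ⟨(key _ q this).1 g'.ch, (key _ q this).2 g'.ck⟩
    have ev : ∀ᶠ q in 𝓝 p, ‖q - p‖ ≤ 1/8 := by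
      filter_upwards [ball_mem_nhds p (by norm_num : (0:ℝ) < 1/8)] with q hq
      rw [mem_ball_iff_norm] at hq; exact hq.le
    exact g.congr (ev.mono fun q hq => (loc q hq).1) (ev.mono fun q hq => (loc q hq).2)
      (loc _ (g.ck.trans hη8)).1 (loc _ (g.ch.trans hη8)).2
  · refine fA l (m p) p x1 x2 ?_
    have := m1 p; have := m2 p
    have r1 : m p < 2 * l + 2 := by
      have : (m p : ℝ) < ((2 * l + 2 : ℤ) : ℝ) := by push_cast; linarith
      exact_mod_cast this
    have r2 : 2 * l - 1 < m p := by
      have : ((2 * l - 1 : ℤ) : ℝ) < m p := by push_cast; linarith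
      exact_mod_cast this
    omega
  · refine fB l (m p) p x1 x2 ?_
    have := m1 p; have := m2 p
    have r1 : m p < 2 * l + 3 := by
      have : (m p : ℝ) < ((2 * l + 3 : ℤ) : ℝ) := by push_cast; linarith
      exact_mod_cast this
    have r2 : 2 * l < m p := by
      have : ((2 * l : ℤ) : ℝ) < m p := by push_cast; linarith
      exact_mod_cast this
    omega

def Pat (s w : ℝ) (x : ℝ) : Prop := ∃ l : ℤ, 2 * (l:ℝ) + 1 + s + w ≤ x ∧ x ≤ 2 * l + 2 + s - w

theorem Pat.mono {s w w' x y : ℝ} (H : Pat s w' x) (h : |y - x| ≤ w' - w) : Pat s w y := by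
  obtain ⟨l, h1, h2⟩ := H
  rw [abs_le] at h
  exact ⟨l, by linarith, by linarith⟩

theorem split2 (i : ι) {η : ℝ} (hη : 0 < η) (hη8 : η ≤ 1/8) : ∃ ε C : ℝ, ∃ K : ℕ, 0 < ε ∧ 1 ≤ C ∧
    ∀ h k : (ι → ℝ) → (ι → ℝ), ∃ h1 k1 h2 k2 : (ι → ℝ) → (ι → ℝ),
    ∀ p, ((∀ L, 1 ≤ L → (∀ q, ‖q - p‖ ≤ 2 → Gd L ε h k q) → 
        Gd (C * L ^ K) (2 * η) h1 k1 p ∧ Gd (C * L ^ K) (2 * η) h2 k2 p ∧ h2 (h1 p) = h p ∧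
        (Pat 0 η (p i) → h1 p = p ∧ k1 p = p) ∧ (Pat 1 η (p i) → h2 p = p ∧ k2 p = p)) ∧
    ((∀ q, ‖q - p‖ ≤ η → h q = q ∧ k q = q) → (h1 p = p ∧ k1 p = p) ∧ (h2 p = p ∧ k2 p = p))) := by
  obtain ⟨ε, C, K, ε0, hC, H⟩ := split1 i hη hη8
  refine ⟨min ε η, C, K + 1, by positivity, hC, fun h k => ?_⟩
  obtain ⟨h1, k1, a1, a2, a3, a4⟩ := H h k
  refine ⟨h1, k1, fun x => h (k1 x), fun x => h1 (k x), fun p => ⟨fun L hL hq => ?_, fun hq => ?_⟩⟩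
  · have L0 : 0 ≤ L := by linarith
    have pw := one_le_pow₀ hL (n := K)
    have C0 : 0 ≤ C * L ^ K := by positivity
    have G0 : ∀ q, ‖q - p‖ ≤ 2 → Gd L ε h k q := fun q h => (hq q h).mono le_rfl (min_le_left _ _)
    have G1 : ∀ q, ‖q - p‖ ≤ 1 → Gd (C * L ^ K) η h1 k1 q := fun q hq' =>
      a1 q L hL fun r hr => G0 r (by linarith [tri hr hq'])
    have gp := hq p (by simp)
    have gp1 := G1 p (by simp)
    have ck : ‖k p - p‖ ≤ η := gp.ck.trans (min_le_right _ _)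
    refine ⟨gp1.mono ?_ (by linarith), ?_, ?_, ?_, ?_⟩
    · rw [pow_succ]; nlinarith
    · have := Gd.comp L0 C0 (h2 := h) (k2 := k) (h1 := k1) (k1 := h1) (p := p)
        (hq (k1 p) (by linarith [gp1.ck])) gp gp1.symm (G1 (k p) (by linarith)).symm
      refine this.mono ?_ (by linarith [min_le_right ε η])
      rw [pow_succ]; apply le_of_eq; ring
    · change h (k1 (h1 p)) = _
      rw [gp1.kh]
    · rintro ⟨l, x1, x2⟩
      exact a4 p l (by linarith) (by linarith)
    · rintro ⟨l, x1, x2⟩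
      have c1 := (a3 p (l + 1) (by push_cast; linarith) (by push_cast; linarith)).2 (gp.ck.trans (min_le_left _ _))
      have y := abs_le.1 (ci ck i)
      have gk := G0 (k p) (by linarith)
      have c2 := (a3 (k p) (l + 1) (by push_cast; linarith [y.1]) (by push_cast; linarith [y.2])).1 gk.ch
      refine ⟨?_, ?_⟩
      · change h (k1 p) = p
        rw [c1, gp.hk]
      · change h1 (k p) = p
        rw [c2, gp.hk]
  · obtain ⟨b1, b2⟩ := a2 p hq
    obtain ⟨c1, c2⟩ := hq p (by simpa using hη.le)
    refine ⟨⟨b1, b2⟩, ?_, ?_⟩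
    · change h (k1 p) = p
      rw [b2, c1]
    · change h1 (k p) = p
      rw [c2, b1]

theorem floor_wall {s w x y : ℝ} (hw : w ≤ 1/4) (h : |x - y| ≤ 1/8)
    (hf : ⌊(x - s + 1/2) / 2⌋ ≠ ⌊(y - s + 1/2) / 2⌋) : Pat s w x ∧ Pat s w y := by
  wlog hl : ⌊(x - s + 1/2) / 2⌋ < ⌊(y - s + 1/2) / 2⌋ generalizing x y
  · exact (this (by rwa [abs_sub_comm]) hf.symm (lt_of_le_of_ne (not_lt.1 hl) hf.symm)).symm
  rw [abs_le] at h
  have h1 := Int.lt_floor_add_one ((x - s + 1/2) / 2)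
  have h2 := Int.floor_le ((y - s + 1/2) / 2)
  set a := ⌊(x - s + 1/2) / 2⌋
  set b := ⌊(y - s + 1/2) / 2⌋
  have h3 : (a:ℝ) + 1 ≤ b := by exact_mod_cast hl
  refine ⟨⟨b - 1, ?_, ?_⟩, ⟨b - 1, ?_, ?_⟩⟩ <;> push_cast <;> linarith

def nr (B : Set (ι → ℝ)) (D : ℝ) (p : ι → ℝ) : Prop := ∃ b ∈ B, ‖p - b‖ ≤ D

theorem nr.tri {B : Set (ι → ℝ)} {D a : ℝ} {p q : ι → ℝ} (h : nr B D p) (hq : ‖q - p‖ ≤ a) : nr B (a + D) q := by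
  obtain ⟨b, hb, h⟩ := h
  exact ⟨b, hb, CDE.tri hq h⟩

theorem nr.mono {B : Set (ι → ℝ)} {D D' : ℝ} {p : ι → ℝ} (h : nr B D p) (hD : D ≤ D') : nr B D' p := by
  obtain ⟨b, hb, h⟩ := h
  exact ⟨b, hb, h.trans hD⟩

theorem glue0 {w : ℝ} (hw : w ≤ 1/4) (s : ι → ℝ) (B : Set (ι → ℝ)) (h k : (ι → ℝ) → (ι → ℝ)) {L : ℝ} (hL : 1 ≤ L)
    (h1 : ∀ p, nr B 4 p → Gd L (1/8) h k p)
    (h2 : ∀ p, nr B 4 p → ∀ j, Pat (s j) w (p j) → h p = p ∧ k p = p) :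
    ∃ h' k' : (ι → ℝ) → (ι → ℝ), (∀ p, Gd L (1/8) h' k' p) ∧ (∀ p, nr B 1 p → h' p = h p) ∧
      (∀ p, ¬ nr B 4 p → h' p = p) := by
  classical
  let c : (ι → ℝ) → ι → ℤ := fun p j => ⌊(p j - s j + 1/2) / 2⌋
  let sel : (ι → ℝ) → Prop := fun p => ∃ q, c q = c p ∧ nr B 1 q
  let F : ((ι → ℝ) → (ι → ℝ)) → (ι → ℝ) → (ι → ℝ) := fun h p => if sel p then h p else p
  have Fs : ∀ h p, sel p → F h p = h p := fun h p hp => if_pos hp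
  have Fn : ∀ h p, ¬ sel p → F h p = p := fun h p hp => if_neg hp
  have sn : ∀ p, sel p → nr B 3 p := by
    rintro p ⟨q, e, hq⟩
    have : ‖p - q‖ ≤ 2 := by
      rw [pi_norm_le_iff_of_nonneg (by norm_num)]
      intro j
      have e := congrFun e j
      simp only [c] at e
      rw [Pi.sub_apply, Real.norm_eq_abs]
      have := Int.abs_sub_lt_one_of_floor_eq_floor e.symm
      rw [abs_lt] at this; rw [abs_le]; constructor <;> linarith [this.1, this.2]
    exact (hq.tri this).mono (by norm_num)
  have loc : ∀ p q, ‖q - p‖ ≤ 1/8 → (sel p → F h q = h q ∧ F k q = k q) ∧ (¬ sel p → F h q = q ∧ F k q = q) := by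
    intro p q hq
    by_cases e : c q = c p
    · have : sel q ↔ sel p := by simp only [sel, e]
      exact ⟨fun hp => ⟨Fs _ _ (this.2 hp), Fs _ _ (this.2 hp)⟩,
        fun hp => ⟨Fn _ _ (fun x => hp (this.1 x)), Fn _ _ (fun x => hp (this.1 x))⟩⟩
    · obtain ⟨j, hj⟩ := Function.ne_iff.1 e
      obtain ⟨w1, w2⟩ := floor_wall hw (ci hq j) hj
      have fx : sel p ∨ sel q → h q = q ∧ k q = q := by
        rintro (hp | hp)
        · exact h2 q (((sn p hp).tri hq).mono (by norm_num)) j w1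
        · exact h2 q ((sn q hp).mono (by norm_num)) j w1
      constructor
      · intro hp
        obtain ⟨x1, x2⟩ := fx (Or.inl hp)
        by_cases hs : sel q
        · exact ⟨Fs _ _ hs, Fs _ _ hs⟩
        · rw [Fn _ _ hs, Fn _ _ hs, x1, x2]; exact ⟨rfl, rfl⟩
      · intro hp
        by_cases hs : sel q
        · rw [Fs _ _ hs, Fs _ _ hs]; exact fx (Or.inr hs)
        · exact ⟨Fn _ _ hs, Fn _ _ hs⟩
  refine ⟨F h, F k, fun p => ?_, fun p hp => Fs _ _ ⟨p, rfl, hp⟩, fun p hp => Fn _ _ fun hs => hp ((sn p hs).mono (by norm_num))⟩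
  have ev : ∀ᶠ q in 𝓝 p, ‖q - p‖ ≤ 1/8 := by
    filter_upwards [ball_mem_nhds p (by norm_num : (0:ℝ) < 1/8)] with q hq
    rw [mem_ball_iff_norm] at hq; exact hq.le
  by_cases hs : sel p
  · have g := h1 p ((sn p hs).mono (by norm_num))
    exact g.congr (ev.mono fun q hq => ((loc p q hq).1 hs).1) (ev.mono fun q hq => ((loc p q hq).1 hs).2)
      ((loc p _ g.ck).1 hs).1 ((loc p _ g.ch).1 hs).2
  · have z : ‖p - p‖ ≤ 1/8 := by simp
    exact (Gd.idd hL (by norm_num) p).congr (ev.mono fun q hq => ((loc p q hq).2 hs).1)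
      (ev.mono fun q hq => ((loc p q hq).2 hs).2) ((loc p p z).2 hs).1 ((loc p p z).2 hs).2

theorem glueI (I : Finset ι) : ∀ w : ℝ, 0 < w → w < 1/4 → ∃ ε C D E : ℝ, ∃ K : ℕ, 0 < ε ∧ 1 ≤ C ∧ 1 ≤ D ∧ 0 < E ∧
    ∀ (s : ι → ℝ) (B : Set (ι → ℝ)) (h k : (ι → ℝ) → (ι → ℝ)) (L : ℝ), 1 ≤ L →
    (∀ p, nr B D p → Gd L ε h k p) →
    (∀ p, nr B D p → ∀ j, j ∉ I → Pat (s j) w (p j) → h p = p ∧ k p = p) →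
    ∃ h' k' : (ι → ℝ) → (ι → ℝ), (∀ p, Gd (C * L ^ K) E h' k' p) ∧ (∀ p, nr B 1 p → h' p = h p) ∧
      (∀ p, ¬ nr B D p → h' p = p) := by
  induction I using Finset.induction_on with
  | empty =>
    intro w w0 w4
    refine ⟨1/8, 1, 4, 1/8, 1, by norm_num, le_rfl, by norm_num, by norm_num, fun s B h k L hL h1 h2 => ?_⟩
    simpa using glue0 w4.le s B h k hL h1 fun p hp j => h2 p hp j (by simp)
  | insert i I hi ih =>
    intro w w0 w4
    obtain ⟨ε', C', D', E', K', ε0', hC', hD', hE', H⟩ := ih ((w + 1/4) / 2) (by linarith) (by linarith)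
    set η := min (ε' / 2) (min (1/8) ((1/4 - w) / 2)) with hη
    have η0 : 0 < η := by
      rw [hη]; refine lt_min (by linarith) (lt_min (by norm_num) (by linarith))
    have η1 : η ≤ ε' / 2 := min_le_left _ _
    have η2 : η ≤ 1/8 := (min_le_right _ _).trans (min_le_left _ _)
    have η3 : η ≤ (1/4 - w) / 2 := (min_le_right _ _).trans (min_le_right _ _)
    obtain ⟨ε, C, K, ε0, hC, S⟩ := split2 i η0 η2
    refine ⟨ε, (C' * C ^ K') * (C' * C ^ K'), D' + 3, E' + E', K * K' + K * K', ε0, ?_, by linarith, by linarith, fun s B h k L hL g1 g2 => ?_⟩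
    · have := one_le_pow₀ hC (n := K')
      have : 1 ≤ C' * C ^ K' := by nlinarith
      nlinarith
    · obtain ⟨h1, k1, h2, k2, G⟩ := S h k
      have b1 : ∀ p, nr {q | nr B 1 q} D' p → nr B (D' + 1) p := by
        rintro p ⟨q, hq, hp⟩
        exact nr.tri hq hp
      have r1 : ∀ p, nr {q | nr B 1 q} D' p → _ := fun p hp => (G p).1 L hL fun q hq => 
        g1 q (((b1 p hp).tri hq).mono (by linarith))
      have r2 : ∀ p, nr {q | nr B 1 q} D' p → ∀ j, j ∉ insert i I → Pat (s j) ((w + 1/4) / 2) (p j) → _ := 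
        fun p hp j hj hpat => (G p).2 fun q hq => g2 q (((b1 p hp).tri hq).mono (by linarith)) j hj 
          (hpat.mono ((ci hq j).trans (by linarith)))
      have LL : 1 ≤ C * L ^ K := by have := one_le_pow₀ hL (n := K); nlinarith
      have pat : ∀ t x, Pat t ((w + 1/4) / 2) x → Pat t η x := fun t x hx => hx.mono (by simp; linarith)
      obtain ⟨F1, X1, u1, u2, u3⟩ := H (Function.update s i 0) {q | nr B 1 q} h1 k1 (C * L ^ K) LL 
        (fun p hp => (r1 p hp).1.mono le_rfl (by linarith)) (fun p hp j hj hpat => by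
          by_cases e : j = i
          · subst e; rw [Function.update_self] at hpat
            exact (r1 p hp).2.2.2.1 (pat _ _ hpat)
          · rw [Function.update_of_ne e] at hpat
            exact (r2 p hp j (by simp [e, hj]) hpat).1)
      obtain ⟨F2, X2, v1, v2, v3⟩ := H (Function.update s i 1) {q | nr B 1 q} h2 k2 (C * L ^ K) LL 
        (fun p hp => (r1 p hp).2.1.mono le_rfl (by linarith)) (fun p hp j hj hpat => by
          by_cases e : j = i
          · subst e; rw [Function.update_self] at hpat
            exact (r1 p hp).2.2.2.2 (pat _ _ hpat)
          · rw [Function.update_of_ne e] at hpat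
            exact (r2 p hp j (by simp [e, hj]) hpat).2)
      refine ⟨fun p => F2 (F1 p), fun p => X1 (X2 p), fun p => ?_, fun p hp => ?_, fun p hp => ?_⟩
      · have P0 : 0 ≤ C' * (C * L ^ K) ^ K' := by positivity
        refine (Gd.comp P0 P0 (v1 _) (v1 p) (u1 p) (u1 _)).mono (le_of_eq ?_) le_rfl
        rw [mul_pow, ← pow_mul, pow_add]; ring
      · have q1 : nr {q | nr B 1 q} 0 p := ⟨p, hp, by simp⟩
        have R := r1 p (q1.mono (by linarith))
        change F2 (F1 p) = h p
        rw [u2 p (q1.mono (by norm_num)), v2 _ ((q1.tri R.1.ch).mono (by linarith)), R.2.2.1]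
      · have : ¬ nr {q | nr B 1 q} D' p := fun hh => hp ((b1 p hh).mono (by linarith))
        change F2 (F1 p) = p
        rw [u3 p this, v3 p this]

theorem glueAll : ∃ ε C D E : ℝ, ∃ K : ℕ, 0 < ε ∧ 1 ≤ C ∧ 1 ≤ D ∧ 0 < E ∧
    ∀ (B : Set (ι → ℝ)) (h k : (ι → ℝ) → (ι → ℝ)) (L : ℝ), 1 ≤ L →
    (∀ p, nr B D p → Gd L ε h k p) →
    ∃ h' k' : (ι → ℝ) → (ι → ℝ), (∀ p, Gd (C * L ^ K) E h' k' p) ∧ (∀ p, nr B 1 p → h' p = h p) ∧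
      (∀ p, ¬ nr B D p → h' p = p) := by
  obtain ⟨ε, C, D, E, K, a, b, c, d, H⟩ := glueI (Finset.univ : Finset ι) (1/8) (by norm_num) (by norm_num)
  exact ⟨ε, C, D, E, K, a, b, c, d, fun B h k L hL g => H 0 B h k L hL g fun p hp j hj => absurd (Finset.mem_univ j) hj⟩

end split
end CDE

namespace CDE

section fin
variable {E F : Type*} [NormedAddCommGroup E] [NormedSpace ℝ E] [NormedAddCommGroup F] [NormedSpace ℝ F]

theorem conj2 {T : E → F} {T' : F → E} {a b : ℝ} (ha : 0 ≤ a) (hb : 0 ≤ b)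
    (tt' : ∀ x, T (T' x) = x) (t't : ∀ x, T' (T x) = x)
    (l1 : ∀ x y, ‖T x - T y‖ ≤ a * ‖x - y‖) (l2 : ∀ x y, ‖T' x - T' y‖ ≤ b * ‖x - y‖)
    {L ε : ℝ} (hL : 0 ≤ L) {h k : E → E} {x : F} (H : Gd L ε h k (T' x)) :
    Gd (a * L * b) (a * ε) (fun y => T (h (T' y))) (fun y => T (k (T' y))) x := by
  have c : ∀ h : E → E, ‖h (T' x) - T' x‖ ≤ ε → ‖T (h (T' x)) - x‖ ≤ a * ε := fun h hh => by
    have := l1 (h (T' x)) (T' x)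
    rw [tt'] at this
    exact this.trans (by gcongr)
  have cT : Continuous T' := by
    refine (LipschitzWith.of_dist_le_mul (K := ⟨b, hb⟩) fun x y => ?_).continuous
    rw [dist_eq_norm, dist_eq_norm]; exact l2 x y
  have l : ∀ h : E → E, PL L h (T' x) → PL (a * L * b) (fun y => T (h (T' y))) x := fun h hh => by
    filter_upwards [cT.continuousAt.eventually hh] with q hq
    calc _ ≤ a * ‖h (T' q) - h (T' x)‖ := l1 _ _
      _ ≤ a * (L * (b * ‖q - x‖)) := by gcongr; exact hq.trans (by gcongr; exact l2 _ _)
      _ = _ := by ring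
  exact ⟨c h H.ch, c k H.ck, by simp only [t't, H.hk, tt'], by simp only [t't, H.kh, tt'], l h H.lh, l k H.lk⟩

theorem PL.glob {M : ℝ} {f : E → E} (H : ∀ p, PL M f p) (x y : E) : ‖f x - f y‖ ≤ M * ‖x - y‖ := by
  have cf : Continuous f := continuous_iff_continuousAt.2 fun p => (H p).cont
  let g : ℝ → E := fun t => y + t • (x - y)
  have cg : Continuous g := by fun_prop
  have gg : ∀ s t, g s - g t = (s - t) • (x - y) := fun s t => by simp only [g]; rw [sub_smul]; abel
  have key := image_le_of_liminf_slope_right_le_deriv_boundary (f := fun t => ‖f (g t) - f y‖)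
    (a := 0) (b := 1) (B := fun t => M * ‖x - y‖ * t) (B' := fun _ => M * ‖x - y‖)
    (by fun_prop) (by simp [g]) (by fun_prop)
    (fun t _ => by simpa using ((hasDerivAt_id t).const_mul (M * ‖x - y‖)).hasDerivWithinAt)
    (fun t _ r hr => by
      refine Filter.Eventually.frequently ?_
      have := nhdsWithin_le_nhds (s := Ioi t) (cg.continuousAt.eventually (H (g t)))
      filter_upwards [this, self_mem_nhdsWithin] with s hs hst
      have hst : t < s := hst
      rw [gg, norm_smul, Real.norm_eq_abs, abs_of_pos (sub_pos.2 hst)] at hs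
      rw [slope_def_field, div_lt_iff₀ (sub_pos.2 hst)]
      have h1 : ‖f (g s) - f y‖ - ‖f (g t) - f y‖ ≤ ‖f (g s) - f (g t)‖ := by
        have := norm_sub_norm_le (f (g s) - f y) (f (g t) - f y)
        simpa using this
      have : 0 < s - t := sub_pos.2 hst
      nlinarith)
  have := key (x := 1) (by simp)
  simpa [g] using this

theorem emb_open {X Y : Type*} [MetricSpace X] [MetricSpace Y] {f : X → Y} (H : IsOpenLipschitzEmbedding f) :
    IsOpenEmbedding f := by
  obtain ⟨⟨inj, lf, g, hg, lg⟩, ho⟩ := H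
  refine IsOpenEmbedding.of_continuous_injective_isOpenMap lf.continuous inj fun O hO => ?_
  have e : f '' O = Subtype.val '' (g ⁻¹' O) := by
    ext y; constructor
    · rintro ⟨x, hx, rfl⟩
      refine ⟨Set.rangeFactorization f x, ?_, rfl⟩
      change g _ ∈ O
      rw [hg x]; exact hx
    · rintro ⟨⟨y, x, rfl⟩, hy, rfl⟩
      have : g (Set.rangeFactorization f x) ∈ O := hy
      rw [hg x] at this
      exact ⟨x, this, rfl⟩
  rw [e]
  exact ho.isOpenMap_subtype_val _ (hO.preimage lg.continuous)

theorem deep {U : Set E} (hU : IsOpen U) [FiniteDimensional ℝ E] {L δ : ℝ} (hL : 1 ≤ L) (hδ : 0 < δ) (h : U → E)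
    (H : IsOpenLipschitzEmbedding h) (H2 : IsLocallyBiLipschitzWith L h) (H3 : ∀ x : U, dist (h x) (x : E) < δ) :
    ∃ f k : E → E, (∀ x : U, f x = h x) ∧ ∀ x, closedBall x (2 * δ) ⊆ U → Gd L δ f k x := by
  classical
  have oe := emb_open H
  let f : E → E := fun x => if hx : x ∈ U then h ⟨x, hx⟩ else x
  let k : E → E := fun y => if hy : ∃ x : U, h x = y then (hy.choose : E) else y
  have ff : ∀ x : U, f x = h x := fun x => by simp [f]
  have kk : ∀ x : U, k (h x) = x := fun x => by
    have hy : ∃ x' : U, h x' = h x := ⟨x, rfl⟩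
    have e : k (h x) = hy.choose := dif_pos hy
    rw [e, oe.injective hy.choose_spec]
  refine ⟨f, k, ff, fun x hx => ?_⟩
  have xU : x ∈ U := hx (mem_closedBall_self (by linarith))
  have xr : x ∈ Set.range h := by
    let Cc : Set U := {u | (u : E) ∈ closedBall x (2 * δ)}
    let W : Set U := {u | (u : E) ∈ ball x (2 * δ)}
    have cC : IsCompact Cc := by
      have : IsCompact ((Subtype.val : U → E) '' Cc) := by
        have e : (Subtype.val : U → E) '' Cc = closedBall x (2 * δ) := by
          ext y; constructor
          · rintro ⟨u, hu, rfl⟩; exact hu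
          · intro hy; exact ⟨⟨y, hx hy⟩, hy, rfl⟩
        rw [e]; exact isCompact_closedBall x _
      exact (Subtype.isCompact_iff (s := Cc)).2 this
    have oW : IsOpen (h '' W) := oe.isOpenMap _ (isOpen_ball.preimage continuous_subtype_val)
    have oV : IsOpen (h '' Cc)ᶜ := (cC.image oe.continuous).isClosed.isOpen_compl
    have sub : ball x δ ⊆ h '' W := by
      refine IsPreconnected.subset_left_of_subset_union oW oV ?_ ?_ ?_ (convex_ball x δ).isPreconnected
      · refine Set.disjoint_left.2 ?_
        rintro _ ⟨u, hu, rfl⟩ hv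
        exact hv ⟨u, ball_subset_closedBall hu, rfl⟩
      · intro z hz
        by_cases hc : z ∈ h '' Cc
        · left
          obtain ⟨u, hu, rfl⟩ := hc
          refine ⟨u, ?_, rfl⟩
          change dist (u : E) x < 2 * δ
          have := H3 u
          rw [dist_comm] at this
          have h2 : dist (h u) x < δ := hz
          linarith [dist_triangle (u : E) (h u) x]
        · exact Or.inr hc
      · exact ⟨h ⟨x, xU⟩, H3 ⟨x, xU⟩, ⟨x, xU⟩, mem_ball_self (by linarith), rfl⟩
    obtain ⟨u, -, e⟩ := sub (mem_ball_self hδ)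
    exact ⟨u, e⟩
  obtain ⟨y, hy⟩ := xr
  have kx : k x = y := by rw [← hy]; exact kk y
  refine ⟨?_, ?_, ?_, ?_, ?_, ?_⟩
  · rw [ff ⟨x, xU⟩, ← dist_eq_norm]; exact (H3 ⟨x, xU⟩).le
  · rw [kx, ← dist_eq_norm, dist_comm]
    have := H3 y
    rw [hy] at this; exact this.le
  · rw [kx, ff, hy]
  · have := kk ⟨x, xU⟩
    rwa [← ff] at this
  · obtain ⟨O, hO, hl⟩ := H2 ⟨x, xU⟩
    rw [nhds_subtype_eq_comap] at hO
    obtain ⟨V, hV, hVO⟩ := hO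
    filter_upwards [hV, hU.mem_nhds xU] with q hq hqU
    have := (hl ⟨q, hqU⟩ (hVO hq) ⟨x, xU⟩ (hVO (by exact mem_of_mem_nhds (x := x) hV))).2
    rw [← ff, ← ff, dist_eq_norm, Subtype.dist_eq, dist_eq_norm] at this
    exact this
  · obtain ⟨O, hO, hl⟩ := H2 y
    have := oe.isOpenMap.image_mem_nhds hO
    rw [hy] at this
    filter_upwards [this] with q hq
    obtain ⟨u, hu, rfl⟩ := hq
    rw [kk, kx]
    have := (hl u hu y (mem_of_mem_nhds hO)).1
    rw [hy, div_le_iff₀ (by linarith), dist_eq_norm, Subtype.dist_eq, dist_eq_norm] at this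
    linarith

theorem final {ι : Type*} [Fintype ι] [DecidableEq ι] [FiniteDimensional ℝ E] (Φ : E ≃L[ℝ] (ι → ℝ)) :
    ∃ C K : ℝ, 1 ≤ C ∧ 1 ≤ K ∧
      ∀ U : Set E, IsOpen U → ∀ B B' : Set E, IsCompact B → IsCompact B' →
      ∀ (hBU : B ⊆ U), B ⊆ interior B' → B' ⊆ U → ∀ L : ℝ, 1 ≤ L →
      ∃ δ₀ > (0:ℝ), ∃ χ : ℝ → ℝ, IsModulus χ ∧
        ∀ δ : ℝ, 0 < δ → δ ≤ δ₀ → ∀ h : ↥U → E,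
            IsOpenLipschitzEmbedding h → IsLocallyBiLipschitzWith L h →
            (∀ x : ↥U, dist (h x) (x : E) < δ) →
            ∃ h' : E → E, Function.Bijective h' ∧ IsBiLipschitzWith (C * L ^ K) h' ∧
              (∀ x (hx : x ∈ B), h' x = h ⟨x, hBU hx⟩) ∧
              (∀ x ∉ B', h' x = x) ∧ (∀ x, dist (h' x) x ≤ χ δ) := by
  obtain ⟨ε, C, D, R, K, ε0, hC, hD, hR, G⟩ := glueAll (ι := ι)
  obtain ⟨N, hN, n1, n2⟩ : ∃ N : ℝ, 1 ≤ N ∧ (∀ x, ‖Φ x‖ ≤ N * ‖x‖) ∧ (∀ x, ‖Φ.symm x‖ ≤ N * ‖x‖) := by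
    refine ⟨max 1 (max ‖(Φ : E →L[ℝ] (ι → ℝ))‖ ‖(Φ.symm : (ι → ℝ) →L[ℝ] E)‖), le_max_left _ _, fun x => ?_, fun x => ?_⟩
    · refine ((Φ : E →L[ℝ] (ι → ℝ)).le_opNorm x).trans ?_
      gcongr; exact (le_max_left _ _).trans (le_max_right _ _)
    · refine ((Φ.symm : (ι → ℝ) →L[ℝ] E).le_opNorm x).trans ?_
      gcongr; exact (le_max_right _ _).trans (le_max_right _ _)
  have N0 : 0 < N := by linarith
  have N2 : 1 ≤ N * N := by nlinarith
  set A := N / ε with hA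
  have A0 : 0 < A := by positivity
  refine ⟨N * N * C * (N * N) ^ K, ((K + 1 : ℕ) : ℝ), ?_, by push_cast; linarith [Nat.cast_nonneg (α := ℝ) K], ?_⟩
  · have := one_le_pow₀ N2 (n := K)
    have : 1 ≤ N * N * C := by nlinarith
    nlinarith
  intro U hU B B' cB cB' hBU hBB' hB'U L hL
  obtain ⟨r, r0, hr⟩ := cB.exists_cthickening_subset_open isOpen_interior hBB'
  have q0 : 0 < N * A * D + 2 := by positivity
  refine ⟨r / (N * A * D + 2), by positivity, fun x => max 0 (N * A * R * x), ?_, ?_⟩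
  · refine ⟨by fun_prop, fun x y hxy => ?_, by simp, fun x => le_max_left _ _⟩
    have : 0 ≤ N * A * R := by positivity
    exact max_le_max le_rfl (by gcongr)
  intro δ δ0 hδ h H1 H2 H3
  rw [le_div_iff₀ q0] at hδ
  have near : ∀ b ∈ B, ∀ y, dist y b ≤ r → y ∈ B' := fun b hb y hy =>
    interior_subset (hr (mem_cthickening_of_dist_le y b r B hb hy))
  obtain ⟨f, k, ff, fk⟩ := deep hU hL δ0 h H1 H2 H3
  set μ := A * δ with hμ
  have μ0 : 0 < μ := by positivity
  let T : E → (ι → ℝ) := fun x => μ⁻¹ • Φ x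
  let T' : (ι → ℝ) → E := fun x => Φ.symm (μ • x)
  have tt' : ∀ x, T (T' x) = x := fun x => by simp [T, T', smul_smul, μ0.ne']
  have t't : ∀ x, T' (T x) = x := fun x => by simp [T, T', smul_smul, μ0.ne']
  have l1 : ∀ x y, ‖T x - T y‖ ≤ (μ⁻¹ * N) * ‖x - y‖ := fun x y => by
    simp only [T]
    rw [← smul_sub, ← map_sub, norm_smul, Real.norm_eq_abs, abs_of_pos (inv_pos.2 μ0), mul_assoc]
    gcongr; exact n1 _
  have l2 : ∀ x y, ‖T' x - T' y‖ ≤ (N * μ) * ‖x - y‖ := fun x y => by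
    simp only [T']
    rw [← map_sub, ← smul_sub]
    refine (n2 _).trans ?_
    rw [norm_smul, Real.norm_eq_abs, abs_of_pos μ0]; exact le_of_eq (by ring)
  have ab : (μ⁻¹ * N) * L * (N * μ) = N * N * L := by field_simp
  have aδ : (μ⁻¹ * N) * δ = ε := by rw [hμ, hA]; field_simp
  have nrr : ∀ p, nr (T '' B) D p → ∃ b ∈ B, dist (T' p) b ≤ N * A * D * δ := by
    rintro p ⟨_, ⟨b, hb, rfl⟩, hp⟩
    refine ⟨b, hb, ?_⟩
    have := l2 p (T b)
    rw [t't] at this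
    rw [dist_eq_norm]
    calc _ ≤ N * μ * ‖p - T b‖ := this
      _ ≤ N * μ * D := by gcongr
      _ = _ := by rw [hμ]; ring
  have L2 : 1 ≤ N * N * L := by nlinarith
  obtain ⟨h', k', g1, g2, g3⟩ := G (T '' B) (fun y => T (f (T' y))) (fun y => T (k (T' y))) (N * N * L) L2
    (fun p hp => by
      obtain ⟨b, hb, hd⟩ := nrr p hp
      have := conj2 (a := μ⁻¹ * N) (b := N * μ) (by positivity) (by positivity) tt' t't l1 l2 (by linarith)
        (fk (T' p) fun y hy => hB'U (near b hb y (by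
          rw [mem_closedBall] at hy
          linarith [dist_triangle y (T' p) b])))
      rwa [ab, aδ] at this)
  set M := C * (N * N * L) ^ K with hM
  have M0 : 0 ≤ M := by positivity
  have gE : ∀ x, Gd (N * N * M) (N * A * R * δ) (fun x => T' (h' (T x))) (fun x => T' (k' (T x))) x := fun x => by
    have := conj2 (a := N * μ) (b := μ⁻¹ * N) (by positivity) (by positivity) t't tt' l2 l1 M0 (g1 (T x))
    have e1 : N * μ * M * (μ⁻¹ * N) = N * N * M := by field_simp
    have e2 : N * μ * R = N * A * R * δ := by rw [hμ]; ring
    rwa [e1, e2] at this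
  set C' := N * N * C * (N * N) ^ K * L ^ ((K + 1 : ℕ) : ℝ) with hC'
  have MC : N * N * M ≤ C' := by
    rw [hM, hC', Real.rpow_natCast, mul_pow, pow_succ]
    have := pow_pos (by linarith : 0 < L) K
    calc N * N * (C * ((N * N) ^ K * L ^ K)) = N * N * C * (N * N) ^ K * (L ^ K * 1) := by ring
      _ ≤ _ := by gcongr
  have C0 : 0 < C' := by rw [hC']; have := Real.rpow_pos_of_pos (by linarith : 0 < L) ((K + 1 : ℕ) : ℝ); positivity
  have lipH := PL.glob fun p => (gE p).lh.mono MC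
  have lipK := PL.glob fun p => (gE p).lk.mono MC
  refine ⟨fun x => T' (h' (T x)), ?_, ?_, ?_, ?_, ?_⟩
  · exact Function.bijective_iff_has_inverse.2 ⟨fun x => T' (k' (T x)), fun x => (gE x).kh, fun x => (gE x).hk⟩
  · intro x y
    rw [dist_eq_norm, dist_eq_norm]
    refine ⟨?_, lipH x y⟩
    rw [div_le_iff₀ C0]
    have := lipK (T' (h' (T x))) (T' (h' (T y)))
    have e1 : T' (k' (T (T' (h' (T x))))) = x := (gE x).kh
    have e2 : T' (k' (T (T' (h' (T y))))) = y := (gE y).kh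
    rw [e1, e2] at this
    linarith
  · intro x hx
    have := g2 (T x) ⟨T x, ⟨x, hx, rfl⟩, by simp⟩
    change T' (h' (T x)) = _
    rw [this, t't, t't]
    exact ff ⟨x, hBU hx⟩
  · intro x hx
    change T' (h' (T x)) = _
    rw [g3 (T x), t't]
    intro hn
    obtain ⟨b, hb, hd⟩ := nrr _ hn
    rw [t't] at hd
    exact hx (near b hb x (by linarith))
  · intro x
    rw [dist_eq_norm]
    exact (gE x).ch.trans (le_max_right _ _)

end fin
end CDE

/-- Proposition 6.1 (Tukia–Väisälä): controlled deformation of Lipschitz embeddings of open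
subsets of `ℝⁿ`.  For every `n ≥ 1` there are constants `C = C(n), K = K(n) ≥ 1` such that any
locally `L`-bi-Lipschitz open Lipschitz embedding `h : U → ℝⁿ` sufficiently close to the
inclusion can be replaced by a `C L ^ K`-bi-Lipschitz homeomorphism `h' : ℝⁿ → ℝⁿ` with
`h' = h` on `B`, `h' = id` outside `B'`, and `h'` `χ(δ)`-close to the identity. -/
theorem controlled_deformation_euclidean :
    ∀ n : ℕ, 1 ≤ n → ∃ C K : ℝ, 1 ≤ C ∧ 1 ≤ K ∧
      ∀ U : Set (EuclideanSpace ℝ (Fin n)), IsOpen U →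
      ∀ B B' : Set (EuclideanSpace ℝ (Fin n)), IsCompact B → IsCompact B' →
      ∀ (hBU : B ⊆ U), B ⊆ interior B' → B' ⊆ U →
      ∀ L : ℝ, 1 ≤ L →
      ∃ δ₀ > (0:ℝ), ∃ χ : ℝ → ℝ, IsModulus χ ∧
        ∀ δ : ℝ, 0 < δ → δ ≤ δ₀ →
          ∀ h : ↥U → EuclideanSpace ℝ (Fin n),
            IsOpenLipschitzEmbedding h → IsLocallyBiLipschitzWith L h →
            (∀ x : ↥U, dist (h x) (x : EuclideanSpace ℝ (Fin n)) < δ) →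
            ∃ h' : EuclideanSpace ℝ (Fin n) → EuclideanSpace ℝ (Fin n),
              Function.Bijective h' ∧ IsBiLipschitzWith (C * L ^ K) h' ∧
              (∀ x (hx : x ∈ B), h' x = h ⟨x, hBU hx⟩) ∧
              (∀ x ∉ B', h' x = x) ∧
              (∀ x, dist (h' x) x ≤ χ δ) := by
  intro n hn
  exact CDE.final (EuclideanSpace.equiv (Fin n) ℝ)
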